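/- arXiv:1012.3673 — 2 statements merged into one kernel-verified Lean document; each statement's English description precedes it below -/
import Mathlib

section
/- Let 0 < R < T, γ > 0, M > 0, and set A = {x : R ≤ |x| ≤ (R+T)/2} and K = {(x,t) : R ≤ |x| ≤ (R+T)/2, |x| ≤ t ≤ R+T−|x|}. There exists δ > 0, depending only on γ, R, T and M, with the following property. Let q₁, q₂ be C⁸ functions on ℝ³ with q₁ − q₂ ∈ Q_γ(R,T), and let u₁, u₂ be C² solutions of the Goursat problems for q₁ and q₂ respectively on the cone {(x,t) : t ≥ |x|}; set v(x,t) = |x|(u₁(x,t) − u₂(x,t)) and v₂(x,t) = |x| u₂(x,t), and suppose the C¹ norm of q₁ on A and the C¹ norm of v₂ on K are both at most M. If for some R* ∈ [R, (R+T)/2] both v and ∂_r v vanish at every point of the cylinder {(x,t) : |x| = R*, R* ≤ t ≤ R* + 2δ}, then q₁ = q₂ on {x : R* ≤ |x| ≤ min(R* + δ, (R+T)/2)}. -/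
noncomputable section

open Real MeasureTheory Metric Set

/-- Euclidean 3-space. -/
abbrev E3 : Type := EuclideanSpace ℝ (Fin 3)

/-- The `i`-th standard basis vector of `ℝ³`. -/
def basis3 (i : Fin 3) : E3 := EuclideanSpace.single i 1

/-- The partial derivative `∂ᵢ f` of a function on `ℝ³`. -/
def pd (i : Fin 3) (f : E3 → ℝ) (x : E3) : ℝ := fderiv ℝ f x (basis3 i)

/-- The Laplacian `Δf` on `ℝ³`. -/
def lap (f : E3 → ℝ) (x : E3) : ℝ := ∑ i, pd i (pd i f) x

/-- The radial derivative `∂_r f(x) = (x/|x|)·∇f(x)`. -/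
def pdr (f : E3 → ℝ) (x : E3) : ℝ := ‖x‖⁻¹ * ∑ i, x i * pd i f x

/-- The angular derivative `Ω_{ij} f = xᵢ ∂ⱼ f − xⱼ ∂ᵢ f`. -/
def ang (i j : Fin 3) (f : E3 → ℝ) (x : E3) : ℝ := x i * pd j f x - x j * pd i f x

/-- `Ω f = Σ_{i<j} Ω_{ij}(Ω_{ij} f)`. -/
def angLap (f : E3 → ℝ) (x : E3) : ℝ :=
  ∑ i, ∑ j, if i < j then ang i j (ang i j f) x else 0

/-- The squared length `|∇f(x)|²` of the gradient. -/
def gradsq (f : E3 → ℝ) (x : E3) : ℝ := ∑ i, (pd i f x) ^ 2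

/-- `Σ_{i<j} (Ω_{ij} g)²`. -/
def angsq (g : E3 → ℝ) (x : E3) : ℝ := ∑ i, ∑ j, if i < j then (ang i j g x) ^ 2 else 0

/-- `Σ_{i<j} Σ_{k<l} (Ω_{kl} Ω_{ij} g)²`. -/
def angsq2 (g : E3 → ℝ) (x : E3) : ℝ :=
  ∑ i, ∑ j, ∑ k, ∑ l, if i < j ∧ k < l then (ang k l (ang i j g) x) ^ 2 else 0

/-- The time derivative `∂_t u` of a space-time function. -/
def pdt (u : E3 × ℝ → ℝ) (p : E3 × ℝ) : ℝ := fderiv ℝ u p (0, 1)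

/-- The spatial slice `x ↦ u(x,t)` of a space-time function, at fixed time `t`. -/
def fixT (u : E3 × ℝ → ℝ) (t : ℝ) : E3 → ℝ := fun y => u (y, t)

/-- The spatial partial derivative `∂ᵢ u` of a space-time function (`t` fixed). -/
def pdx (i : Fin 3) (u : E3 × ℝ → ℝ) (p : E3 × ℝ) : ℝ := pd i (fixT u p.2) p.1

/-- The spatial radial derivative `∂_r u` of a space-time function (`t` fixed). -/
def pdrX (u : E3 × ℝ → ℝ) (p : E3 × ℝ) : ℝ := pdr (fixT u p.2) p.1

/-- The spatial angular derivative `Ω_{ij} u` of a space-time function (`t` fixed). -/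
def angX (i j : Fin 3) (u : E3 × ℝ → ℝ) (p : E3 × ℝ) : ℝ := ang i j (fixT u p.2) p.1

/-- The spatial operator `Ω u` of a space-time function (`t` fixed). -/
def angLapX (u : E3 × ℝ → ℝ) (p : E3 × ℝ) : ℝ := angLap (fixT u p.2) p.1

/-- The spatial Laplacian `Δu` of a space-time function (`t` fixed). -/
def lapX (u : E3 × ℝ → ℝ) (p : E3 × ℝ) : ℝ := lap (fixT u p.2) p.1

/-- The squared spatial gradient `|∇u|²` of a space-time function (`t` fixed). -/
def gradsqX (u : E3 × ℝ → ℝ) (p : E3 × ℝ) : ℝ := gradsq (fixT u p.2) p.1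

/-- `Σ_{i<j} (Ω_{ij} w)²` for a space-time function (`t` fixed). -/
def angsqX (w : E3 × ℝ → ℝ) (p : E3 × ℝ) : ℝ :=
  ∑ i, ∑ j, if i < j then (angX i j w p) ^ 2 else 0

/-- The solid light cone `t ≥ |x|`. -/
def cone : Set (E3 × ℝ) := {p | ‖p.1‖ ≤ p.2}

/-- `u` is a C² solution of the Goursat problem for `q` on the cone `t ≥ |x|`:
`∂_t²u − Δu − q u = 0` for `t > |x|` and `u(x,|x|) = ∫₀¹ q(σx) dσ`. -/
def GoursatSol (q : E3 → ℝ) (u : E3 × ℝ → ℝ) : Prop :=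
  ContDiffOn ℝ 2 u cone ∧
  (∀ p : E3 × ℝ, ‖p.1‖ < p.2 → pdt (pdt u) p - lapX u p - q p.1 * u p = 0) ∧
  (∀ x : E3, u (x, ‖x‖) = ∫ σ in (0:ℝ)..1, q (σ • x))

/-- `p(x) = ∫₀^{|x|} q(σ x/|x|) dσ`. -/
def pfun (q : E3 → ℝ) (x : E3) : ℝ := ∫ σ in (0:ℝ)..‖x‖, q ((σ / ‖x‖) • x)

/-- Integral over the sphere of radius `r` with respect to surface measure. -/
def sphInt (r : ℝ) (g : E3 → ℝ) : ℝ := ∫ x in sphere (0:E3) r, g x ∂μH[2]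

/-- Squared `L²` norm on the sphere of radius `r`. -/
def L2sq (g : E3 → ℝ) (r : ℝ) : ℝ := sphInt r (fun x => (g x) ^ 2)

/-- Squared `H¹` norm on the sphere of radius `r`. -/
def H1sq (g : E3 → ℝ) (r : ℝ) : ℝ := sphInt r (fun x => (g x) ^ 2 + (r ^ 2)⁻¹ * angsq g x)

/-- Squared `H²` norm on the sphere of radius `r`. -/
def H2sq (g : E3 → ℝ) (r : ℝ) : ℝ := H1sq g r + sphInt r (fun x => (r ^ 4)⁻¹ * angsq2 g x)

/-- The class `Q_γ(R,T)`. -/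
def memQ (R T γ : ℝ) (q : E3 → ℝ) : Prop :=
  ∀ r ∈ Icc R ((R + T) / 2),
    Real.sqrt (H2sq (pfun q) r) + Real.sqrt (H1sq (pdr (pfun q)) r) ≤
      γ * (Real.sqrt (H1sq (pfun q) r) + Real.sqrt (L2sq (pdr (pfun q)) r))

/-- The closed annulus `R ≤ |x| ≤ ρ` in `ℝ³`. -/
def Ann (R ρ : ℝ) : Set E3 := {x | R ≤ ‖x‖ ∧ ‖x‖ ≤ ρ}

/-- The space-time region `K_ρ = {R ≤ |x| ≤ ρ, |x| ≤ t ≤ R+T−|x|}`. -/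
def Kreg (R T ρ : ℝ) : Set (E3 × ℝ) :=
  {p | R ≤ ‖p.1‖ ∧ ‖p.1‖ ≤ ρ ∧ ‖p.1‖ ≤ p.2 ∧ p.2 ≤ R + T - ‖p.1‖}

/-- `F = ∂_t²w − ∂_r∂_r w − |x|^{-2} Ω w`. -/
def Fop (w : E3 × ℝ → ℝ) (p : E3 × ℝ) : ℝ :=
  pdt (pdt w) p - pdrX (pdrX w) p - (‖p.1‖ ^ 2)⁻¹ * angLapX w p

/-- The sideways energy `J(ρ)`. -/
def Jfun (R T : ℝ) (w : E3 × ℝ → ℝ) (ρ : ℝ) : ℝ :=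
  ∫ t in ρ..(R + T - ρ), sphInt ρ
    (fun x => (ρ ^ 2)⁻¹ * ((w (x, t)) ^ 2 + (pdt w (x, t)) ^ 2 + gradsqX w (x, t)))


/-- The closed triangle `0 ≤ α`, `ρ + α ≤ β ≤ ρ + d`. -/
def Tri (ρ d : ℝ) : Set (ℝ × ℝ) := {z | 0 ≤ z.1 ∧ ρ + z.1 ≤ z.2 ∧ z.2 ≤ ρ + d}

lemma isCompact_Tri (ρ d : ℝ) : IsCompact (Tri ρ d) := by
  refine IsCompact.of_isClosed_subset (isCompact_Icc (a := ((0, ρ) : ℝ × ℝ)) (b := (d, ρ + d)))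
    ?_ ?_
  · exact (isClosed_le continuous_const continuous_fst).inter
      ((isClosed_le (continuous_const.add continuous_fst) continuous_snd).inter
        (isClosed_le continuous_snd continuous_const))
  · rintro ⟨a, b⟩ ⟨h1, h2, h3⟩
    simp only at h1 h2 h3
    exact ⟨⟨h1, by simp only; linarith⟩, ⟨by simp only; linarith, h3⟩⟩

lemma integrableOn_Tri {ρ d : ℝ} {f : ℝ × ℝ → ℝ} (hf : ContinuousOn f (Tri ρ d)) :
    IntegrableOn f (Tri ρ d) :=
  hf.integrableOn_compact (isCompact_Tri ρ d)

lemma setIntegral_Tri_eq {ρ d : ℝ} {f : ℝ × ℝ → ℝ} (hd : 0 ≤ d)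
    (hf : ContinuousOn f (Tri ρ d)) :
    ∫ z in Tri ρ d, f z = ∫ α in (0:ℝ)..d, ∫ β in (ρ + α)..(ρ + d), f (α, β) := by
  have hm := (isCompact_Tri ρ d).measurableSet
  rw [← integral_indicator hm, Measure.volume_eq_prod, integral_prod]
  swap
  · rw [← Measure.volume_eq_prod]
    exact (integrable_indicator_iff hm).2 (integrableOn_Tri hf)
  rw [intervalIntegral.integral_of_le hd, ← integral_Icc_eq_integral_Ioc,
    ← integral_indicator measurableSet_Icc]
  congr 1
  ext α
  by_cases hα : α ∈ Icc 0 d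
  · rw [indicator_of_mem hα, intervalIntegral.integral_of_le (by linarith [hα.2]),
      ← integral_Icc_eq_integral_Ioc, ← integral_indicator measurableSet_Icc]
    congr 1
    ext β
    by_cases hβ : β ∈ Icc (ρ + α) (ρ + d)
    · rw [indicator_of_mem hβ, indicator_of_mem]
      exact ⟨hα.1, hβ.1, hβ.2⟩
    · rw [indicator_of_notMem hβ, indicator_of_notMem]
      rintro ⟨_, h2, h3⟩
      exact hβ ⟨h2, h3⟩
  · rw [indicator_of_notMem hα]
    have : ∀ β, (Tri ρ d).indicator f (α, β) = 0 := by
      intro β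
      rw [indicator_of_notMem]
      rintro ⟨h1, h2, h3⟩
      simp only at h1 h2 h3
      exact hα ⟨h1, by linarith⟩
    simp [this]

lemma integral_indicator_Tri_slice {ρ d : ℝ} (f : ℝ × ℝ → ℝ) {β : ℝ} (hβ : β ∈ Icc ρ (ρ + d)) :
    ∫ α, (Tri ρ d).indicator f (α, β) = ∫ α in (0:ℝ)..(β - ρ), f (α, β) := by
  rw [intervalIntegral.integral_of_le (by linarith [hβ.1]),
    ← integral_Icc_eq_integral_Ioc, ← integral_indicator measurableSet_Icc]
  congr 1
  ext α
  by_cases hα : α ∈ Icc 0 (β - ρ)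
  · rw [indicator_of_mem hα, indicator_of_mem]
    exact ⟨hα.1, by simp only; linarith [hα.2], hβ.2⟩
  · rw [indicator_of_notMem hα, indicator_of_notMem]
    rintro ⟨h1, h2, h3⟩
    simp only at h1 h2 h3
    exact hα ⟨h1, by linarith⟩

lemma integrable_indicator_Tri {ρ d : ℝ} {f : ℝ × ℝ → ℝ} (hf : ContinuousOn f (Tri ρ d)) :
    Integrable ((Tri ρ d).indicator f) ((volume : Measure ℝ).prod volume) := by
  rw [← Measure.volume_eq_prod]
  exact (integrable_indicator_iff (isCompact_Tri ρ d).measurableSet).2 (integrableOn_Tri hf)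

lemma intervalIntegrable_Tri_slice {ρ d : ℝ} {f : ℝ × ℝ → ℝ} (hd : 0 ≤ d)
    (hf : ContinuousOn f (Tri ρ d)) :
    IntervalIntegrable (fun β => ∫ α in (0:ℝ)..(β - ρ), f (α, β)) volume ρ (ρ + d) := by
  rw [intervalIntegrable_iff_integrableOn_Icc_of_le (by linarith) (by simp)]
  refine (integrable_indicator_Tri hf).integral_prod_right.integrableOn.congr_fun
    (fun β hβ => integral_indicator_Tri_slice f hβ) measurableSet_Icc

lemma setIntegral_Tri_eq' {ρ d : ℝ} {f : ℝ × ℝ → ℝ} (hd : 0 ≤ d)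
    (hf : ContinuousOn f (Tri ρ d)) :
    ∫ z in Tri ρ d, f z = ∫ β in ρ..(ρ + d), ∫ α in (0:ℝ)..(β - ρ), f (α, β) := by
  rw [← integral_indicator (isCompact_Tri ρ d).measurableSet, Measure.volume_eq_prod,
    integral_prod_symm _ (integrable_indicator_Tri hf),
    intervalIntegral.integral_of_le (by linarith), ← integral_Icc_eq_integral_Ioc,
    ← integral_indicator measurableSet_Icc]
  congr 1
  ext β
  by_cases hβ : β ∈ Icc ρ (ρ + d)
  · rw [indicator_of_mem hβ, integral_indicator_Tri_slice f hβ]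
  · rw [indicator_of_notMem hβ]
    have : ∀ α, (Tri ρ d).indicator f (α, β) = 0 := by
      intro α
      rw [indicator_of_notMem]
      rintro ⟨h1, h2, h3⟩
      simp only at h1 h2 h3
      exact hβ ⟨by linarith, h3⟩
    simp [this]

lemma setIntegral_Tri_deriv_snd {ρ d : ℝ} (hd : 0 ≤ d) {g g' : ℝ × ℝ → ℝ}
    (hg : ContinuousOn g (Tri ρ d)) (hg' : ContinuousOn g' (Tri ρ d))
    (h : ∀ α β, 0 < α → ρ + α < β → β < ρ + d →
      HasDerivAt (fun b => g (α, b)) (g' (α, β)) β) :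
    ∫ z in Tri ρ d, g' z = ∫ α in (0:ℝ)..d, (g (α, ρ + d) - g (α, ρ + α)) := by
  rw [setIntegral_Tri_eq hd hg']
  refine intervalIntegral.integral_congr_ae (Filter.Eventually.of_forall fun α hα => ?_)
  rw [uIoc_of_le hd] at hα
  have hmaps : MapsTo (fun b : ℝ => (α, b)) (Icc (ρ + α) (ρ + d)) (Tri ρ d) :=
    fun b hb => ⟨hα.1.le, hb.1, hb.2⟩
  have hle : ρ + α ≤ ρ + d := by linarith [hα.2]
  refine intervalIntegral.integral_eq_sub_of_hasDerivAt_of_le hle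
    (hg.comp (by fun_prop) hmaps) (fun b hb => h α b hα.1 hb.1 hb.2) ?_
  exact (ContinuousOn.intervalIntegrable_of_Icc hle (hg'.comp (by fun_prop) hmaps))

lemma setIntegral_Tri_deriv_fst {ρ d : ℝ} (hd : 0 ≤ d) {g g' : ℝ × ℝ → ℝ}
    (hg : ContinuousOn g (Tri ρ d)) (hg' : ContinuousOn g' (Tri ρ d))
    (h : ∀ α β, 0 < α → ρ + α < β → β ≤ ρ + d →
      HasDerivAt (fun a => g (a, β)) (g' (α, β)) α) :
    ∫ z in Tri ρ d, g' z = ∫ β in ρ..(ρ + d), (g (β - ρ, β) - g (0, β)) := by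
  rw [setIntegral_Tri_eq' hd hg']
  refine intervalIntegral.integral_congr_ae (Filter.Eventually.of_forall fun β hβ => ?_)
  rw [uIoc_of_le (by linarith)] at hβ
  have hmaps : MapsTo (fun a : ℝ => (a, β)) (Icc 0 (β - ρ)) (Tri ρ d) :=
    fun a ha => ⟨ha.1, by simp only; linarith [ha.2], hβ.2⟩
  have hle : 0 ≤ β - ρ := by linarith [hβ.1]
  refine intervalIntegral.integral_eq_sub_of_hasDerivAt_of_le hle
    (hg.comp (by fun_prop) hmaps) (fun a ha => h a β ha.1 (by linarith [ha.2]) hβ.2) ?_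
  exact (ContinuousOn.intervalIntegrable_of_Icc hle (hg'.comp (by fun_prop) hmaps))

/-- The weighted energy inequality on the triangle, for the scalar energies `a`, `b`. -/
lemma triangle_energy {ρ d : ℝ} (hρ : 0 < ρ) (hd : 0 < d) {a a' b b' f : ℝ × ℝ → ℝ}
    (ha : ContinuousOn a (Tri ρ d)) (ha' : ContinuousOn a' (Tri ρ d))
    (hb : ContinuousOn b (Tri ρ d)) (hb' : ContinuousOn b' (Tri ρ d))
    (hf : ContinuousOn f (Tri ρ d))
    (hda : ∀ α β, 0 < α → ρ + α < β → β < ρ + d →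
      HasDerivAt (fun s => a (α, s)) (a' (α, β)) β)
    (hdb : ∀ α β, 0 < α → ρ + α < β → β ≤ ρ + d →
      HasDerivAt (fun s => b (s, β)) (b' (α, β)) α)
    (ha0 : ∀ z ∈ Tri ρ d, 0 ≤ a z) (hb0 : ∀ z ∈ Tri ρ d, 0 ≤ b z)
    (hf0 : ∀ z ∈ Tri ρ d, 0 ≤ f z)
    (hah : ∀ α ∈ Icc 0 d, a (α, ρ + α) = 0) (hbh : ∀ α ∈ Icc 0 d, b (α, ρ + α) = 0)
    (hid : ∀ z ∈ Tri ρ d, 0 < z.1 →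
      a' z + ((z.2 - z.1) ^ 2)⁻¹ * b' z ≤ f z + a z) :
    ∫ z in Tri ρ d, (a z + ((z.2 - z.1) ^ 2)⁻¹ * b z) ≤
      d * ρ⁻¹ ^ 2 * 2 * (∫ β in ρ..(ρ + d), b (0, β)) +
      2 * d * ∫ z in Tri ρ d, (f z + a z + 2 * ρ⁻¹ * (((z.2 - z.1) ^ 2)⁻¹ * b z)) := by
  have hr : ∀ z ∈ Tri ρ d, ρ ≤ z.2 - z.1 := fun z hz => by linarith [hz.2.1]
  have hr0 : ∀ z ∈ Tri ρ d, 0 < z.2 - z.1 := fun z hz => hρ.trans_le (hr z hz)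
  set φ : ℝ × ℝ → ℝ := fun z => ρ + 2 * d - z.1 - z.2 with hφ
  have hφ0 : ∀ z ∈ Tri ρ d, 0 ≤ φ z := fun z hz => by
    simp only [hφ]; linarith [hz.2.1, hz.2.2, hz.1]
  have hφ1 : ∀ z ∈ Tri ρ d, φ z ≤ 2 * d := fun z hz => by
    simp only [hφ]; linarith [hz.2.1, hz.2.2, hz.1]
  have hφc : Continuous φ := by fun_prop
  set w : ℝ × ℝ → ℝ := fun z => ((z.2 - z.1) ^ 2)⁻¹ with hw
  set w' : ℝ × ℝ → ℝ := fun z => 2 * ((z.2 - z.1) ^ 3)⁻¹ with hw'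
  have hwc : ContinuousOn w (Tri ρ d) :=
    ContinuousOn.inv₀ (by fun_prop) fun z hz => (pow_pos (hr0 z hz) 2).ne'
  have hw'c : ContinuousOn w' (Tri ρ d) :=
    continuousOn_const.mul
      (ContinuousOn.inv₀ (by fun_prop) fun z hz => (pow_pos (hr0 z hz) 3).ne')
  have hw'le : ∀ z ∈ Tri ρ d, w' z ≤ 2 * ρ⁻¹ * w z := fun z hz => by
    simp only [hw', hw]
    have h1 : ((z.2 - z.1) ^ 3)⁻¹ = (z.2 - z.1)⁻¹ * ((z.2 - z.1) ^ 2)⁻¹ := by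
      rw [← mul_inv]; ring_nf
    rw [h1, mul_assoc]
    have h2 : (z.2 - z.1)⁻¹ ≤ ρ⁻¹ := inv_anti₀ hρ (hr z hz)
    have h3 : 0 ≤ ((z.2 - z.1) ^ 2)⁻¹ := by positivity
    nlinarith [mul_le_mul_of_nonneg_right h2 h3]
  have I1 := setIntegral_Tri_deriv_snd hd.le (g := fun z => φ z * a z)
    (g' := fun z => φ z * a' z - a z) (hφc.continuousOn.mul ha)
    ((hφc.continuousOn.mul ha').sub ha) (fun α β h1 h2 h3 => by
      have := (((hasDerivAt_id β).const_sub (ρ + 2 * d - α))).mul (hda α β h1 h2 h3)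
      refine this.congr_deriv ?_
      simp [hφ]; ring)
  have I2 := setIntegral_Tri_deriv_fst hd.le (g := fun z => φ z * (w z * b z))
    (g' := fun z => φ z * (w z * b' z + w' z * b z) - w z * b z)
    (hφc.continuousOn.mul (hwc.mul hb))
    ((hφc.continuousOn.mul ((hwc.mul hb').add (hw'c.mul hb))).sub (hwc.mul hb))
    (fun α β h1 h2 h3 => by
      have hz := hr0 (α, β) ⟨h1.le, h2.le, h3⟩
      simp only at hz
      have d1 : HasDerivAt (fun s : ℝ => ((β - s) ^ 2)⁻¹) (2 * ((β - α) ^ 3)⁻¹) α := by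
        have := (((hasDerivAt_id α).const_sub β).pow 2).inv (pow_pos hz 2).ne'
        refine this.congr_deriv ?_
        simp
        field_simp
      have d2 : HasDerivAt (fun s : ℝ => ρ + 2 * d - s - β) (-1) α :=
        (((hasDerivAt_id α).const_sub (ρ + 2 * d)).sub_const β)
      refine (d2.mul (d1.mul (hdb α β h1 h2 h3))).congr_deriv ?_
      simp [hφ, hw, hw']; ring)
  have hmeas := (isCompact_Tri ρ d).measurableSet
  have c1 : ContinuousOn (fun z => φ z * a' z - a z) (Tri ρ d) :=
    (hφc.continuousOn.mul ha').sub ha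
  have c2 : ContinuousOn (fun z => φ z * (w z * b' z + w' z * b z) - w z * b z) (Tri ρ d) :=
    (hφc.continuousOn.mul ((hwc.mul hb').add (hw'c.mul hb))).sub (hwc.mul hb)
  have hIcc : ∀ α ∈ Icc 0 d, (α, ρ + d) ∈ Tri ρ d := fun α hα =>
    ⟨hα.1, by simp only; linarith [hα.2], le_rfl⟩
  -- boundary terms
  have B1 : 0 ≤ ∫ α in (0:ℝ)..d, (φ (α, ρ + d) * a (α, ρ + d) - φ (α, ρ + α) * a (α, ρ + α)) := by
    refine intervalIntegral.integral_nonneg hd.le fun α hα => ?_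
    rw [hah α hα, mul_zero, sub_zero]
    exact mul_nonneg (hφ0 _ (hIcc α hα)) (ha0 _ (hIcc α hα))
  have hb_cont : ContinuousOn (fun β => b (0, β)) (Icc ρ (ρ + d)) :=
    hb.comp (by fun_prop) fun β hβ => ⟨le_rfl, by simpa using hβ.1, hβ.2⟩
  have B2 : -(d * ρ⁻¹ ^ 2 * 2 * (∫ β in ρ..(ρ + d), b (0, β))) ≤
      ∫ β in ρ..(ρ + d), (φ (β - ρ, β) * (w (β - ρ, β) * b (β - ρ, β)) -
        φ (0, β) * (w (0, β) * b (0, β))) := by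
    rw [← intervalIntegral.integral_const_mul, ← intervalIntegral.integral_neg]
    have hm0 : MapsTo (fun β : ℝ => ((0:ℝ), β)) (Icc ρ (ρ + d)) (Tri ρ d) :=
      fun β hβ => ⟨le_rfl, by simpa using hβ.1, hβ.2⟩
    have hm1 : MapsTo (fun β : ℝ => (β - ρ, β)) (Icc ρ (ρ + d)) (Tri ρ d) :=
      fun β hβ => ⟨by simpa using hβ.1, by simp, hβ.2⟩
    have cw := (hφc.continuousOn.mul (hwc.mul hb))
    refine intervalIntegral.integral_mono_on (by linarith) ?_ ?_ ?_
    · exact ContinuousOn.intervalIntegrable_of_Icc (by linarith) (continuousOn_const.mul hb_cont).neg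
    · exact ContinuousOn.intervalIntegrable_of_Icc (by linarith)
        ((cw.comp (by fun_prop) hm1).sub (cw.comp (by fun_prop) hm0))
    · intro β hβ
      have e1 : b (β - ρ, β) = 0 := by
        have := hbh (β - ρ) ⟨by linarith [hβ.1], by linarith [hβ.2]⟩
        rwa [show ρ + (β - ρ) = β by ring] at this
      have hz := hm0 hβ
      have e2 := hφ1 _ hz
      have e3 := hφ0 _ hz
      have e4 := hb0 _ hz
      have e5 : w (0, β) ≤ ρ⁻¹ ^ 2 := by
        simp only [hw, sub_zero]
        rw [inv_pow]
        exact inv_anti₀ (by positivity) (by have := hβ.1; gcongr)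
      have e6 : 0 ≤ w (0, β) := by simp only [hw]; positivity
      rw [e1]
      simp only [mul_zero, zero_sub, neg_le_neg_iff]
      calc φ (0, β) * (w (0, β) * b (0, β)) ≤ 2 * d * (ρ⁻¹ ^ 2 * b (0, β)) := by gcongr
        _ = _ := by ring
  have key : (∫ z in Tri ρ d, (φ z * a' z - a z)) +
      (∫ z in Tri ρ d, (φ z * (w z * b' z + w' z * b z) - w z * b z)) ≤
      (∫ z in Tri ρ d, 2 * d * (f z + a z + 2 * ρ⁻¹ * (w z * b z))) -
      ∫ z in Tri ρ d, (a z + w z * b z) := by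
    rw [← integral_add (integrableOn_Tri c1) (integrableOn_Tri c2), ← integral_sub]
    rotate_left
    · exact integrableOn_Tri (by fun_prop)
    · exact integrableOn_Tri (by fun_prop)
    refine integral_mono_ae (integrableOn_Tri (c1.add c2)) (integrableOn_Tri (by fun_prop)) ?_
    have hnull : ∀ᵐ z : ℝ × ℝ, z.1 ≠ 0 := by
      rw [Measure.volume_eq_prod]
      exact Measure.quasiMeasurePreserving_fst.ae (p := fun x : ℝ => x ≠ 0)
        (by simp [ae_iff])
    filter_upwards [ae_restrict_mem hmeas, ae_restrict_of_ae hnull] with z hz hz0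
    have hpos : 0 < z.1 := lt_of_le_of_ne hz.1 (Ne.symm hz0)
    have h1 := hid z hz hpos
    have h2 : a' z + w z * b' z + w' z * b z ≤ f z + a z + 2 * ρ⁻¹ * (w z * b z) := by
      have := mul_le_mul_of_nonneg_right (hw'le z hz) (hb0 z hz)
      simp only [hw] at this h1 ⊢
      linarith
    have hX : 0 ≤ f z + a z + 2 * ρ⁻¹ * (w z * b z) := by
      have := hb0 z hz
      have := ha0 z hz
      have := hf0 z hz
      have : 0 ≤ w z := by simp only [hw]; positivity
      positivity
    have h3 := mul_le_mul_of_nonneg_left h2 (hφ0 z hz)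
    have h4 := mul_le_mul_of_nonneg_right (hφ1 z hz) hX
    linarith
  rw [I1, I2, integral_const_mul] at key
  linarith

section Param

variable {S : Type*} [MetricSpace S] [CompactSpace S] [MeasurableSpace S] [BorelSpace S]
  {μ : Measure S} [IsFiniteMeasure μ]

omit [CompactSpace S] [MeasurableSpace S] [BorelSpace S] in
lemma continuous_slice {X : Type*} [TopologicalSpace X] {K : Set X} {g : X × S → ℝ}
    (hg : ContinuousOn g (K ×ˢ univ)) {x : X} (hx : x ∈ K) : Continuous fun ω => g (x, ω) :=
  hg.comp_continuous (by fun_prop) fun _ => ⟨hx, mem_univ _⟩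

lemma integrable_of_continuous_compact {f : S → ℝ} (hf : Continuous f) : Integrable f μ :=
  integrableOn_univ.1 (hf.continuousOn.integrableOn_compact isCompact_univ)

lemma continuousOn_integral_compact {X : Type*} [TopologicalSpace X] [FirstCountableTopology X]
    {K : Set X} (hK : IsCompact K) {g : X × S → ℝ} (hg : ContinuousOn g (K ×ˢ univ)) :
    ContinuousOn (fun x => ∫ ω, g (x, ω) ∂μ) K := by
  obtain ⟨C, hC⟩ := (hK.prod isCompact_univ).exists_bound_of_continuousOn hg
  refine continuousOn_of_dominated (bound := fun _ => C)
    (fun x hx => (continuous_slice hg hx).aestronglyMeasurable)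
    (fun x hx => Filter.Eventually.of_forall fun ω => hC _ ⟨hx, mem_univ _⟩)
    (integrable_const C) (Filter.Eventually.of_forall fun ω => ?_)
  exact hg.comp (by fun_prop) fun x hx => ⟨hx, mem_univ _⟩

lemma hasDerivAt_integral_compact {c e t : ℝ} (ht : t ∈ Ioo c e) {g g' : ℝ × S → ℝ}
    (hg : ContinuousOn g (Icc c e ×ˢ univ)) (hg' : ContinuousOn g' (Icc c e ×ˢ univ))
    (h : ∀ s ∈ Ioo c e, ∀ ω, HasDerivAt (fun x => g (x, ω)) (g' (s, ω)) s) :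
    HasDerivAt (fun s => ∫ ω, g (s, ω) ∂μ) (∫ ω, g' (t, ω) ∂μ) t := by
  obtain ⟨C, hC⟩ := (isCompact_Icc.prod isCompact_univ).exists_bound_of_continuousOn hg'
  have hn : Ioo c e ∈ nhds t := isOpen_Ioo.mem_nhds ht
  refine (hasDerivAt_integral_of_dominated_loc_of_deriv_le (bound := fun _ => C)
    (F := fun s ω => g (s, ω)) (F' := fun s ω => g' (s, ω)) hn ?_ ?_ ?_ ?_
    (integrable_const C) ?_).2
  · filter_upwards [hn] with s hs
    exact (continuous_slice hg (Ioo_subset_Icc_self hs)).aestronglyMeasurable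
  · exact integrable_of_continuous_compact (continuous_slice hg (Ioo_subset_Icc_self ht))
  · exact (continuous_slice hg' (Ioo_subset_Icc_self ht)).aestronglyMeasurable
  · exact Filter.Eventually.of_forall fun ω s hs => hC _ ⟨Ioo_subset_Icc_self hs, mem_univ _⟩
  · exact Filter.Eventually.of_forall fun ω s hs => h s hs ω

lemma integral_intervalIntegral_compact {a b : ℝ} (hab : a ≤ b) {g : ℝ × S → ℝ}
    (hg : ContinuousOn g (Icc a b ×ˢ univ)) :
    ∫ ω, (∫ t in a..b, g (t, ω)) ∂μ = ∫ t in a..b, (∫ ω, g (t, ω) ∂μ) := by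
  simp only [intervalIntegral.integral_of_le hab, ← integral_Icc_eq_integral_Ioc]
  refine (integral_integral_swap (f := fun t ω => g (t, ω)) ?_).symm
  have h : IntegrableOn g (Icc a b ×ˢ univ) ((volume : Measure ℝ).prod μ) :=
    hg.integrableOn_compact (isCompact_Icc.prod isCompact_univ)
  rw [IntegrableOn, ← Measure.prod_restrict, Measure.restrict_univ] at h
  exact h

lemma sq_intervalIntegral_le {a b : ℝ} (hab : a ≤ b) {f : ℝ → ℝ} (hf : ContinuousOn f (Icc a b)) :
    (∫ t in a..b, f t) ^ 2 ≤ (b - a) * ∫ t in a..b, f t ^ 2 := by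
  rcases hab.eq_or_lt with rfl | hlt
  · simp
  have hf1 : IntervalIntegrable f volume a b := hf.intervalIntegrable_of_Icc hab
  have hf2 : IntervalIntegrable (fun t => f t ^ 2) volume a b :=
    (hf.pow 2).intervalIntegrable_of_Icc hab
  set I := ∫ t in a..b, f t with hI
  set m := I / (b - a) with hm
  have h0 : 0 ≤ ∫ t in a..b, (f t - m) ^ 2 :=
    intervalIntegral.integral_nonneg hab fun t _ => sq_nonneg _
  have h1 : ∫ t in a..b, (f t - m) ^ 2 =
      (∫ t in a..b, f t ^ 2) - 2 * m * I + (b - a) * m ^ 2 := by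
    have : ∀ t, (f t - m) ^ 2 = f t ^ 2 - 2 * m * f t + m ^ 2 := fun t => by ring
    simp only [this]
    rw [intervalIntegral.integral_add (hf2.sub (hf1.const_mul _)) (by simp),
      intervalIntegral.integral_sub hf2 (hf1.const_mul _), intervalIntegral.integral_const_mul]
    simp [hI]
  have hba : 0 < b - a := by linarith
  have h2 : I = m * (b - a) := by rw [hm]; field_simp
  rw [h1, h2] at h0
  rw [h2]
  nlinarith

lemma integral_sq_intervalIntegral_le {a b : ℝ} (hab : a ≤ b) {g : ℝ × S → ℝ}
    (hg : ContinuousOn g (Icc a b ×ˢ univ)) :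
    ∫ ω, (∫ t in a..b, g (t, ω)) ^ 2 ∂μ ≤ (b - a) * ∫ t in a..b, ∫ ω, g (t, ω) ^ 2 ∂μ := by
  have hg2 : ContinuousOn (fun z => g z ^ 2) (Icc a b ×ˢ univ) := hg.pow 2
  rw [← integral_intervalIntegral_compact hab hg2, ← integral_const_mul]
  have hc : ∀ {k : ℝ × S → ℝ}, ContinuousOn k (Icc a b ×ˢ univ) →
      Continuous fun ω => ∫ t in a..b, k (t, ω) := by
    intro k hk
    simp only [intervalIntegral.integral_of_le hab, ← integral_Icc_eq_integral_Ioc]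
    obtain ⟨C, hC⟩ := (isCompact_Icc.prod isCompact_univ).exists_bound_of_continuousOn hk
    refine continuous_of_dominated (bound := fun _ => C) (fun ω => ?_) (fun ω => ?_)
      (integrableOn_const (by simp)) ?_
    · exact (hk.comp (by fun_prop) fun t ht => ⟨ht, mem_univ _⟩).aestronglyMeasurable
        measurableSet_Icc
    · filter_upwards [ae_restrict_mem measurableSet_Icc] with t ht
      exact hC _ ⟨ht, mem_univ _⟩
    · filter_upwards [ae_restrict_mem measurableSet_Icc] with t ht
      exact continuous_slice hk ht
  refine integral_mono (integrable_of_continuous_compact ((hc hg).pow 2))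
    (integrable_of_continuous_compact (continuous_const.mul (hc hg2))) fun ω => ?_
  exact sq_intervalIntegral_le hab (hg.comp (by fun_prop) fun t ht => ⟨ht, mem_univ _⟩)

end Param

/-- The absorption step: for small `d` the chain of estimates forces `N = 0`. -/
lemma exists_absorption (c M C : ℝ) (hc : 0 ≤ c) (hC : 0 ≤ C) :
    ∃ δ > (0:ℝ), ∀ d Z N G f : ℝ, 0 < d → d ≤ δ → 0 ≤ Z → 0 ≤ N → 0 ≤ G →
      Z ≤ d * c ^ 2 * 2 * (d ^ 2 * G) + 2 * d * (f + Z + 2 * c * Z) →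
      f ≤ 2 * M ^ 2 * (d ^ 2 * Z) + 2 * M ^ 2 * (d * N) →
      2 * N ≤ Z + c ^ 2 * (d * G) + f + d * N →
      G ≤ C * (d ^ 2 * N + d ^ 2 * G + N) → N ≤ 0 := by
  set k1 := 8 * c ^ 2 * C + 4 * M ^ 2 with hk1
  set k2 := 4 * M ^ 2 + 2 + 4 * c with hk2
  set k3 := 2 * k1 + 4 * C * c ^ 2 + 4 * M ^ 2 * k1 + 2 * M ^ 2 + 1 with hk3
  have hk1p : 0 ≤ k1 := by positivity
  have hk2p : 0 ≤ k2 := by positivity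
  have hk3p : 0 ≤ k3 := by positivity
  set D := 1 + 2 * C + 2 * k2 + k3 with hD
  have hDp : 0 < D := by positivity
  refine ⟨D⁻¹, by positivity, fun d Z N G f hd hdδ hZ hN hG h1 h2 h3 h4 => ?_⟩
  have hdD : d * D ≤ 1 := by
    calc d * D ≤ D⁻¹ * D := by gcongr
      _ = 1 := inv_mul_cancel₀ hDp.ne'
  have e1 : 0 ≤ d * C := by positivity
  have e2 : 0 ≤ d * k2 := by positivity
  have e3 : 0 ≤ d * k3 := by positivity
  have hd1 : d ≤ 1 := by nlinarith
  have hdC : d * C ≤ 1 / 2 := by nlinarith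
  have hdk2 : d * k2 ≤ 1 / 2 := by nlinarith
  have hdk3 : d * k3 ≤ 1 := by nlinarith
  have hd2 : d ^ 2 ≤ d := by nlinarith
  have hd2' : d ^ 2 ≤ 1 := by linarith
  have g1 : G ≤ 4 * C * N := by
    have a1 : C * (d ^ 2 * G) ≤ 1 / 2 * G := by
      have : C * (d ^ 2 * G) ≤ C * (d * G) := by gcongr
      nlinarith
    have a2 : C * (d ^ 2 * N) ≤ C * (1 * N) := by gcongr
    nlinarith
  have f1 : f ≤ 2 * M ^ 2 * d * (Z + N) := by
    have : 2 * M ^ 2 * (d ^ 2 * Z) ≤ 2 * M ^ 2 * (d * Z) := by gcongr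
    linarith
  have z1 : Z ≤ d * (k1 * N + k2 * Z) := by
    have a1 : d * c ^ 2 * 2 * (d ^ 2 * G) ≤ d * c ^ 2 * 2 * (1 * (4 * C * N)) := by gcongr
    have a2 : 2 * d * f ≤ 2 * d * (2 * M ^ 2 * 1 * (Z + N)) := by
      have : 2 * M ^ 2 * d * (Z + N) ≤ 2 * M ^ 2 * 1 * (Z + N) := by gcongr
      have := f1.trans this
      gcongr
    simp only [hk1, hk2]
    linarith
  have z2 : Z ≤ 2 * (d * k1 * N) := by
    have : d * k2 * Z ≤ 1 / 2 * Z := by gcongr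
    linarith
  have f2 : f ≤ 2 * M ^ 2 * d * (2 * k1 * N + N) := by
    have : d * k1 * N ≤ 1 * k1 * N := by gcongr
    refine f1.trans ?_
    gcongr
    linarith
  have n1 : 2 * N ≤ d * k3 * N := by
    have a1 : c ^ 2 * (d * G) ≤ c ^ 2 * (d * (4 * C * N)) := by gcongr
    simp only [hk3]
    linarith
  have : d * k3 * N ≤ 1 * N := by gcongr
  linarith

set_option linter.unusedSectionVars false

/-- The quantities entering the energy argument on the characteristic triangle
`α = (t - r)/2`, `β = (t + r)/2`: the unknown `W`, its null derivatives `A = ∂_α W`, `B = ∂_β W`,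
`H = ∂_α ∂_β W`, the angular derivatives `L k = Ω_k W`, `N k = Ω_k A`, the spherical Laplacian `P`,
the source `F`, the potential `q` in polar coordinates and its angular derivatives `G k`. -/
structure TriangleData {S : Type*} [MetricSpace S] [CompactSpace S] [MeasurableSpace S]
    [BorelSpace S] (μ : Measure S) (ρ d M C : ℝ) where
  W : (ℝ × ℝ) × S → ℝ
  A : (ℝ × ℝ) × S → ℝ
  B : (ℝ × ℝ) × S → ℝ
  H : (ℝ × ℝ) × S → ℝ
  P : (ℝ × ℝ) × S → ℝ
  F : (ℝ × ℝ) × S → ℝ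
  L : Fin 3 → (ℝ × ℝ) × S → ℝ
  N : Fin 3 → (ℝ × ℝ) × S → ℝ
  q : ℝ × S → ℝ
  G : Fin 3 → ℝ × S → ℝ
  contW : ContinuousOn W (Tri ρ d ×ˢ univ)
  contA : ContinuousOn A (Tri ρ d ×ˢ univ)
  contB : ContinuousOn B (Tri ρ d ×ˢ univ)
  contH : ContinuousOn H (Tri ρ d ×ˢ univ)
  contP : ContinuousOn P (Tri ρ d ×ˢ univ)
  contF : ContinuousOn F (Tri ρ d ×ˢ univ)
  contL : ∀ k, ContinuousOn (L k) (Tri ρ d ×ˢ univ)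
  contN : ∀ k, ContinuousOn (N k) (Tri ρ d ×ˢ univ)
  contq : ContinuousOn q (Icc ρ (ρ + d) ×ˢ univ)
  contG : ∀ k, ContinuousOn (G k) (Icc ρ (ρ + d) ×ˢ univ)
  derivW : ∀ α β ω, 0 < α → ρ + α < β → β ≤ ρ + d →
    HasDerivAt (fun s => W ((s, β), ω)) (A ((α, β), ω)) α
  derivB : ∀ α β ω, 0 < α → ρ + α < β → β ≤ ρ + d →
    HasDerivAt (fun s => B ((s, β), ω)) (H ((α, β), ω)) α
  derivL : ∀ k α β ω, 0 < α → ρ + α < β → β ≤ ρ + d →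
    HasDerivAt (fun s => L k ((s, β), ω)) (N k ((α, β), ω)) α
  derivA : ∀ α β ω, 0 < α → ρ + α < β → β < ρ + d →
    HasDerivAt (fun s => A ((α, s), ω)) (H ((α, β), ω)) β
  zeroW : ∀ α ∈ Icc 0 d, ∀ ω, W ((α, ρ + α), ω) = 0
  zeroA : ∀ α ∈ Icc 0 d, ∀ ω, A ((α, ρ + α), ω) = 0
  zeroB : ∀ α ∈ Icc 0 d, ∀ ω, B ((α, ρ + α), ω) = 0
  zeroL : ∀ k, ∀ α ∈ Icc 0 d, ∀ ω, L k ((α, ρ + α), ω) = 0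
  bottomB : ∀ β ∈ Icc ρ (ρ + d), ∀ ω, B ((0, β), ω) = q (β, ω)
  bottomL : ∀ k, ∀ β ∈ Icc ρ (ρ + d), ∀ ω, L k ((0, β), ω) = ∫ s in ρ..β, G k (s, ω)
  pde : ∀ z ∈ Tri ρ d, 0 < z.1 → ∀ ω, H (z, ω) = ((z.2 - z.1) ^ 2)⁻¹ * P (z, ω) + F (z, ω)
  source : ∀ z ∈ Tri ρ d, ∀ ω,
    F (z, ω) ^ 2 ≤ 2 * M ^ 2 * W (z, ω) ^ 2 + 2 * M ^ 2 * q (z.2 - z.1, ω) ^ 2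
  partsA : ∀ z ∈ Tri ρ d, 0 < z.1 →
    ∫ ω, P (z, ω) * A (z, ω) ∂μ = -∫ ω, ∑ k, L k (z, ω) * N k (z, ω) ∂μ
  partsq : ∀ z ∈ Tri ρ d, 0 < z.1 →
    ∫ ω, P (z, ω) * q (z.2, ω) ∂μ = -∫ ω, ∑ k, L k (z, ω) * G k (z.2, ω) ∂μ
  control : ∀ β ∈ Icc ρ (ρ + d), ∫ ω, ∑ k, G k (β, ω) ^ 2 ∂μ ≤
    C * ((∫ ω, (∫ s in ρ..β, q (s, ω)) ^ 2 ∂μ) +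
      (∫ ω, ∑ k, (∫ s in ρ..β, G k (s, ω)) ^ 2 ∂μ) + ∫ ω, q (β, ω) ^ 2 ∂μ)

namespace TriangleData

variable {S : Type*} [MetricSpace S] [CompactSpace S] [MeasurableSpace S]
    [BorelSpace S] {μ : Measure S} [IsFiniteMeasure μ] {ρ d M C : ℝ}
    (D : TriangleData μ ρ d M C)

/-- `∫_S A²`. -/
def eA (z : ℝ × ℝ) : ℝ := ∫ ω, D.A (z, ω) ^ 2 ∂μ
/-- `∫_S Σ L_k²`. -/
def eL (z : ℝ × ℝ) : ℝ := ∫ ω, ∑ k, D.L k (z, ω) ^ 2 ∂μ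
/-- `∫_S F²`. -/
def eF (z : ℝ × ℝ) : ℝ := ∫ ω, D.F (z, ω) ^ 2 ∂μ
/-- `∫_S W²`. -/
def eW (z : ℝ × ℝ) : ℝ := ∫ ω, D.W (z, ω) ^ 2 ∂μ
/-- `∫_S q²`. -/
def eq (r : ℝ) : ℝ := ∫ ω, D.q (r, ω) ^ 2 ∂μ
/-- `∫_S Σ G_k²`. -/
def eG (r : ℝ) : ℝ := ∫ ω, ∑ k, D.G k (r, ω) ^ 2 ∂μ

lemma cont_eA : ContinuousOn D.eA (Tri ρ d) :=
  continuousOn_integral_compact (isCompact_Tri ρ d) (D.contA.pow 2)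
lemma cont_eL : ContinuousOn D.eL (Tri ρ d) :=
  continuousOn_integral_compact (isCompact_Tri ρ d)
    (continuousOn_finsetSum _ fun k _ => (D.contL k).pow 2)
lemma cont_eF : ContinuousOn D.eF (Tri ρ d) :=
  continuousOn_integral_compact (isCompact_Tri ρ d) (D.contF.pow 2)
lemma cont_eW : ContinuousOn D.eW (Tri ρ d) :=
  continuousOn_integral_compact (isCompact_Tri ρ d) (D.contW.pow 2)
lemma cont_eq : ContinuousOn D.eq (Icc ρ (ρ + d)) :=
  continuousOn_integral_compact isCompact_Icc (D.contq.pow 2)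
lemma cont_eG : ContinuousOn D.eG (Icc ρ (ρ + d)) :=
  continuousOn_integral_compact isCompact_Icc
    (continuousOn_finsetSum _ fun k _ => (D.contG k).pow 2)

lemma eA_nonneg (z : ℝ × ℝ) : 0 ≤ D.eA z := integral_nonneg fun _ => sq_nonneg _
lemma eL_nonneg (z : ℝ × ℝ) : 0 ≤ D.eL z :=
  integral_nonneg fun _ => Finset.sum_nonneg fun _ _ => sq_nonneg _
lemma eF_nonneg (z : ℝ × ℝ) : 0 ≤ D.eF z := integral_nonneg fun _ => sq_nonneg _
lemma eq_nonneg (r : ℝ) : 0 ≤ D.eq r := integral_nonneg fun _ => sq_nonneg _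
lemma eG_nonneg (r : ℝ) : 0 ≤ D.eG r :=
  integral_nonneg fun _ => Finset.sum_nonneg fun _ _ => sq_nonneg _

/-- The zeroth order energy of the triangle. -/
def Z : ℝ := ∫ z in Tri ρ d, (D.eA z + ((z.2 - z.1) ^ 2)⁻¹ * D.eL z)
/-- The squared `L²` norm of `q`. -/
def Nq : ℝ := ∫ r in ρ..(ρ + d), D.eq r
/-- The squared `L²` norm of the angular derivatives of `q`. -/
def Gq : ℝ := ∫ r in ρ..(ρ + d), D.eG r

lemma cont_weight (hρ : 0 < ρ) :
    ContinuousOn (fun z : ℝ × ℝ => ((z.2 - z.1) ^ 2)⁻¹) (Tri ρ d) :=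
  ContinuousOn.inv₀ (by fun_prop) fun z hz => (pow_pos (by linarith [hz.2.1]) 2).ne'

lemma Z_nonneg : 0 ≤ D.Z :=
  integral_nonneg fun z => add_nonneg (D.eA_nonneg z) (mul_nonneg (by positivity) (D.eL_nonneg z))

lemma Nq_nonneg (hd : 0 ≤ d) : 0 ≤ D.Nq :=
  intervalIntegral.integral_nonneg (by linarith) fun r _ => D.eq_nonneg r

lemma Gq_nonneg (hd : 0 ≤ d) : 0 ≤ D.Gq :=
  intervalIntegral.integral_nonneg (by linarith) fun r _ => D.eG_nonneg r

lemma integral_le_Nq (hd : 0 ≤ d) {β : ℝ} (hβ : β ∈ Icc ρ (ρ + d)) :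
    ∫ r in ρ..β, D.eq r ≤ D.Nq := by
  refine intervalIntegral.integral_mono_interval le_rfl hβ.1 hβ.2
    (Filter.Eventually.of_forall fun r => D.eq_nonneg r)
    (D.cont_eq.intervalIntegrable_of_Icc (by linarith))

lemma integral_le_Gq (hd : 0 ≤ d) {β : ℝ} (hβ : β ∈ Icc ρ (ρ + d)) :
    ∫ r in ρ..β, D.eG r ≤ D.Gq := by
  refine intervalIntegral.integral_mono_interval le_rfl hβ.1 hβ.2
    (Filter.Eventually.of_forall fun r => D.eG_nonneg r)
    (D.cont_eG.intervalIntegrable_of_Icc (by linarith))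

lemma integral_sq_q_le (hd : 0 ≤ d) {β : ℝ} (hβ : β ∈ Icc ρ (ρ + d)) :
    ∫ ω, (∫ s in ρ..β, D.q (s, ω)) ^ 2 ∂μ ≤ d * D.Nq := by
  have hsub : Icc ρ β ×ˢ (univ : Set S) ⊆ Icc ρ (ρ + d) ×ˢ univ :=
    prod_mono (Icc_subset_Icc_right hβ.2) subset_rfl
  refine (integral_sq_intervalIntegral_le hβ.1 (D.contq.mono hsub)).trans ?_
  have h1 := D.integral_le_Nq hd hβ
  have h2 : 0 ≤ ∫ r in ρ..β, D.eq r :=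
    intervalIntegral.integral_nonneg hβ.1 fun r _ => D.eq_nonneg r
  have h3 : β - ρ ≤ d := by linarith [hβ.2]
  exact mul_le_mul h3 h1 h2 hd

lemma integral_sq_G_le (hd : 0 ≤ d) {β : ℝ} (hβ : β ∈ Icc ρ (ρ + d)) :
    ∫ ω, ∑ k, (∫ s in ρ..β, D.G k (s, ω)) ^ 2 ∂μ ≤ d * D.Gq := by
  have hsub : Icc ρ β ×ˢ (univ : Set S) ⊆ Icc ρ (ρ + d) ×ˢ univ :=
    prod_mono (Icc_subset_Icc_right hβ.2) subset_rfl
  have hc : ∀ k, Continuous fun ω => ∫ s in ρ..β, D.G k (s, ω) := fun k => by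
    have : (fun ω => ∫ s in ρ..β, D.G k (s, ω)) = fun ω => D.L k ((0, β), ω) := by
      ext ω; rw [D.bottomL k β hβ]
    rw [this]
    exact continuous_slice (D.contL k) ⟨le_rfl, by simpa using hβ.1, hβ.2⟩
  rw [integral_finsetSum (f := fun k ω => (∫ s in ρ..β, D.G k (s, ω)) ^ 2) _
    fun k _ => integrable_of_continuous_compact ((hc k).pow 2)]
  have h0 : ∀ k, ContinuousOn (fun s => ∫ ω, D.G k (s, ω) ^ 2 ∂μ) (Icc ρ β) := fun k =>
    continuousOn_integral_compact isCompact_Icc (((D.contG k).mono hsub).pow 2)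
  have h1 : ∑ k, ∫ s in ρ..β, ∫ ω, D.G k (s, ω) ^ 2 ∂μ = ∫ s in ρ..β, D.eG s := by
    rw [← intervalIntegral.integral_finsetSum
      fun k _ => (h0 k).intervalIntegrable_of_Icc hβ.1]
    refine intervalIntegral.integral_congr fun s hs => ?_
    rw [uIcc_of_le hβ.1] at hs
    have hs' : s ∈ Icc ρ (ρ + d) := ⟨hs.1, hs.2.trans hβ.2⟩
    simp only [eG]
    rw [integral_finsetSum (f := fun k ω => D.G k (s, ω) ^ 2) _ fun k _ =>
      integrable_of_continuous_compact ((continuous_slice (D.contG k) hs').pow 2)]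
  calc ∑ k, ∫ ω, (∫ s in ρ..β, D.G k (s, ω)) ^ 2 ∂μ
      ≤ ∑ k, (β - ρ) * ∫ s in ρ..β, ∫ ω, D.G k (s, ω) ^ 2 ∂μ :=
        Finset.sum_le_sum fun k _ =>
          integral_sq_intervalIntegral_le hβ.1 ((D.contG k).mono hsub)
    _ = (β - ρ) * ∫ s in ρ..β, D.eG s := by rw [← Finset.mul_sum, h1]
    _ ≤ d * D.Gq := by
      have h2 : 0 ≤ ∫ r in ρ..β, D.eG r :=
        intervalIntegral.integral_nonneg hβ.1 fun r _ => D.eG_nonneg r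
      exact mul_le_mul (by linarith [hβ.2]) (D.integral_le_Gq hd hβ) h2 hd

lemma Gq_le (hd : 0 ≤ d) (hC : 0 ≤ C) : D.Gq ≤ C * (d ^ 2 * D.Nq + d ^ 2 * D.Gq + D.Nq) := by
  have h : D.Gq ≤ ∫ r in ρ..(ρ + d), C * (d * D.Nq + d * D.Gq + D.eq r) := by
    refine intervalIntegral.integral_mono_on (by linarith)
      (D.cont_eG.intervalIntegrable_of_Icc (by linarith))
      (ContinuousOn.intervalIntegrable_of_Icc (by linarith)
        (continuousOn_const.mul (continuousOn_const.add D.cont_eq))) fun r hr => ?_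
    refine (D.control r hr).trans ?_
    have h1 := D.integral_sq_q_le hd hr
    have h2 := D.integral_sq_G_le hd hr
    simp only [eq]
    gcongr
  refine h.trans (le_of_eq ?_)
  rw [intervalIntegral.integral_const_mul, intervalIntegral.integral_add (by simp)
    (D.cont_eq.intervalIntegrable_of_Icc (by linarith)), intervalIntegral.integral_const]
  simp only [Nq, smul_eq_mul]
  ring

lemma integral_eW_le (hρ : 0 < ρ) (hd : 0 < d) :
    ∫ z in Tri ρ d, D.eW z ≤ d ^ 2 * D.Z := by
  have hX : ∫ z in Tri ρ d, D.eA z ≤ D.Z := by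
    refine integral_mono_ae (integrableOn_Tri D.cont_eA)
      (integrableOn_Tri (D.cont_eA.add ((cont_weight hρ).mul D.cont_eL)))
      (Filter.Eventually.of_forall fun z => ?_)
    have : 0 ≤ ((z.2 - z.1) ^ 2)⁻¹ * D.eL z := mul_nonneg (by positivity) (D.eL_nonneg z)
    simp only
    linarith
  refine le_trans ?_ (mul_le_mul_of_nonneg_left hX (sq_nonneg d))
  rw [setIntegral_Tri_eq' hd.le D.cont_eW, setIntegral_Tri_eq' hd.le D.cont_eA]
  -- the total over `α` of `A²` at fixed `β`
  set J : ℝ → ℝ := fun β => ∫ α in (0:ℝ)..(β - ρ), D.eA (α, β) with hJ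
  have pt : ∀ β ∈ Icc ρ (ρ + d), ∀ α ∈ Icc 0 (β - ρ), D.eW (α, β) ≤ d * J β := by
    intro β hβ α hα
    have hmaps : MapsTo (fun p : ℝ × S => ((p.1, β), p.2)) (Icc α (β - ρ) ×ˢ univ)
        (Tri ρ d ×ˢ univ) := fun p hp =>
      ⟨⟨hα.1.trans hp.1.1, by simp only; linarith [hp.1.2], hβ.2⟩, mem_univ _⟩
    have hAc : ContinuousOn (fun p : ℝ × S => D.A ((p.1, β), p.2)) (Icc α (β - ρ) ×ˢ univ) :=
      D.contA.comp (by fun_prop) hmaps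
    have hWeq : ∀ ω, D.W ((α, β), ω) = -∫ a in α..(β - ρ), D.A ((a, β), ω) := by
      intro ω
      have hm1 : MapsTo (fun a : ℝ => ((a, β), ω)) (Icc α (β - ρ)) (Tri ρ d ×ˢ univ) :=
        fun a ha => hmaps (x := (a, ω)) ⟨ha, mem_univ _⟩
      rw [intervalIntegral.integral_eq_sub_of_hasDerivAt_of_le hα.2
        (f := fun a => D.W ((a, β), ω)) (D.contW.comp (by fun_prop) hm1)
        (fun a ha => D.derivW a β ω (hα.1.trans_lt ha.1) (by linarith [ha.2]) hβ.2)
        ((D.contA.comp (by fun_prop) hm1).intervalIntegrable_of_Icc hα.2)]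
      have := D.zeroW (β - ρ) ⟨by linarith [hβ.1], by linarith [hβ.2]⟩ ω
      rw [show ρ + (β - ρ) = β by ring] at this
      rw [this]; ring
    have h1 := integral_sq_intervalIntegral_le (μ := μ) hα.2 hAc
    have h2 : D.eW (α, β) = ∫ ω, (∫ a in α..(β - ρ), D.A ((a, β), ω)) ^ 2 ∂μ := by
      simp only [eW, hWeq, neg_sq]
    rw [h2]
    refine h1.trans ?_
    have hm2 : MapsTo (fun a : ℝ => (a, β)) (Icc 0 (β - ρ)) (Tri ρ d) :=
      fun a ha => ⟨ha.1, by simp only; linarith [ha.2], hβ.2⟩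
    have h3 : ∫ a in α..(β - ρ), D.eA (a, β) ≤ J β :=
      intervalIntegral.integral_mono_interval hα.1 hα.2 le_rfl
        (Filter.Eventually.of_forall fun r => D.eA_nonneg _)
        ((D.cont_eA.comp (by fun_prop) hm2).intervalIntegrable_of_Icc (hα.1.trans hα.2))
    have h4 : 0 ≤ ∫ a in α..(β - ρ), D.eA (a, β) :=
      intervalIntegral.integral_nonneg hα.2 fun a _ => D.eA_nonneg _
    exact mul_le_mul (by linarith [hα.1, hβ.2]) h3 h4 hd.le
  rw [← intervalIntegral.integral_const_mul]
  have hle : ρ ≤ ρ + d := by linarith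
  refine intervalIntegral.integral_mono_on hle (intervalIntegrable_Tri_slice hd.le D.cont_eW)
    ((intervalIntegrable_Tri_slice hd.le D.cont_eA).const_mul _) fun β hβ => ?_
  have h0 : 0 ≤ β - ρ := by linarith [hβ.1]
  have hm2 : MapsTo (fun a : ℝ => (a, β)) (Icc 0 (β - ρ)) (Tri ρ d) :=
      fun a ha => ⟨ha.1, by simp only; linarith [ha.2], hβ.2⟩
  have hJ0 : 0 ≤ J β := intervalIntegral.integral_nonneg h0 fun a _ => D.eA_nonneg _
  calc ∫ α in (0:ℝ)..(β - ρ), D.eW (α, β) ≤ ∫ α in (0:ℝ)..(β - ρ), d * J β :=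
        intervalIntegral.integral_mono_on h0
          ((D.cont_eW.comp (by fun_prop) hm2).intervalIntegrable_of_Icc h0) (by simp) (pt β hβ)
    _ = (β - ρ) * (d * J β) := by
        rw [intervalIntegral.integral_const, sub_zero, smul_eq_mul]
    _ ≤ d * (d * J β) := by
        have : β - ρ ≤ d := by linarith [hβ.2]
        gcongr
    _ = d ^ 2 * J β := by ring

end TriangleData

namespace TriangleData

variable {S : Type*} [MetricSpace S] [CompactSpace S] [MeasurableSpace S]
    [BorelSpace S] {μ : Measure S} [IsFiniteMeasure μ] {ρ d M C : ℝ}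
    (D : TriangleData μ ρ d M C)

lemma integral_eF_le (hd : 0 < d) :
    ∫ z in Tri ρ d, D.eF z ≤
      2 * M ^ 2 * (∫ z in Tri ρ d, D.eW z) + 2 * M ^ 2 * (d * D.Nq) := by
  have hmaps : MapsTo (fun z : ℝ × ℝ => z.2 - z.1) (Tri ρ d) (Icc ρ (ρ + d)) :=
    fun z hz => ⟨by simp only; linarith [hz.2.1], by simp only; linarith [hz.1, hz.2.2]⟩
  have hqc : ContinuousOn (fun z : ℝ × ℝ => D.eq (z.2 - z.1)) (Tri ρ d) :=
    D.cont_eq.comp (by fun_prop) hmaps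
  have h1 : ∫ z in Tri ρ d, D.eF z ≤
      ∫ z in Tri ρ d, (2 * M ^ 2 * D.eW z + 2 * M ^ 2 * D.eq (z.2 - z.1)) := by
    refine setIntegral_mono_on (integrableOn_Tri D.cont_eF) (integrableOn_Tri
      ((continuousOn_const.mul D.cont_eW).add (continuousOn_const.mul hqc)))
      (isCompact_Tri ρ d).measurableSet fun z hz => ?_
    have i1 : Continuous fun ω => D.W (z, ω) ^ 2 := (continuous_slice D.contW hz).pow 2
    have i2 : Continuous fun ω => D.q (z.2 - z.1, ω) ^ 2 :=
      (continuous_slice D.contq (hmaps hz)).pow 2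
    simp only [eF, eW, eq]
    rw [← integral_const_mul, ← integral_const_mul, ← integral_add
      ((integrable_of_continuous_compact i1).const_mul _)
      ((integrable_of_continuous_compact i2).const_mul _)]
    exact integral_mono
      (integrable_of_continuous_compact ((continuous_slice D.contF hz).pow 2))
      (((integrable_of_continuous_compact i1).const_mul _).add
      ((integrable_of_continuous_compact i2).const_mul _)) fun ω => D.source z hz ω
  have h2 : ∫ z in Tri ρ d, D.eq (z.2 - z.1) ≤ d * D.Nq := by
    rw [setIntegral_Tri_eq' hd.le hqc]
    have : ∫ β in ρ..(ρ + d), (∫ α in (0:ℝ)..(β - ρ), D.eq (β - α)) ≤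
        ∫ β in ρ..(ρ + d), D.Nq := by
      refine intervalIntegral.integral_mono_on (by linarith)
        (intervalIntegrable_Tri_slice hd.le hqc) (by simp) fun β hβ => ?_
      rw [intervalIntegral.integral_comp_sub_left (fun x => D.eq x)]
      simpa using D.integral_le_Nq hd.le hβ
    simpa using this
  refine h1.trans ?_
  rw [integral_add ((integrableOn_Tri D.cont_eW).const_mul _)
    ((integrableOn_Tri hqc).const_mul _), integral_const_mul, integral_const_mul]
  gcongr

lemma integral_eL_bottom_le (hd : 0 < d) :
    ∫ β in ρ..(ρ + d), D.eL (0, β) ≤ d ^ 2 * D.Gq := by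
  have hm : MapsTo (fun b : ℝ => ((0:ℝ), b)) (Icc ρ (ρ + d)) (Tri ρ d) :=
    fun b hb => ⟨le_rfl, by simpa using hb.1, hb.2⟩
  have : ∫ β in ρ..(ρ + d), D.eL (0, β) ≤ ∫ β in ρ..(ρ + d), d * D.Gq := by
    refine intervalIntegral.integral_mono_on (by linarith)
      ((D.cont_eL.comp (by fun_prop) hm).intervalIntegrable_of_Icc (by linarith)) (by simp)
      fun β hβ => ?_
    have := D.integral_sq_G_le hd.le hβ
    simp only [eL]
    simpa only [D.bottomL _ β hβ] using this
  refine this.trans (le_of_eq ?_)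
  simp; ring

lemma integral_wL_le_Z (hρ : 0 < ρ) :
    ∫ z in Tri ρ d, ((z.2 - z.1) ^ 2)⁻¹ * D.eL z ≤ D.Z := by
  refine integral_mono_ae (integrableOn_Tri ((cont_weight hρ).mul D.cont_eL))
      (integrableOn_Tri (D.cont_eA.add ((cont_weight hρ).mul D.cont_eL)))
      (Filter.Eventually.of_forall fun z => ?_)
  have := D.eA_nonneg z
  simp only
  linarith

lemma Z_le (hρ : 0 < ρ) (hd : 0 < d) :
    D.Z ≤ d * ρ⁻¹ ^ 2 * 2 * (d ^ 2 * D.Gq) +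
      2 * d * ((∫ z in Tri ρ d, D.eF z) + D.Z + 2 * ρ⁻¹ * D.Z) := by
  have hLN : ContinuousOn (fun p => ∑ k, 2 * D.L k p * D.N k p) (Tri ρ d ×ˢ univ) :=
    continuousOn_finsetSum _ fun k _ => (continuousOn_const.mul (D.contL k)).mul (D.contN k)
  have hAH : ContinuousOn (fun p => 2 * D.A p * D.H p) (Tri ρ d ×ˢ univ) :=
    (continuousOn_const.mul D.contA).mul D.contH
  have key := triangle_energy hρ hd (a := D.eA) (a' := fun z => ∫ ω, 2 * D.A (z, ω) * D.H (z, ω) ∂μ)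
    (b := D.eL) (b' := fun z => ∫ ω, ∑ k, 2 * D.L k (z, ω) * D.N k (z, ω) ∂μ) (f := D.eF)
    D.cont_eA (continuousOn_integral_compact (isCompact_Tri ρ d) hAH)
    D.cont_eL (continuousOn_integral_compact (isCompact_Tri ρ d) hLN) D.cont_eF
    ?_ ?_ (fun z _ => D.eA_nonneg z) (fun z _ => D.eL_nonneg z) (fun z _ => D.eF_nonneg z)
    (fun α hα => by simp [eA, D.zeroA α hα]) (fun α hα => by simp [eL, D.zeroL _ α hα]) ?_
  · have hA : IntegrableOn D.eA (Tri ρ d) := integrableOn_Tri D.cont_eA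
    have hL : IntegrableOn (fun z : ℝ × ℝ => ((z.2 - z.1) ^ 2)⁻¹ * D.eL z) (Tri ρ d) :=
      integrableOn_Tri ((cont_weight hρ).mul D.cont_eL)
    have hF : IntegrableOn D.eF (Tri ρ d) := integrableOn_Tri D.cont_eF
    have e : ∫ z in Tri ρ d, (D.eF z + D.eA z + 2 * ρ⁻¹ * (((z.2 - z.1) ^ 2)⁻¹ * D.eL z)) ≤
        (∫ z in Tri ρ d, D.eF z) + D.Z + 2 * ρ⁻¹ * D.Z := by
      have hFA : IntegrableOn (fun z => D.eF z + D.eA z) (Tri ρ d) := hF.add hA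
      rw [integral_add hFA (hL.const_mul _), integral_add hF hA, integral_const_mul]
      have hAZ : ∫ z in Tri ρ d, D.eA z ≤ D.Z := by
        refine integral_mono_ae hA (hA.add hL) (Filter.Eventually.of_forall fun z => ?_)
        have : 0 ≤ ((z.2 - z.1) ^ 2)⁻¹ * D.eL z := mul_nonneg (by positivity) (D.eL_nonneg z)
        simp only
        linarith
      have := D.integral_wL_le_Z hρ
      gcongr
    refine key.trans ?_
    have := D.integral_eL_bottom_le hd
    gcongr
  · intro α β hα h1 h2
    have hm : MapsTo (fun p : ℝ × S => ((α, p.1), p.2)) (Icc (ρ + α) (ρ + d) ×ˢ univ)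
        (Tri ρ d ×ˢ univ) := fun p hp => ⟨⟨hα.le, hp.1.1, hp.1.2⟩, mem_univ _⟩
    refine hasDerivAt_integral_compact (t := β) ⟨h1, h2⟩
      (g := fun p => D.A ((α, p.1), p.2) ^ 2)
      (g' := fun p => 2 * D.A ((α, p.1), p.2) * D.H ((α, p.1), p.2))
      ((D.contA.comp (by fun_prop) hm).pow 2) (hAH.comp (by fun_prop) hm) fun s hs ω => ?_
    simpa using (D.derivA α s ω hα hs.1 hs.2).fun_pow 2
  · intro α β hα h1 h2
    have hm : MapsTo (fun p : ℝ × S => ((p.1, β), p.2)) (Icc 0 (β - ρ) ×ˢ univ)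
        (Tri ρ d ×ˢ univ) := fun p hp => ⟨⟨hp.1.1, by simp only; linarith [hp.1.2], h2⟩, mem_univ _⟩
    refine hasDerivAt_integral_compact (t := α) (c := 0) (e := β - ρ) ⟨hα, by linarith⟩
      (g := fun p => ∑ k, D.L k ((p.1, β), p.2) ^ 2)
      (g' := fun p => ∑ k, 2 * D.L k ((p.1, β), p.2) * D.N k ((p.1, β), p.2))
      (continuousOn_finsetSum _ fun k _ => ((D.contL k).comp (by fun_prop) hm).pow 2)
      (hLN.comp (by fun_prop) hm) fun s hs ω => ?_
    refine HasDerivAt.fun_sum fun k _ => ?_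
    simpa using (D.derivL k s β ω hs.1 (by linarith [hs.2]) h2).fun_pow 2
  · intro z hz hz0
    have cA := continuous_slice D.contA hz
    have cF := continuous_slice D.contF hz
    have cP := continuous_slice D.contP hz
    have iPA : Integrable (fun ω => D.P (z, ω) * D.A (z, ω)) μ :=
      integrable_of_continuous_compact (cP.mul cA)
    have iAF : Integrable (fun ω => 2 * D.A (z, ω) * D.F (z, ω)) μ :=
      integrable_of_continuous_compact ((continuous_const.mul cA).mul cF)
    have iF2 : Integrable (fun ω => D.F (z, ω) ^ 2) μ :=
      integrable_of_continuous_compact (cF.pow 2)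
    have iA2 : Integrable (fun ω => D.A (z, ω) ^ 2) μ :=
      integrable_of_continuous_compact (cA.pow 2)
    have e1 : ∫ ω, 2 * D.A (z, ω) * D.H (z, ω) ∂μ =
        2 * ((z.2 - z.1) ^ 2)⁻¹ * (∫ ω, D.P (z, ω) * D.A (z, ω) ∂μ) +
          ∫ ω, 2 * D.A (z, ω) * D.F (z, ω) ∂μ := by
      rw [← integral_const_mul, ← integral_add (iPA.const_mul _) iAF]
      refine integral_congr_ae (Filter.Eventually.of_forall fun ω => ?_)
      simp only
      rw [D.pde z hz hz0 ω]; ring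
    have e2 : ∫ ω, ∑ k, 2 * D.L k (z, ω) * D.N k (z, ω) ∂μ =
        2 * ∫ ω, ∑ k, D.L k (z, ω) * D.N k (z, ω) ∂μ := by
      rw [← integral_const_mul]
      simp only [Finset.mul_sum, mul_assoc]
    have e3 : ∫ ω, 2 * D.A (z, ω) * D.F (z, ω) ∂μ ≤ D.eF z + D.eA z := by
      simp only [eF, eA]
      rw [← integral_add iF2 iA2]
      refine integral_mono iAF (iF2.add iA2) fun ω => ?_
      simp only
      nlinarith [sq_nonneg (D.A (z, ω) - D.F (z, ω))]
    rw [e1, e2, D.partsA z hz hz0]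
    linarith

lemma two_eq_le (hρ : 0 < ρ) {β : ℝ} (hβ : β ∈ Icc ρ (ρ + d)) :
    2 * D.eq β ≤ (∫ α in (0:ℝ)..(β - ρ), (((β - α) ^ 2)⁻¹ * D.eL (α, β) + D.eF (α, β))) +
      d * (ρ⁻¹ ^ 2 * D.eG β + D.eq β) := by
  have h0 : 0 ≤ β - ρ := by linarith [hβ.1]
  have hm : MapsTo (fun a : ℝ => (a, β)) (Icc 0 (β - ρ)) (Tri ρ d) :=
    fun a ha => ⟨ha.1, by simp only; linarith [ha.2], hβ.2⟩
  have hm' : MapsTo (fun p : ℝ × S => ((p.1, β), p.2)) (Icc 0 (β - ρ) ×ˢ univ)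
      (Tri ρ d ×ˢ univ) := fun p hp => ⟨hm hp.1, mem_univ _⟩
  have cq := continuous_slice D.contq hβ
  have cqH : ContinuousOn (fun p : ℝ × S => -2 * (D.q (β, p.2) * D.H ((p.1, β), p.2)))
      (Icc 0 (β - ρ) ×ˢ univ) :=
    continuousOn_const.mul ((cq.comp continuous_snd).continuousOn.mul
      (D.contH.comp (by fun_prop) hm'))
  have hq : ∀ ω, D.q (β, ω) = -∫ a in (0:ℝ)..(β - ρ), D.H ((a, β), ω) := by
    intro ω
    have hm1 : MapsTo (fun a : ℝ => ((a, β), ω)) (Icc 0 (β - ρ)) (Tri ρ d ×ˢ univ) :=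
      fun a ha => ⟨hm ha, mem_univ _⟩
    rw [intervalIntegral.integral_eq_sub_of_hasDerivAt_of_le h0
      (f := fun a => D.B ((a, β), ω)) (D.contB.comp (by fun_prop) hm1)
      (fun a ha => D.derivB a β ω ha.1 (by linarith [ha.2]) hβ.2)
      ((D.contH.comp (by fun_prop) hm1).intervalIntegrable_of_Icc h0)]
    have := D.zeroB (β - ρ) ⟨by linarith [hβ.1], by linarith [hβ.2]⟩ ω
    rw [show ρ + (β - ρ) = β by ring] at this
    rw [this, D.bottomB β hβ]; ring
  have e1 : 2 * D.eq β =
      ∫ α in (0:ℝ)..(β - ρ), ∫ ω, -2 * (D.q (β, ω) * D.H ((α, β), ω)) ∂μ := by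
    rw [← integral_intervalIntegral_compact h0 cqH, eq, ← integral_const_mul]
    refine integral_congr_ae (Filter.Eventually.of_forall fun ω => ?_)
    simp only [intervalIntegral.integral_const_mul]
    have := hq ω
    rw [sq]
    nth_rewrite 2 [this]
    ring
  have cw : ContinuousOn (fun a : ℝ => ((β - a) ^ 2)⁻¹) (Icc 0 (β - ρ)) :=
    (cont_weight hρ (d := d)).comp (f := fun a : ℝ => (a, β)) (by fun_prop) hm
  have cint : ContinuousOn (fun α => ((β - α) ^ 2)⁻¹ * D.eL (α, β) + D.eF (α, β))
      (Icc 0 (β - ρ)) := by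
    refine (cw.mul (D.cont_eL.comp (by fun_prop) hm)).add (D.cont_eF.comp (by fun_prop) hm)
  have e2 : ∫ α in (0:ℝ)..(β - ρ), ∫ ω, -2 * (D.q (β, ω) * D.H ((α, β), ω)) ∂μ ≤
      ∫ α in (0:ℝ)..(β - ρ), ((((β - α) ^ 2)⁻¹ * D.eL (α, β) + D.eF (α, β)) +
        (ρ⁻¹ ^ 2 * D.eG β + D.eq β)) := by
    refine intervalIntegral.integral_mono_on_of_le_Ioo h0
      ((continuousOn_integral_compact isCompact_Icc cqH).intervalIntegrable_of_Icc h0)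
      ((cint.add continuousOn_const).intervalIntegrable_of_Icc h0) fun α hα => ?_
    have hz : (α, β) ∈ Tri ρ d := hm (Ioo_subset_Icc_self hα)
    have cP := continuous_slice D.contP hz
    have cF := continuous_slice D.contF hz
    have cL := fun k => continuous_slice (D.contL k) hz
    have cG := fun k => continuous_slice (D.contG k) hβ
    have cLG : Continuous fun ω => ∑ k, D.L k ((α, β), ω) * D.G k (β, ω) :=
      continuous_finsetSum _ fun k _ => (cL k).mul (cG k)
    have cL2 : Continuous fun ω => ∑ k, D.L k ((α, β), ω) ^ 2 :=
      continuous_finsetSum _ fun k _ => (cL k).pow 2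
    have cG2 : Continuous fun ω => ∑ k, D.G k (β, ω) ^ 2 :=
      continuous_finsetSum _ fun k _ => (cG k).pow 2
    have iPq : Integrable (fun ω => D.P ((α, β), ω) * D.q (β, ω)) μ :=
      integrable_of_continuous_compact (cP.mul cq)
    have iqF : Integrable (fun ω => -2 * (D.q (β, ω) * D.F ((α, β), ω))) μ :=
      integrable_of_continuous_compact (continuous_const.mul (cq.mul cF))
    have iF2 : Integrable (fun ω => D.F ((α, β), ω) ^ 2) μ :=
      integrable_of_continuous_compact (cF.pow 2)
    have iq2 : Integrable (fun ω => D.q (β, ω) ^ 2) μ :=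
      integrable_of_continuous_compact (cq.pow 2)
    have hw : ((β - α) ^ 2)⁻¹ ≤ ρ⁻¹ ^ 2 := by
      rw [inv_pow]
      have : ρ ≤ β - α := by linarith [hα.2]
      gcongr
    have hw0 : 0 ≤ ((β - α) ^ 2)⁻¹ := by positivity
    have f1 : ∫ ω, -2 * (D.q (β, ω) * D.H ((α, β), ω)) ∂μ =
        ((β - α) ^ 2)⁻¹ * (2 * ∫ ω, ∑ k, D.L k ((α, β), ω) * D.G k (β, ω) ∂μ) +
          ∫ ω, -2 * (D.q (β, ω) * D.F ((α, β), ω)) ∂μ := by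
      have := D.partsq _ hz hα.1
      simp only at this
      rw [show ((β - α) ^ 2)⁻¹ * (2 * ∫ ω, ∑ k, D.L k ((α, β), ω) * D.G k (β, ω) ∂μ) =
        (-2 * ((β - α) ^ 2)⁻¹) * (-∫ ω, ∑ k, D.L k ((α, β), ω) * D.G k (β, ω) ∂μ) by ring,
        ← this, ← integral_const_mul, ← integral_add (iPq.const_mul _) iqF]
      refine integral_congr_ae (Filter.Eventually.of_forall fun ω => ?_)
      simp only
      rw [D.pde _ hz hα.1 ω]; ring
    have f2 : 2 * ∫ ω, ∑ k, D.L k ((α, β), ω) * D.G k (β, ω) ∂μ ≤ D.eL (α, β) + D.eG β := by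
      simp only [eL, eG]
      rw [← integral_const_mul, ← integral_add (integrable_of_continuous_compact cL2)
        (integrable_of_continuous_compact cG2)]
      refine integral_mono (integrable_of_continuous_compact (continuous_const.mul cLG))
        ((integrable_of_continuous_compact cL2).add
        (integrable_of_continuous_compact cG2)) fun ω => ?_
      simp only [← Finset.sum_add_distrib, Finset.mul_sum]
      refine Finset.sum_le_sum fun k _ => ?_
      nlinarith [sq_nonneg (D.L k ((α, β), ω) - D.G k (β, ω))]
    have f3 : ∫ ω, -2 * (D.q (β, ω) * D.F ((α, β), ω)) ∂μ ≤ D.eF (α, β) + D.eq β := by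
      simp only [eF, eq]
      rw [← integral_add iF2 iq2]
      refine integral_mono iqF (iF2.add iq2) fun ω => ?_
      simp only
      nlinarith [sq_nonneg (D.q (β, ω) + D.F ((α, β), ω))]
    rw [f1]
    have f4 := mul_le_mul_of_nonneg_left f2 hw0
    have f5 := mul_le_mul_of_nonneg_right hw (D.eG_nonneg β)
    linarith
  rw [e1]
  refine e2.trans ?_
  rw [intervalIntegral.integral_add (cint.intervalIntegrable_of_Icc h0) (by simp),
    intervalIntegral.integral_const, sub_zero, smul_eq_mul]
  have : 0 ≤ ρ⁻¹ ^ 2 * D.eG β + D.eq β :=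
    add_nonneg (mul_nonneg (by positivity) (D.eG_nonneg β)) (D.eq_nonneg β)
  have h3 : β - ρ ≤ d := by linarith [hβ.2]
  gcongr

lemma two_Nq_le (hρ : 0 < ρ) (hd : 0 < d) :
    2 * D.Nq ≤ D.Z + ρ⁻¹ ^ 2 * (d * D.Gq) + (∫ z in Tri ρ d, D.eF z) + d * D.Nq := by
  have hle : ρ ≤ ρ + d := by linarith
  have cLF : ContinuousOn (fun z : ℝ × ℝ => ((z.2 - z.1) ^ 2)⁻¹ * D.eL z + D.eF z) (Tri ρ d) :=
    ((cont_weight hρ).mul D.cont_eL).add D.cont_eF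
  have iL : IntegrableOn (fun z : ℝ × ℝ => ((z.2 - z.1) ^ 2)⁻¹ * D.eL z) (Tri ρ d) :=
    integrableOn_Tri ((cont_weight hρ).mul D.cont_eL)
  have i1 := intervalIntegrable_Tri_slice hd.le cLF
  have i2 := D.cont_eq.intervalIntegrable_of_Icc hle (μ := volume)
  have i3 := D.cont_eG.intervalIntegrable_of_Icc hle (μ := volume)
  have h := intervalIntegral.integral_mono_on hle (i2.const_mul 2)
    (i1.add (((i3.const_mul (ρ⁻¹ ^ 2)).add i2).const_mul d)) fun β hβ => D.two_eq_le hρ hβ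
  rw [intervalIntegral.integral_add i1 (((i3.const_mul (ρ⁻¹ ^ 2)).add i2).const_mul d),
    ← setIntegral_Tri_eq' hd.le cLF, intervalIntegral.integral_const_mul,
    intervalIntegral.integral_const_mul, intervalIntegral.integral_add (i3.const_mul _) i2,
    intervalIntegral.integral_const_mul, integral_add iL (integrableOn_Tri D.cont_eF)] at h
  have := D.integral_wL_le_Z hρ
  simp only [Nq, Gq] at *
  linarith

lemma eq_zero_of_Nq (hd : 0 < d) (h : D.Nq ≤ 0) {r : ℝ} (hr : r ∈ Icc ρ (ρ + d)) :
    D.eq r = 0 := by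
  by_contra hne
  have hpos : 0 < D.eq r := lt_of_le_of_ne (D.eq_nonneg r) (Ne.symm hne)
  have : 0 < D.Nq :=
    intervalIntegral.integral_pos (by linarith) D.cont_eq (fun x _ => D.eq_nonneg x)
      ⟨r, hr, hpos⟩
  linarith

end TriangleData

/-- Small triangles: the potential vanishes as soon as the data of a `TriangleData` exist on a
sufficiently small triangle, uniformly in `ρ ≥ R`. -/
theorem exists_triangle_uniqueness {S : Type*} [MetricSpace S] [CompactSpace S]
    [MeasurableSpace S] [BorelSpace S] {μ : Measure S} [IsFiniteMeasure μ] {R M C : ℝ}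
    (hR : 0 < R) (hC : 0 ≤ C) :
    ∃ δ > (0:ℝ), ∀ ρ d : ℝ, R ≤ ρ → 0 < d → d ≤ δ → ∀ D : TriangleData μ ρ d M C,
      ∀ r ∈ Icc ρ (ρ + d), ∫ ω, D.q (r, ω) ^ 2 ∂μ = 0 := by
  obtain ⟨δ, hδ, h⟩ := exists_absorption R⁻¹ M C (by positivity) hC
  refine ⟨δ, hδ, fun ρ d hρ hd hdδ D r hr => D.eq_zero_of_Nq hd ?_ hr⟩
  have hρ0 : 0 < ρ := hR.trans_le hρ
  have hZ := D.Z_nonneg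
  have hG := D.Gq_nonneg hd.le
  have hinv : ρ⁻¹ ≤ R⁻¹ := by gcongr
  refine h d D.Z D.Nq D.Gq (∫ z in Tri ρ d, D.eF z) hd hdδ hZ (D.Nq_nonneg hd.le) hG ?_ ?_ ?_
    (D.Gq_le hd.le hC)
  · refine (D.Z_le hρ0 hd).trans ?_
    gcongr
  · refine (D.integral_eF_le hd).trans ?_
    have := D.integral_eW_le hρ0 hd
    gcongr
  · refine (D.two_Nq_le hρ0 hd).trans ?_
    gcongr

/-- The unit sphere of `ℝ³`. -/
abbrev US : Type := sphere (0 : E3) 1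

/-- The surface measure of the unit sphere. -/
abbrev surf : Measure US := μH[2]

/-- A linear isometry of `ℝ³` acting on the unit sphere. -/
def sphereIso (e : E3 ≃ₗᵢ[ℝ] E3) : US ≃ᵢ US where
  toFun ω := ⟨e ω, by simp⟩
  invFun ω := ⟨e.symm ω, by simp⟩
  left_inv ω := by simp
  right_inv ω := by simp
  isometry_toFun := fun x y => by
    rw [Subtype.edist_eq, Subtype.edist_eq]; exact e.isometry _ _

lemma integral_comp_sphereIso (e : E3 ≃ₗᵢ[ℝ] E3) (f : US → ℝ) :
    ∫ ω, f (sphereIso e ω) ∂surf = ∫ ω, f ω ∂surf :=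
  ((sphereIso e).measurePreserving_hausdorffMeasure 2).integral_comp
    (sphereIso e).toHomeomorph.measurableEmbedding f

lemma surf_image_val (s : Set US) : (μH[2] : Measure E3) (Subtype.val '' s) = surf s :=
  isometry_subtype_coe.hausdorffMeasure_image (Or.inl (by norm_num)) s

/-- Spherical coordinates. -/
def spherical (p : ℝ × ℝ) : E3 :=
  !₂[sin p.1 * cos p.2, sin p.1 * sin p.2, cos p.1]

lemma contDiff_spherical : ContDiff ℝ 1 spherical := by
  unfold spherical
  rw [contDiff_piLp]
  intro i
  fin_cases i
  · exact (contDiff_sin.comp contDiff_fst).mul (contDiff_cos.comp contDiff_snd)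
  · exact (contDiff_sin.comp contDiff_fst).mul (contDiff_sin.comp contDiff_snd)
  · exact contDiff_cos.comp contDiff_fst

lemma sphere_subset_spherical :
    sphere (0 : E3) 1 ⊆ spherical '' (Icc 0 π ×ˢ Icc (-π) π) := by
  intro x hx
  have hx1 : x 0 ^ 2 + x 1 ^ 2 + x 2 ^ 2 = 1 := by
    have : ‖x‖ ^ 2 = 1 := by rw [mem_sphere_zero_iff_norm.1 hx]; norm_num
    rw [EuclideanSpace.norm_sq_eq, Fin.sum_univ_three] at this
    simpa using this
  have h2 : -1 ≤ x 2 ∧ x 2 ≤ 1 := abs_le.1 (by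
    rw [← sq_le_one_iff_abs_le_one]; nlinarith [sq_nonneg (x 0), sq_nonneg (x 1)])
  set z : ℂ := ⟨x 0, x 1⟩ with hz
  have hn : ‖z‖ = sin (arccos (x 2)) := by
    rw [sin_arccos, Complex.norm_def, Complex.normSq_mk]
    congr 1
    linarith
  refine ⟨(arccos (x 2), z.arg), ⟨⟨arccos_nonneg _, arccos_le_pi _⟩,
    ⟨(Complex.neg_pi_lt_arg z).le, Complex.arg_le_pi z⟩⟩, ?_⟩
  ext i
  fin_cases i
  · simp [spherical, ← hn, Complex.norm_mul_cos_arg, hz]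
  · simp [spherical, ← hn, Complex.norm_mul_sin_arg, hz]
  · simp [spherical, cos_arccos h2.1 h2.2]

instance isFiniteMeasure_surf : IsFiniteMeasure surf := by
  refine ⟨?_⟩
  rw [← surf_image_val]
  have hK : IsCompact (Icc 0 π ×ˢ Icc (-π) π : Set (ℝ × ℝ)) := isCompact_Icc.prod isCompact_Icc
  obtain ⟨K, hL⟩ := (contDiff_spherical.locallyLipschitz.locallyLipschitzOn
    (s := Icc 0 π ×ˢ Icc (-π) π)).exists_lipschitzOnWith_of_compact hK
  have h1 := hL.hausdorffMeasure_image_le (d := 2) (by norm_num)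
  rw [hausdorffMeasure_prod_real] at h1
  have h2 : Subtype.val '' (univ : Set US) ⊆ spherical '' (Icc 0 π ×ˢ Icc (-π) π) := by
    rw [Subtype.coe_image_univ]; exact sphere_subset_spherical
  refine (measure_mono h2).trans_lt (h1.trans_lt ?_)
  exact ENNReal.mul_lt_top (ENNReal.rpow_lt_top_of_nonneg (by norm_num) (by simp))
    hK.measure_lt_top

lemma surf_univ_pos : 0 < surf univ := by
  set f : E3 → ℝ × ℝ := fun x => (x 0, x 1) with hf
  have hL : LipschitzWith 1 f := by
    refine LipschitzWith.of_dist_le_mul fun x y => ?_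
    rw [NNReal.coe_one, one_mul, Prod.dist_eq]
    exact max_le (by simpa [dist_eq_norm] using PiLp.norm_apply_le (x - y) 0)
      (by simpa [dist_eq_norm] using PiLp.norm_apply_le (x - y) 1)
  have h1 := hL.hausdorffMeasure_image_le (d := 2) (by norm_num) (sphere (0 : E3) 1)
  have h2 : Icc (0:ℝ) (1/2) ×ˢ Icc (0:ℝ) (1/2) ⊆ f '' sphere (0 : E3) 1 := by
    rintro ⟨a, b⟩ ⟨ha, hb⟩
    simp only [mem_Icc] at ha hb
    refine ⟨!₂[a, b, √(1 - a ^ 2 - b ^ 2)], ?_, by simp [hf]⟩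
    rw [mem_sphere_zero_iff_norm, EuclideanSpace.norm_eq, Fin.sum_univ_three]
    have : 0 ≤ 1 - a ^ 2 - b ^ 2 := by nlinarith
    simp [Real.sq_sqrt this]
  have h3 := (measure_mono (μ := (μH[2] : Measure (ℝ × ℝ))) h2).trans h1
  have h4 : surf univ = (μH[2] : Measure E3) (sphere (0 : E3) 1) := by
    rw [← surf_image_val, Subtype.coe_image_univ]
  rw [h4]
  refine lt_of_lt_of_le ?_ (h3.trans_eq (by simp))
  rw [hausdorffMeasure_prod_real, Measure.volume_eq_prod, Measure.prod_prod]
  simp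

instance isOpenPosMeasure_surf : surf.IsOpenPosMeasure := by
  refine ⟨fun U hU ⟨ω₀, hω₀⟩ h0 => ?_⟩
  have hcov : ∀ ω : US, ∃ V : Set US, IsOpen V ∧ ω ∈ V ∧ surf V = 0 := by
    intro ω
    set e : E3 ≃ₗᵢ[ℝ] E3 := (ℝ ∙ ((ω : E3) - ω₀))ᗮ.reflection with he
    have hew : e ω = ω₀ := Submodule.reflection_sub (by simp)
    refine ⟨sphereIso e ⁻¹' U, hU.preimage (sphereIso e).continuous, ?_, ?_⟩
    · have : sphereIso e ω = ω₀ := Subtype.ext hew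
      simpa [this] using hω₀
    · rw [IsometryEquiv.hausdorffMeasure_preimage]; exact h0
  choose V hVo hVm hV0 using hcov
  obtain ⟨t, ht⟩ := isCompact_univ.elim_finite_subcover V hVo
    fun ω _ => mem_iUnion.2 ⟨ω, hVm ω⟩
  have : surf univ ≤ 0 := (measure_mono ht).trans
    ((measure_biUnion_finset_le t V).trans (by simp [hV0]))
  exact absurd this (not_le.2 surf_univ_pos)

lemma sphInt_eq {r : ℝ} (hr : 0 < r) (g : E3 → ℝ) :
    sphInt r g = r ^ 2 * ∫ ω : US, g (r • (ω : E3)) ∂surf := by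
  set Φ : US → E3 := fun ω => r • (ω : E3) with hΦ
  have hemb : MeasurableEmbedding Φ :=
    ((Homeomorph.smulOfNeZero r hr.ne').isClosedEmbedding.comp
      (isClosed_sphere.isClosedEmbedding_subtypeVal)).measurableEmbedding
  have hrange : range Φ = sphere (0:E3) r := by
    ext x
    simp only [mem_range, mem_sphere_zero_iff_norm, hΦ]
    constructor
    · rintro ⟨ω, rfl⟩
      rw [norm_smul, norm_eq_of_mem_sphere, mul_one, Real.norm_of_nonneg hr.le]
    · intro hx
      refine ⟨⟨r⁻¹ • x, ?_⟩, by simp [smul_smul, hr.ne']⟩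
      rw [mem_sphere_zero_iff_norm, norm_smul, hx, norm_inv, Real.norm_of_nonneg hr.le,
        inv_mul_cancel₀ hr.ne']
  have hmeas : (μH[2] : Measure E3).restrict (sphere (0:E3) r) =
      ENNReal.ofReal (r ^ 2) • Measure.map Φ surf := by
    ext s hs
    rw [Measure.restrict_apply hs, Measure.smul_apply, hemb.map_apply, ← surf_image_val]
    have : s ∩ sphere 0 r = (fun x : E3 => r • x) '' (Subtype.val '' (Φ ⁻¹' s)) := by
      rw [image_image]
      change _ = Φ '' (Φ ⁻¹' s)
      rw [image_preimage_eq_inter_range, hrange]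
    rw [this, image_smul, Measure.hausdorffMeasure_smul₀ (by norm_num) hr.ne']
    rw [ENNReal.smul_def, smul_eq_mul, smul_eq_mul]
    congr 1
    rw [ENNReal.ofReal_pow hr.le, ← Real.enorm_of_nonneg hr.le]
    simp [enorm]
  rw [sphInt, hmeas, integral_smul_measure, hemb.integral_map,
    ENNReal.toReal_ofReal (by positivity), smul_eq_mul]

/-- The smaller index of the `k`-th coordinate plane. -/
def pfst : Fin 3 → Fin 3 := ![0, 0, 1]

/-- The larger index of the `k`-th coordinate plane. -/
def psnd : Fin 3 → Fin 3 := ![1, 2, 2]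

/-- The infinitesimal rotation `x ↦ xᵢ eⱼ − xⱼ eᵢ` in the `k`-th coordinate plane. -/
def infRot (k : Fin 3) : E3 →L[ℝ] E3 :=
  LinearMap.toContinuousLinearMap
    { toFun := fun x => x (pfst k) • basis3 (psnd k) - x (psnd k) • basis3 (pfst k)
      map_add' := fun x y => by simp only [PiLp.add_apply, add_smul]; abel
      map_smul' := fun c x => by
        simp only [PiLp.smul_apply, smul_eq_mul, mul_smul, RingHom.id_apply, smul_sub] }

lemma infRot_apply (k : Fin 3) (x : E3) :
    infRot k x = x (pfst k) • basis3 (psnd k) - x (psnd k) • basis3 (pfst k) := rfl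

lemma infRot_cube (k : Fin 3) (x : E3) : infRot k (infRot k (infRot k x)) = -infRot k x := by
  ext i
  fin_cases k <;> fin_cases i <;> simp [infRot_apply, pfst, psnd, basis3]

lemma sum_infRot_sq (x : E3) : ∑ k, infRot k (infRot k x) = (-2 : ℝ) • x := by
  ext i
  fin_cases i <;> simp [Fin.sum_univ_three, infRot_apply, pfst, psnd, basis3] <;> ring

lemma norm_sq_E3 (x : E3) : ‖x‖ ^ 2 = x 0 ^ 2 + x 1 ^ 2 + x 2 ^ 2 := by
  rw [EuclideanSpace.norm_sq_eq, Fin.sum_univ_three]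
  simp

lemma E3_eq_sum (x : E3) : x = ∑ i, x i • basis3 i := by
  ext i
  fin_cases i <;> simp [Fin.sum_univ_three, basis3]

lemma sum_infRot_bilin (b : (E3 × ℝ) →L[ℝ] (E3 × ℝ) →L[ℝ] ℝ) (x : E3) :
    ∑ k, b (infRot k x, 0) (infRot k x, 0) =
      ‖x‖ ^ 2 * (∑ i, b (basis3 i, 0) (basis3 i, 0)) - b (x, 0) (x, 0) := by
  have h1 : ∀ k, ((infRot k x, 0) : E3 × ℝ) =
      x (pfst k) • ((basis3 (psnd k), 0) : E3 × ℝ) - x (psnd k) • (basis3 (pfst k), 0) := by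
    intro k; rw [infRot_apply]; simp
  have h2 : ((x, 0) : E3 × ℝ) = x 0 • ((basis3 0, 0) : E3 × ℝ) + x 1 • (basis3 1, 0) +
      x 2 • (basis3 2, 0) := by
    conv_lhs => rw [E3_eq_sum x]
    simp [Fin.sum_univ_three]
  simp only [h1]
  rw [h2, norm_sq_E3]
  simp only [Fin.sum_univ_three, pfst, psnd, map_add, map_sub, map_smul,
    add_apply, sub_apply, smul_apply, smul_eq_mul, Matrix.cons_val_zero,
    Matrix.cons_val_one, Matrix.cons_val]
  ring

/-- The rotation by the angle `θ` in the `k`-th coordinate plane. -/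
def rotFun (k : Fin 3) (θ : ℝ) : E3 →ₗ[ℝ] E3 :=
  (ContinuousLinearMap.id ℝ E3 + sin θ • infRot k +
    (1 - cos θ) • (infRot k).comp (infRot k) : E3 →L[ℝ] E3)

lemma rotFun_apply (k : Fin 3) (θ : ℝ) (x : E3) :
    rotFun k θ x = x + sin θ • infRot k x + (1 - cos θ) • infRot k (infRot k x) := rfl

lemma norm_rotFun (k : Fin 3) (θ : ℝ) (x : E3) : ‖rotFun k θ x‖ = ‖x‖ := by
  rw [← sq_eq_sq₀ (norm_nonneg _) (norm_nonneg _), norm_sq_E3, norm_sq_E3, rotFun_apply]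
  have h := sin_sq_add_cos_sq θ
  fin_cases k <;> simp [infRot_apply, pfst, psnd, basis3]
  · linear_combination (x 0 ^ 2 + x 1 ^ 2) * h
  · linear_combination (x 0 ^ 2 + x 2 ^ 2) * h
  · linear_combination (x 1 ^ 2 + x 2 ^ 2) * h

/-- The rotation by the angle `θ` in the `k`-th coordinate plane, as a linear isometry. -/
def rot (k : Fin 3) (θ : ℝ) : E3 ≃ₗᵢ[ℝ] E3 :=
  LinearIsometry.toLinearIsometryEquiv ⟨rotFun k θ, norm_rotFun k θ⟩ rfl

lemma rot_apply (k : Fin 3) (θ : ℝ) (x : E3) :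
    rot k θ x = x + sin θ • infRot k x + (1 - cos θ) • infRot k (infRot k x) := rfl

@[simp] lemma rot_zero (k : Fin 3) (x : E3) : rot k 0 x = x := by simp [rot_apply]

lemma hasDerivAt_rot (k : Fin 3) (x : E3) (θ : ℝ) :
    HasDerivAt (fun t => rot k t x) (infRot k (rot k θ x)) θ := by
  have h := (((hasDerivAt_sin θ).smul_const (infRot k x)).const_add x).add
    (((hasDerivAt_cos θ).const_sub 1).smul_const (infRot k (infRot k x)))
  refine (h.congr_deriv ?_)
  rw [rot_apply, map_add, map_add, map_smul, map_smul, infRot_cube]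
  module

/-- The rotation by the angle `θ` in the `k`-th coordinate plane, acting on the unit sphere. -/
def rotS (k : Fin 3) (θ : ℝ) (ω : US) : US := sphereIso (rot k θ) ω

lemma coe_rotS (k : Fin 3) (θ : ℝ) (ω : US) : (rotS k θ ω : E3) = rot k θ ω := rfl

@[simp] lemma rotS_zero (k : Fin 3) (ω : US) : rotS k 0 ω = ω := Subtype.ext (by simp [coe_rotS])

lemma hasDerivAt_rotS (k : Fin 3) (ω : US) (θ : ℝ) :
    HasDerivAt (fun t => (rotS k t ω : E3)) (infRot k (rotS k θ ω)) θ :=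
  hasDerivAt_rot k ω θ

lemma continuous_rotS (k : Fin 3) : Continuous fun p : ℝ × US => rotS k p.1 p.2 := by
  refine Continuous.subtype_mk ?_ _
  change Continuous fun p : ℝ × US => (p.2 : E3) + sin p.1 • infRot k p.2 +
    (1 - cos p.1) • infRot k (infRot k p.2)
  fun_prop

/-- The integral over the sphere of an angular derivative vanishes. -/
lemma integral_angular_deriv_eq_zero (k : Fin 3) {g g' : US → ℝ} (hg : Continuous g)
    (hg' : Continuous g')
    (h : ∀ ω θ, HasDerivAt (fun t => g (rotS k t ω)) (g' (rotS k θ ω)) θ) :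
    ∫ ω, g' ω ∂surf = 0 := by
  have hc : Continuous fun p : ℝ × US => g' (rotS k p.1 p.2) := hg'.comp (continuous_rotS k)
  have h1 := integral_intervalIntegral_compact (μ := surf) (zero_le_one (α := ℝ))
    (g := fun p : ℝ × US => g' (rotS k p.1 p.2)) hc.continuousOn
  have h2 : ∀ ω : US, ∫ t in (0:ℝ)..1, g' (rotS k t ω) = g (rotS k 1 ω) - g ω := by
    intro ω
    rw [intervalIntegral.integral_eq_sub_of_hasDerivAt (fun t _ => h ω t)
      ((hc.comp (Continuous.prodMk_left ω)).intervalIntegrable _ _)]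
    simp
  have h3 : ∀ (f : US → ℝ) t, ∫ ω, f (rotS k t ω) ∂surf = ∫ ω, f ω ∂surf :=
    fun f t => integral_comp_sphereIso (rot k t) f
  simp only [h2, h3] at h1
  have c1 : Continuous fun ω => g (rotS k 1 ω) := hg.comp (sphereIso (rot k 1)).continuous
  rw [integral_sub (integrable_of_continuous_compact c1) (integrable_of_continuous_compact hg),
    h3] at h1
  simpa using h1.symm

/-- The open light cone `t > |x|`. -/
def ocone : Set (E3 × ℝ) := {p | ‖p.1‖ < p.2}

lemma isOpen_ocone : IsOpen ocone :=
  isOpen_lt (continuous_fst.norm) continuous_snd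

lemma ocone_subset : ocone ⊆ cone := fun p (hp : ‖p.1‖ < p.2) => (le_of_lt hp : ‖p.1‖ ≤ p.2)

lemma cone_mem_nhds {p : E3 × ℝ} (hp : p ∈ ocone) : cone ∈ nhds p :=
  Filter.mem_of_superset (isOpen_ocone.mem_nhds hp) ocone_subset

lemma uniqueDiffOn_cone : UniqueDiffOn ℝ cone := by
  refine uniqueDiffOn_convex ?_ ?_
  · intro x hx y hy a b ha hb hab
    have hx' : ‖x.1‖ ≤ x.2 := hx
    have hy' : ‖y.1‖ ≤ y.2 := hy
    change ‖a • x.1 + b • y.1‖ ≤ a * x.2 + b * y.2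
    refine (norm_add_le _ _).trans ?_
    rw [norm_smul, norm_smul, Real.norm_of_nonneg ha, Real.norm_of_nonneg hb]
    gcongr
  · refine ⟨(0, 1), mem_interior.2 ⟨ocone, ocone_subset, isOpen_ocone, ?_⟩⟩
    simp [ocone]

/-- The derivative of a function on the cone. -/
def dU (u : E3 × ℝ → ℝ) : E3 × ℝ → (E3 × ℝ →L[ℝ] ℝ) := fderivWithin ℝ u cone

/-- The second derivative of a function on the cone. -/
def d2U (u : E3 × ℝ → ℝ) : E3 × ℝ → (E3 × ℝ →L[ℝ] E3 × ℝ →L[ℝ] ℝ) := fderivWithin ℝ (dU u) cone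

section Regularity

variable {u : E3 × ℝ → ℝ} (hu : ContDiffOn ℝ 2 u cone)
include hu

lemma contDiffOn_dU : ContDiffOn ℝ 1 (dU u) cone :=
  hu.fderivWithin uniqueDiffOn_cone (by norm_num)

lemma continuousOn_dU : ContinuousOn (dU u) cone := (contDiffOn_dU hu).continuousOn

lemma continuousOn_d2U : ContinuousOn (d2U u) cone :=
  (contDiffOn_dU hu).continuousOn_fderivWithin uniqueDiffOn_cone le_rfl

lemma hasFDerivWithinAt_dU {p : E3 × ℝ} (hp : p ∈ cone) : HasFDerivWithinAt u (dU u p) cone p :=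
  (hu.differentiableOn (by norm_num) p hp).hasFDerivWithinAt

lemma hasFDerivAt_dU {p : E3 × ℝ} (hp : p ∈ ocone) : HasFDerivAt u (dU u p) p :=
  (hasFDerivWithinAt_dU hu (ocone_subset hp)).hasFDerivAt (cone_mem_nhds hp)

lemma hasFDerivAt_d2U {p : E3 × ℝ} (hp : p ∈ ocone) : HasFDerivAt (dU u) (d2U u p) p :=
  (((contDiffOn_dU hu).differentiableOn (by norm_num) p
    (ocone_subset hp)).hasFDerivWithinAt).hasFDerivAt (cone_mem_nhds hp)

lemma d2U_symm {p : E3 × ℝ} (hp : p ∈ ocone) (v w : E3 × ℝ) : d2U u p v w = d2U u p w v :=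
  second_derivative_symmetric_of_eventually
    (Filter.eventually_of_mem (isOpen_ocone.mem_nhds hp) fun _ hy => hasFDerivAt_dU hu hy)
    (hasFDerivAt_d2U hu hp) v w

lemma hasFDerivAt_dU_apply {p : E3 × ℝ} (hp : p ∈ ocone) (w : E3 × ℝ) :
    HasFDerivAt (fun y => dU u y w) ((d2U u p).flip w) p := by
  have := (hasFDerivAt_d2U hu hp).clm_apply (hasFDerivAt_const w p)
  refine this.congr_fderiv ?_
  ext v <;> simp

lemma pdt_pdt_eq {p : E3 × ℝ} (hp : p ∈ ocone) : pdt (pdt u) p = d2U u p (0, 1) (0, 1) := by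
  have h : pdt u =ᶠ[nhds p] fun y => dU u y (0, 1) :=
    Filter.eventually_of_mem (isOpen_ocone.mem_nhds hp) fun y hy => by
      simp only [pdt, (hasFDerivAt_dU hu hy).fderiv]
  rw [pdt, h.fderiv_eq, (hasFDerivAt_dU_apply hu hp _).fderiv]
  rfl

omit hu in
lemma hasFDerivAt_slice (x : E3) (t : ℝ) :
    HasFDerivAt (fun y : E3 => (y, t)) (ContinuousLinearMap.inl ℝ E3 ℝ) x :=
  (hasFDerivAt_id x).prodMk (hasFDerivAt_const t x)

lemma hasFDerivAt_fixT {p : E3 × ℝ} (hp : p ∈ ocone) :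
    HasFDerivAt (fixT u p.2) ((dU u p).comp (ContinuousLinearMap.inl ℝ E3 ℝ)) p.1 :=
  (hasFDerivAt_dU hu hp).comp p.1 (hasFDerivAt_slice p.1 p.2)

lemma pd_fixT {p : E3 × ℝ} (hp : p ∈ ocone) (i : Fin 3) :
    pd i (fixT u p.2) p.1 = dU u p (basis3 i, 0) := by
  rw [pd, (hasFDerivAt_fixT hu hp).fderiv]; rfl

lemma lapX_eq {p : E3 × ℝ} (hp : p ∈ ocone) :
    lapX u p = ∑ i, d2U u p (basis3 i, 0) (basis3 i, 0) := by
  unfold lapX lap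
  refine Finset.sum_congr rfl fun i _ => ?_
  have hn : {y : E3 | (y, p.2) ∈ ocone} ∈ nhds p.1 :=
    (isOpen_ocone.preimage (by fun_prop : Continuous fun y : E3 => (y, p.2))).mem_nhds hp
  have h : pd i (fixT u p.2) =ᶠ[nhds p.1] fun y => dU u (y, p.2) (basis3 i, 0) :=
    Filter.eventually_of_mem hn fun y hy => pd_fixT hu (p := (y, p.2)) hy i
  rw [pd, h.fderiv_eq]
  have := (hasFDerivAt_dU_apply hu hp (basis3 i, 0)).comp p.1 (hasFDerivAt_slice p.1 p.2)
  rw [HasFDerivAt.fderiv (f := fun y : E3 => dU u (y, p.2) (basis3 i, 0)) this]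
  rfl

end Regularity

lemma goursat_pde {q : E3 → ℝ} {u : E3 × ℝ → ℝ} (h : GoursatSol q u) {p : E3 × ℝ}
    (hp : p ∈ ocone) :
    d2U u p (0, 1) (0, 1) - ∑ i, d2U u p (basis3 i, 0) (basis3 i, 0) = q p.1 * u p := by
  have := h.2.1 p hp
  rw [pdt_pdt_eq h.1 hp, lapX_eq h.1 hp] at this
  linarith

lemma dU_sub {u w : E3 × ℝ → ℝ} (hu : ContDiffOn ℝ 2 u cone) (hw : ContDiffOn ℝ 2 w cone)
    {p : E3 × ℝ} (hp : p ∈ cone) : dU (u - w) p = dU u p - dU w p :=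
  fderivWithin_sub (uniqueDiffOn_cone p hp) (hu.differentiableOn (by norm_num) p hp)
    (hw.differentiableOn (by norm_num) p hp)

lemma d2U_sub {u w : E3 × ℝ → ℝ} (hu : ContDiffOn ℝ 2 u cone) (hw : ContDiffOn ℝ 2 w cone)
    {p : E3 × ℝ} (hp : p ∈ cone) : d2U (u - w) p = d2U u p - d2U w p := by
  rw [d2U, fderivWithin_congr (fun y hy => dU_sub hu hw hy) (dU_sub hu hw hp)]
  exact fderivWithin_fun_sub (uniqueDiffOn_cone p hp)
    ((contDiffOn_dU hu).differentiableOn (by norm_num) p hp)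
    ((contDiffOn_dU hw).differentiableOn (by norm_num) p hp)

/-- Null coordinates: the space-time point with `(t - r)/2 = α`, `(t + r)/2 = β`, direction `ω`. -/
def nullPt (p : (ℝ × ℝ) × US) : E3 × ℝ := ((p.1.2 - p.1.1) • (p.2 : E3), p.1.1 + p.1.2)

lemma continuous_nullPt : Continuous nullPt := by unfold nullPt; fun_prop

lemma norm_nullPt {z : ℝ × ℝ} (hz : z.1 ≤ z.2) (ω : US) : ‖(nullPt (z, ω)).1‖ = z.2 - z.1 := by
  rw [nullPt, norm_smul, norm_eq_of_mem_sphere, mul_one, Real.norm_of_nonneg (by simpa using hz)]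

lemma nullPt_mem_cone {z : ℝ × ℝ} (h : z.1 ≤ z.2) (h0 : 0 ≤ z.1) (ω : US) :
    nullPt (z, ω) ∈ cone := by
  change ‖(nullPt (z, ω)).1‖ ≤ z.1 + z.2
  rw [norm_nullPt h]; linarith

lemma nullPt_mem_ocone {z : ℝ × ℝ} (h : z.1 ≤ z.2) (h0 : 0 < z.1) (ω : US) :
    nullPt (z, ω) ∈ ocone := by
  change ‖(nullPt (z, ω)).1‖ < z.1 + z.2
  rw [norm_nullPt h]; linarith

lemma mapsTo_nullPt {ρ d : ℝ} (hρ : 0 < ρ) : MapsTo nullPt (Tri ρ d ×ˢ univ) cone :=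
  fun p hp => nullPt_mem_cone (z := p.1) (by linarith [hp.1.2.1]) hp.1.1 p.2

lemma hasDerivAt_nullPt_fst (α β : ℝ) (ω : US) :
    HasDerivAt (fun s => nullPt ((s, β), ω)) (-(ω : E3), 1) α := by
  have h1 := ((hasDerivAt_id α).const_sub β).smul_const (ω : E3)
  have h2 := (hasDerivAt_id α).add_const β
  simpa [nullPt] using h1.prodMk h2

lemma hasDerivAt_nullPt_snd (α β : ℝ) (ω : US) :
    HasDerivAt (fun s => nullPt ((α, s), ω)) ((ω : E3), 1) β := by
  have h1 := ((hasDerivAt_id β).sub_const α).smul_const (ω : E3)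
  have h2 := (hasDerivAt_id β).const_add α
  simpa [nullPt] using h1.prodMk h2

lemma hasDerivAt_nullPt_rot (z : ℝ × ℝ) (k : Fin 3) (ω : US) (θ : ℝ) :
    HasDerivAt (fun s => nullPt (z, rotS k s ω))
      ((z.2 - z.1) • infRot k (rotS k θ ω), (0:ℝ)) θ :=
  ((hasDerivAt_rotS k ω θ).const_smul (z.2 - z.1)).prodMk (hasDerivAt_const θ (z.1 + z.2))

/-- `W = r u` in null coordinates. -/
def nW (u : E3 × ℝ → ℝ) (p : (ℝ × ℝ) × US) : ℝ := (p.1.2 - p.1.1) * u (nullPt p)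
/-- `A = ∂_α W`. -/
def nA (u : E3 × ℝ → ℝ) (p : (ℝ × ℝ) × US) : ℝ :=
  -u (nullPt p) + (p.1.2 - p.1.1) * dU u (nullPt p) (-(p.2 : E3), 1)
/-- `B = ∂_β W`. -/
def nB (u : E3 × ℝ → ℝ) (p : (ℝ × ℝ) × US) : ℝ :=
  u (nullPt p) + (p.1.2 - p.1.1) * dU u (nullPt p) ((p.2 : E3), 1)
/-- `H = ∂_α ∂_β W`. -/
def nH (u : E3 × ℝ → ℝ) (p : (ℝ × ℝ) × US) : ℝ :=
  dU u (nullPt p) (-(p.2 : E3), 1) - dU u (nullPt p) ((p.2 : E3), 1) +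
    (p.1.2 - p.1.1) * d2U u (nullPt p) ((p.2 : E3), 1) (-(p.2 : E3), 1)
/-- The angular derivatives of `W`. -/
def nL (u : E3 × ℝ → ℝ) (k : Fin 3) (p : (ℝ × ℝ) × US) : ℝ :=
  (p.1.2 - p.1.1) ^ 2 * dU u (nullPt p) (infRot k p.2, 0)
/-- The angular derivatives of `A`. -/
def nN (u : E3 × ℝ → ℝ) (k : Fin 3) (p : (ℝ × ℝ) × US) : ℝ :=
  -2 * (p.1.2 - p.1.1) * dU u (nullPt p) (infRot k p.2, 0) +
    (p.1.2 - p.1.1) ^ 2 * d2U u (nullPt p) (infRot k p.2, 0) (-(p.2 : E3), 1)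
/-- The second angular derivative of `W` in the `k`-th coordinate plane. -/
def nPk (u : E3 × ℝ → ℝ) (k : Fin 3) (p : (ℝ × ℝ) × US) : ℝ :=
  (p.1.2 - p.1.1) ^ 2 * ((p.1.2 - p.1.1) * d2U u (nullPt p) (infRot k p.2, 0) (infRot k p.2, 0) +
    dU u (nullPt p) (infRot k (infRot k p.2), 0))
/-- The spherical Laplacian of `W`. -/
def nP (u : E3 × ℝ → ℝ) (p : (ℝ × ℝ) × US) : ℝ := ∑ k, nPk u k p

section NullCoordinates

variable {u : E3 × ℝ → ℝ} (hu : ContDiffOn ℝ 2 u cone)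
include hu

section Continuity

variable {ρ d : ℝ} (hρ : 0 < ρ)
include hρ

lemma contOn_u : ContinuousOn (fun p => u (nullPt p)) (Tri ρ d ×ˢ univ) :=
  hu.continuousOn.comp continuous_nullPt.continuousOn (mapsTo_nullPt hρ)

lemma contOn_dU {w : (ℝ × ℝ) × US → E3 × ℝ} (hw : Continuous w) :
    ContinuousOn (fun p => dU u (nullPt p) (w p)) (Tri ρ d ×ˢ univ) :=
  ((continuousOn_dU hu).comp continuous_nullPt.continuousOn (mapsTo_nullPt hρ)).clm_apply
    hw.continuousOn

lemma contOn_d2U {w w' : (ℝ × ℝ) × US → E3 × ℝ} (hw : Continuous w) (hw' : Continuous w') :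
    ContinuousOn (fun p => d2U u (nullPt p) (w p) (w' p)) (Tri ρ d ×ˢ univ) :=
  (((continuousOn_d2U hu).comp continuous_nullPt.continuousOn (mapsTo_nullPt hρ)).clm_apply
    hw.continuousOn).clm_apply hw'.continuousOn

lemma contOn_nW : ContinuousOn (nW u) (Tri ρ d ×ˢ univ) :=
  ContinuousOn.mul (by fun_prop) (contOn_u hu hρ)

lemma contOn_nA : ContinuousOn (nA u) (Tri ρ d ×ˢ univ) :=
  (contOn_u hu hρ).neg.add (ContinuousOn.mul (by fun_prop) (contOn_dU hu hρ (by fun_prop)))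

lemma contOn_nB : ContinuousOn (nB u) (Tri ρ d ×ˢ univ) :=
  (contOn_u hu hρ).add (ContinuousOn.mul (by fun_prop) (contOn_dU hu hρ (by fun_prop)))

lemma contOn_nH : ContinuousOn (nH u) (Tri ρ d ×ˢ univ) :=
  ((contOn_dU hu hρ (by fun_prop)).sub (contOn_dU hu hρ (by fun_prop))).add
    (ContinuousOn.mul (by fun_prop) (contOn_d2U hu hρ (by fun_prop) (by fun_prop)))

lemma contOn_nL (k : Fin 3) : ContinuousOn (nL u k) (Tri ρ d ×ˢ univ) :=
  ContinuousOn.mul (by fun_prop) (contOn_dU hu hρ (by fun_prop))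

lemma contOn_nN (k : Fin 3) : ContinuousOn (nN u k) (Tri ρ d ×ˢ univ) :=
  (ContinuousOn.mul (by fun_prop) (contOn_dU hu hρ (by fun_prop))).add
    (ContinuousOn.mul (by fun_prop) (contOn_d2U hu hρ (by fun_prop) (by fun_prop)))

lemma contOn_nPk (k : Fin 3) : ContinuousOn (nPk u k) (Tri ρ d ×ˢ univ) :=
  ContinuousOn.mul (by fun_prop)
    ((ContinuousOn.mul (by fun_prop) (contOn_d2U hu hρ (by fun_prop) (by fun_prop))).add
      (contOn_dU hu hρ (by fun_prop)))

lemma contOn_nP : ContinuousOn (nP u) (Tri ρ d ×ˢ univ) :=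
  continuousOn_finsetSum _ fun k _ => contOn_nPk hu hρ k

end Continuity

section Derivatives

variable {α β : ℝ} (hα : 0 < α) (hαβ : α < β) (ω : US)
include hα hαβ

lemma hasDerivAt_u_fst : HasDerivAt (fun s => u (nullPt ((s, β), ω)))
    (dU u (nullPt ((α, β), ω)) (-(ω : E3), 1)) α :=
  (hasFDerivAt_dU hu (nullPt_mem_ocone (z := (α, β)) hαβ.le hα ω)).comp_hasDerivAt α
    (hasDerivAt_nullPt_fst α β ω)

lemma hasDerivAt_u_snd : HasDerivAt (fun s => u (nullPt ((α, s), ω)))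
    (dU u (nullPt ((α, β), ω)) ((ω : E3), 1)) β :=
  (hasFDerivAt_dU hu (nullPt_mem_ocone (z := (α, β)) hαβ.le hα ω)).comp_hasDerivAt β
    (hasDerivAt_nullPt_snd α β ω)

lemma hasDerivAt_dU_fst (w : E3 × ℝ) : HasDerivAt (fun s => dU u (nullPt ((s, β), ω)) w)
    (d2U u (nullPt ((α, β), ω)) (-(ω : E3), 1) w) α :=
  HasFDerivAt.comp_hasDerivAt (l := fun y => dU u y w)
    (l' := (d2U u (nullPt ((α, β), ω))).flip w) α
    (hasFDerivAt_dU_apply hu (nullPt_mem_ocone (z := (α, β)) hαβ.le hα ω) w)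
    (hasDerivAt_nullPt_fst α β ω)

lemma hasDerivAt_dU_snd (w : E3 × ℝ) : HasDerivAt (fun s => dU u (nullPt ((α, s), ω)) w)
    (d2U u (nullPt ((α, β), ω)) ((ω : E3), 1) w) β :=
  HasFDerivAt.comp_hasDerivAt (l := fun y => dU u y w)
    (l' := (d2U u (nullPt ((α, β), ω))).flip w) β
    (hasFDerivAt_dU_apply hu (nullPt_mem_ocone (z := (α, β)) hαβ.le hα ω) w)
    (hasDerivAt_nullPt_snd α β ω)

lemma hasDerivAt_nW : HasDerivAt (fun s => nW u ((s, β), ω)) (nA u ((α, β), ω)) α := by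
  refine (((hasDerivAt_id α).const_sub β).mul (hasDerivAt_u_fst hu hα hαβ ω)).congr_deriv ?_
  simp [nA]

lemma hasDerivAt_nB : HasDerivAt (fun s => nB u ((s, β), ω)) (nH u ((α, β), ω)) α := by
  refine ((hasDerivAt_u_fst hu hα hαβ ω).add (((hasDerivAt_id α).const_sub β).mul
    (hasDerivAt_dU_fst hu hα hαβ ω ((ω : E3), 1)))).congr_deriv ?_
  rw [d2U_symm hu (nullPt_mem_ocone (z := (α, β)) hαβ.le hα ω)]
  simp [nH]
  ring

lemma hasDerivAt_nA : HasDerivAt (fun s => nA u ((α, s), ω)) (nH u ((α, β), ω)) β := by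
  refine ((hasDerivAt_u_snd hu hα hαβ ω).neg.add (((hasDerivAt_id β).sub_const α).mul
    (hasDerivAt_dU_snd hu hα hαβ ω (-(ω : E3), 1)))).congr_deriv ?_
  simp [nH]
  ring

lemma hasDerivAt_nL (k : Fin 3) :
    HasDerivAt (fun s => nL u k ((s, β), ω)) (nN u k ((α, β), ω)) α := by
  refine ((((hasDerivAt_id α).const_sub β).fun_pow 2).mul
    (hasDerivAt_dU_fst hu hα hαβ ω (infRot k ω, 0))).congr_deriv ?_
  rw [d2U_symm hu (nullPt_mem_ocone (z := (α, β)) hαβ.le hα ω)]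
  simp [nN]

end Derivatives

section Angular

variable {z : ℝ × ℝ} (hz : 0 < z.1) (hz' : z.1 < z.2) (k : Fin 3) (ω : US) (θ : ℝ)
include hz hz'

omit hu hz hz' in
lemma smul_infRot_pair (c : ℝ) (x : E3) : ((c • x, (0:ℝ)) : E3 × ℝ) = c • (x, 0) := by simp

lemma hasDerivAt_u_rot : HasDerivAt (fun s => u (nullPt (z, rotS k s ω)))
    ((z.2 - z.1) * dU u (nullPt (z, rotS k θ ω)) (infRot k (rotS k θ ω), 0)) θ := by
  refine ((hasFDerivAt_dU hu (nullPt_mem_ocone hz'.le hz _)).comp_hasDerivAt θ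
    (hasDerivAt_nullPt_rot z k ω θ)).congr_deriv ?_
  rw [smul_infRot_pair, map_smul, smul_eq_mul]

lemma hasDerivAt_dU_rot {w : ℝ → E3 × ℝ} {w' : E3 × ℝ} (hw : HasDerivAt w w' θ) :
    HasDerivAt (fun s => dU u (nullPt (z, rotS k s ω)) (w s))
    ((z.2 - z.1) * d2U u (nullPt (z, rotS k θ ω)) (infRot k (rotS k θ ω), 0) (w θ) +
      dU u (nullPt (z, rotS k θ ω)) w') θ := by
  have h := (hasFDerivAt_d2U hu (nullPt_mem_ocone hz'.le hz _)).comp_hasDerivAt θ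
    (hasDerivAt_nullPt_rot z k ω θ)
  refine (h.clm_apply hw).congr_deriv ?_
  rw [smul_infRot_pair, map_smul]
  simp

lemma hasDerivAt_nL_rot : HasDerivAt (fun s => nL u k (z, rotS k s ω))
    (nPk u k (z, rotS k θ ω)) θ := by
  have hw : HasDerivAt (fun s => ((infRot k (rotS k s ω), (0:ℝ)) : E3 × ℝ))
      (infRot k (infRot k (rotS k θ ω)), 0) θ :=
    ((infRot k).hasFDerivAt.comp_hasDerivAt θ (hasDerivAt_rotS k ω θ)).prodMk
      (hasDerivAt_const θ _)
  exact (hasDerivAt_dU_rot hu hz hz' k ω θ hw).const_mul ((z.2 - z.1) ^ 2)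

lemma hasDerivAt_nA_rot : HasDerivAt (fun s => nA u (z, rotS k s ω))
    (nN u k (z, rotS k θ ω)) θ := by
  have hw : HasDerivAt (fun s => ((-(rotS k s ω : E3), (1:ℝ)) : E3 × ℝ))
      (-infRot k (rotS k θ ω), 0) θ :=
    (hasDerivAt_rotS k ω θ).neg.prodMk (hasDerivAt_const θ _)
  refine ((hasDerivAt_u_rot hu hz hz' k ω θ).neg.add
    ((hasDerivAt_dU_rot hu hz hz' k ω θ hw).const_mul (z.2 - z.1))).congr_deriv ?_
  have : ((-infRot k (rotS k θ ω), (0:ℝ)) : E3 × ℝ) = -(infRot k (rotS k θ ω), 0) := by simp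
  rw [this, map_neg]
  simp only [nN]
  ring

end Angular

end NullCoordinates

lemma nH_eq {q1 q2 : E3 → ℝ} {u1 u2 : E3 × ℝ → ℝ} (h1 : GoursatSol q1 u1) (h2 : GoursatSol q2 u2)
    {z : ℝ × ℝ} (hz : 0 < z.1) (hz' : z.1 < z.2) (ω : US) :
    nH (u1 - u2) (z, ω) = ((z.2 - z.1) ^ 2)⁻¹ * nP (u1 - u2) (z, ω) +
      (z.2 - z.1) * (q1 (nullPt (z, ω)).1 * u1 (nullPt (z, ω)) -
        q2 (nullPt (z, ω)).1 * u2 (nullPt (z, ω))) := by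
  have hp := nullPt_mem_ocone hz'.le hz ω
  rw [← goursat_pde h1 hp, ← goursat_pde h2 hp]
  have hu : ContDiffOn ℝ 2 (u1 - u2) cone := h1.1.sub h2.1
  have hs := d2U_symm hu hp (ω, 0) (0, 1)
  have hsub := d2U_sub h1.1 h2.1 (ocone_subset hp)
  set p := nullPt (z, ω) with hpdef
  set b := d2U (u1 - u2) p with hb
  have e0 : d2U u1 p (0, 1) (0, 1) - ∑ i, d2U u1 p (basis3 i, 0) (basis3 i, 0) -
      (d2U u2 p (0, 1) (0, 1) - ∑ i, d2U u2 p (basis3 i, 0) (basis3 i, 0)) =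
      b (0, 1) (0, 1) - ∑ i, b (basis3 i, 0) (basis3 i, 0) := by
    rw [hsub]
    simp only [sub_apply, Finset.sum_sub_distrib]
    ring
  have e1 : ((ω : E3), (1:ℝ)) = ((ω : E3), (0:ℝ)) + ((0 : E3), (1:ℝ)) := by simp
  have e2 : (-(ω : E3), (1:ℝ)) = -((ω : E3), (0:ℝ)) + ((0 : E3), (1:ℝ)) := by simp
  have e3 : ∑ k, b (infRot k ω, 0) (infRot k ω, 0) =
      (∑ i, b (basis3 i, 0) (basis3 i, 0)) - b (ω, 0) (ω, 0) := by
    rw [sum_infRot_bilin, norm_eq_of_mem_sphere]; ring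
  have e4 : ∑ k, dU (u1 - u2) p (infRot k (infRot k ω), 0) = -2 * dU (u1 - u2) p (ω, 0) := by
    rw [← map_sum, ← smul_eq_mul, ← map_smul]
    congr 1
    rw [← smul_infRot_pair, ← sum_infRot_sq]
    simp [Prod.ext_iff, Prod.fst_sum, Prod.snd_sum]
  have hr : z.2 - z.1 ≠ 0 := by linarith
  have e5 : ((z.2 - z.1) ^ 2)⁻¹ * nP (u1 - u2) (z, ω) =
      (z.2 - z.1) * ((∑ i, b (basis3 i, 0) (basis3 i, 0)) - b (ω, 0) (ω, 0)) -
        2 * dU (u1 - u2) p (ω, 0) := by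
    simp only [nP, nPk, ← hpdef, ← hb]
    rw [← Finset.mul_sum, ← mul_assoc, inv_mul_cancel₀ (pow_ne_zero 2 hr), one_mul,
      Finset.sum_add_distrib, ← Finset.mul_sum, e3, e4]
    ring
  rw [e5, e0]
  simp only [nH, ← hpdef, ← hb]
  rw [e1, e2]
  simp only [map_add, map_neg, add_apply]
  rw [hs]
  ring

lemma pdr_eq (f : E3 → ℝ) (x : E3) : pdr f x = ‖x‖⁻¹ * fderiv ℝ f x x := by
  conv_rhs => rw [E3_eq_sum x, map_sum, ← E3_eq_sum x]
  simp [pdr, pd]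

lemma ang_eq (k : Fin 3) (f : E3 → ℝ) (x : E3) :
    ang (pfst k) (psnd k) f x = fderiv ℝ f x (infRot k x) := by
  simp [infRot_apply, ang, pd]

lemma angsq_eq (f : E3 → ℝ) (x : E3) : angsq f x = ∑ k, (fderiv ℝ f x (infRot k x)) ^ 2 := by
  simp_rw [← ang_eq]
  simp [angsq, Fin.sum_univ_three, pfst, psnd]

/-- The rotational derivative of `q` at the point `s ω`. -/
def rotDeriv (q : E3 → ℝ) (k : Fin 3) (p : ℝ × US) : ℝ :=
  fderiv ℝ q (p.1 • (p.2 : E3)) (p.1 • infRot k p.2)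

section Radial

variable {q : E3 → ℝ} (hq : ContDiff ℝ 1 q)
include hq

lemma continuous_radial : Continuous fun p : ℝ × US => q (p.1 • (p.2 : E3)) :=
  hq.continuous.comp (by fun_prop)

lemma continuous_rotDeriv (k : Fin 3) : Continuous (rotDeriv q k) :=
  ((hq.continuous_fderiv one_ne_zero).comp
    (by fun_prop : Continuous fun p : ℝ × US => p.1 • (p.2 : E3))).clm_apply (by fun_prop)

lemma hasDerivAt_radial_rot (k : Fin 3) (s : ℝ) (ω : US) (θ : ℝ) :
    HasDerivAt (fun t => q (s • (rotS k t ω : E3))) (rotDeriv q k (s, rotS k θ ω)) θ :=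
  ((hq.differentiable one_ne_zero).differentiableAt.hasFDerivAt).comp_hasDerivAt θ
    ((hasDerivAt_rotS k ω θ).const_smul s)

lemma hasDerivAt_integral_radial_rot (k : Fin 3) (β : ℝ) (ω : US) :
    HasDerivAt (fun t => ∫ s in (0:ℝ)..β, q (s • (rotS k t ω : E3)))
      (∫ s in (0:ℝ)..β, rotDeriv q k (s, ω)) 0 := by
  have hrot' : Continuous fun t : ℝ => rotS k t ω :=
    Continuous.comp (g := fun p : ℝ × US => rotS k p.1 p.2) (f := fun t => (t, ω))
      (continuous_rotS k) (Continuous.prodMk_left ω)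
  have hrot : Continuous fun p : ℝ × ℝ => (p.2, rotS k p.1 ω) :=
    continuous_snd.prodMk (hrot'.comp continuous_fst)
  have hF : Continuous fun p : ℝ × ℝ => q (p.2 • (rotS k p.1 ω : E3)) :=
    (continuous_radial hq).comp hrot
  have hF' : Continuous fun p : ℝ × ℝ => rotDeriv q k (p.2, rotS k p.1 ω) :=
    (continuous_rotDeriv hq k).comp hrot
  obtain ⟨C, hC⟩ := ((isCompact_Icc (a := (-1:ℝ)) (b := 1)).prod
    (isCompact_uIcc (a := (0:ℝ)) (b := β))).exists_bound_of_continuousOn hF'.continuousOn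
  have h := (intervalIntegral.hasDerivAt_integral_of_dominated_loc_of_deriv_le (μ := volume)
    (a := 0) (b := β) (F := fun t s => q (s • (rotS k t ω : E3)))
    (F' := fun t s => rotDeriv q k (s, rotS k t ω)) (bound := fun _ => C) (x₀ := (0:ℝ))
    (Icc_mem_nhds (by norm_num : (-1:ℝ) < 0) one_pos)
    (Filter.Eventually.of_forall fun t =>
      (hF.comp (by fun_prop : Continuous fun s => (t, s))).aestronglyMeasurable)
    ((hF.comp (by fun_prop : Continuous fun s => ((0:ℝ), s))).intervalIntegrable _ _)
    (hF'.comp (by fun_prop : Continuous fun s => ((0:ℝ), s))).aestronglyMeasurable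
    (Filter.Eventually.of_forall fun s hs t ht => hC (t, s) ⟨ht, uIoc_subset_uIcc hs⟩)
    intervalIntegrable_const
    (Filter.Eventually.of_forall fun s _ t _ => hasDerivAt_radial_rot hq k s ω t)).2
  simpa using h

end Radial

lemma pfun_smul (q : E3 → ℝ) {β : ℝ} (hβ : 0 < β) (ω : US) :
    pfun q (β • (ω : E3)) = ∫ s in (0:ℝ)..β, q (s • (ω : E3)) := by
  have : ‖β • (ω : E3)‖ = β := by
    rw [norm_smul, norm_eq_of_mem_sphere, mul_one, Real.norm_of_nonneg hβ.le]
  rw [pfun, this]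
  simp_rw [smul_smul, div_mul_cancel₀ _ hβ.ne']

lemma pfun_eq_norm_mul (q : E3 → ℝ) (x : E3) :
    pfun q x = ‖x‖ * ∫ σ in (0:ℝ)..1, q (σ • x) := by
  rcases eq_or_ne x 0 with rfl | hx
  · simp [pfun]
  · have hx' : ‖x‖ ≠ 0 := norm_ne_zero_iff.2 hx
    have := intervalIntegral.mul_integral_comp_mul_right (a := 0) (b := 1)
      (f := fun σ => q ((σ / ‖x‖) • x)) ‖x‖
    rw [zero_mul, one_mul] at this
    rw [pfun, ← this]
    simp_rw [mul_div_cancel_right₀ _ hx']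

section Characteristic

variable {q : E3 → ℝ} (hq : ContDiff ℝ 1 q) {u : E3 × ℝ → ℝ} (hu : ContDiffOn ℝ 2 u cone)
  (hb : ∀ x : E3, u (x, ‖x‖) = ∫ σ in (0:ℝ)..1, q (σ • x))

include hu hb in
lemma differentiableAt_pfun {x : E3} (hx : x ≠ 0) : DifferentiableAt ℝ (pfun q) x := by
  have h1 : DifferentiableAt ℝ (fun y : E3 => ‖y‖) x :=
    (contDiffAt_norm (n := 1) ℝ hx).differentiableAt one_ne_zero
  have h2 : DifferentiableAt ℝ (fun y : E3 => u (y, ‖y‖)) x :=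
    ((hasFDerivWithinAt_dU hu (p := (x, ‖x‖)) (le_refl ‖x‖)).comp_hasFDerivAt
      (f := fun y => (y, ‖y‖)) x
      ((hasFDerivAt_id x).prodMk h1.hasFDerivAt)
      (Filter.Eventually.of_forall fun y => (le_rfl : ‖y‖ ≤ ‖y‖))).differentiableAt
  have h3 : pfun q = fun y => ‖y‖ * u (y, ‖y‖) := by
    ext y; rw [pfun_eq_norm_mul, hb]
  rw [h3]
  exact h1.mul h2

include hq in
lemma hasDerivAt_pfun_radial {β : ℝ} (hβ : 0 < β) (ω : US) :
    HasDerivAt (fun s => pfun q (s • (ω : E3))) (q (β • (ω : E3))) β := by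
  have hc : Continuous fun s : ℝ => q (s • (ω : E3)) := hq.continuous.comp (by fun_prop)
  refine (intervalIntegral.integral_hasDerivAt_right (hc.intervalIntegrable 0 β)
    (hc.stronglyMeasurableAtFilter _ _) hc.continuousAt).congr_of_eventuallyEq ?_
  filter_upwards [lt_mem_nhds hβ] with s hs using pfun_smul q hs ω

include hq in
lemma hasDerivAt_pfun_rot (k : Fin 3) {β : ℝ} (hβ : 0 < β) (ω : US) :
    HasDerivAt (fun t => pfun q (β • (rotS k t ω : E3)))
      (∫ s in (0:ℝ)..β, rotDeriv q k (s, ω)) 0 := by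
  simp_rw [pfun_smul q hβ]
  exact hasDerivAt_integral_radial_rot hq k β ω

lemma smul_ne_zero_US {β : ℝ} (hβ : 0 < β) (ω : US) : β • (ω : E3) ≠ 0 :=
  smul_ne_zero hβ.ne' (norm_ne_zero_iff.1 (by rw [norm_eq_of_mem_sphere]; exact one_ne_zero))

include hq hu hb in
lemma fderiv_pfun_radial {β : ℝ} (hβ : 0 < β) (ω : US) :
    fderiv ℝ (pfun q) (β • (ω : E3)) ω = q (β • (ω : E3)) := by
  have h := (differentiableAt_pfun hu hb (smul_ne_zero_US hβ ω)).hasFDerivAt.comp_hasDerivAt β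
    ((hasDerivAt_id β).smul_const (ω : E3))
  rw [one_smul] at h
  exact h.unique (hasDerivAt_pfun_radial hq hβ ω)

include hq hu hb in
lemma fderiv_pfun_rot (k : Fin 3) {β : ℝ} (hβ : 0 < β) (ω : US) :
    fderiv ℝ (pfun q) (β • (ω : E3)) (infRot k (β • (ω : E3))) =
      ∫ s in (0:ℝ)..β, rotDeriv q k (s, ω) := by
  have hd : HasFDerivAt (pfun q) (fderiv ℝ (pfun q) (β • (ω : E3))) (β • (rotS k 0 ω : E3)) := by
    rw [rotS_zero]
    exact (differentiableAt_pfun hu hb (smul_ne_zero_US hβ ω)).hasFDerivAt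
  have h := hd.comp_hasDerivAt (0:ℝ) ((hasDerivAt_rotS k ω 0).const_smul β)
  rw [rotS_zero, ← map_smul] at h
  exact h.unique (hasDerivAt_pfun_rot hq k hβ ω)

include hq hu hb in
lemma pdr_pfun {x : E3} (hx : x ≠ 0) : pdr (pfun q) x = q x := by
  have hn : 0 < ‖x‖ := norm_pos_iff.2 hx
  let ω : US := ⟨‖x‖⁻¹ • x, by
    rw [mem_sphere_zero_iff_norm, norm_smul, norm_inv, norm_norm, inv_mul_cancel₀ hn.ne']⟩
  have hω : x = ‖x‖ • (ω : E3) := (smul_inv_smul₀ hn.ne' x).symm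
  have h := fderiv_pfun_radial hq hu hb hn ω
  rw [← hω] at h
  rw [pdr_eq, ← h, ← smul_eq_mul, ← map_smul]

include hq hu hb in
lemma angsq_pdr_pfun {β : ℝ} (hβ : 0 < β) (ω : US) :
    angsq (pdr (pfun q)) (β • (ω : E3)) = ∑ k, rotDeriv q k (β, ω) ^ 2 := by
  have h : pdr (pfun q) =ᶠ[nhds (β • (ω : E3))] q :=
    Filter.eventually_of_mem (isOpen_ne.mem_nhds (smul_ne_zero_US hβ ω)) fun y hy =>
      pdr_pfun hq hu hb hy
  rw [angsq_eq, h.fderiv_eq]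
  simp [rotDeriv]

include hq hu hb in
lemma angsq_pfun {β : ℝ} (hβ : 0 < β) (ω : US) :
    angsq (pfun q) (β • (ω : E3)) = ∑ k, (∫ s in (0:ℝ)..β, rotDeriv q k (s, ω)) ^ 2 := by
  rw [angsq_eq]
  simp_rw [fderiv_pfun_rot hq hu hb _ hβ ω]

include hb in
lemma nW_bottom {β : ℝ} (hβ : 0 < β) (ω : US) : nW u ((0, β), ω) = pfun q (β • (ω : E3)) := by
  have h : ‖β • (ω : E3)‖ = β := by
    rw [norm_smul, norm_eq_of_mem_sphere, mul_one, Real.norm_of_nonneg hβ.le]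
  have h2 := hb (β • (ω : E3))
  rw [h] at h2
  rw [pfun_eq_norm_mul, h, ← h2]
  simp [nW, nullPt]

include hq hu hb in
lemma nB_bottom {β : ℝ} (hβ : 0 < β) (ω : US) : nB u ((0, β), ω) = q (β • (ω : E3)) := by
  have h1 : HasDerivAt (fun s => u (nullPt ((0, s), ω)))
      (dU u (nullPt ((0, β), ω)) ((ω : E3), 1)) β :=
    (hasFDerivWithinAt_dU hu (nullPt_mem_cone (z := (0, β)) hβ.le le_rfl ω)).comp_hasDerivAt
      (f := fun s => nullPt ((0, s), ω)) β
      (hasDerivAt_nullPt_snd 0 β ω) (by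
        filter_upwards [lt_mem_nhds hβ] with s hs using
          nullPt_mem_cone (z := (0, s)) hs.le le_rfl ω)
  have h2 : HasDerivAt (fun s => nW u ((0, s), ω)) (nB u ((0, β), ω)) β := by
    refine (((hasDerivAt_id β).sub_const 0).mul h1).congr_deriv ?_
    simp [nB]
  refine h2.unique ((hasDerivAt_pfun_radial hq hβ ω).congr_of_eventuallyEq ?_)
  filter_upwards [lt_mem_nhds hβ] with s hs using nW_bottom hb hs ω

include hq hu hb in
lemma nL_bottom (k : Fin 3) {β : ℝ} (hβ : 0 < β) (ω : US) :
    nL u k ((0, β), ω) = ∫ s in (0:ℝ)..β, rotDeriv q k (s, ω) := by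
  have h0 : HasFDerivWithinAt u (dU u (nullPt ((0, β), ω))) cone (nullPt ((0, β), rotS k 0 ω)) := by
    rw [rotS_zero]
    exact hasFDerivWithinAt_dU hu (nullPt_mem_cone (z := (0, β)) hβ.le le_rfl ω)
  have h1 := h0.comp_hasDerivAt (f := fun s => nullPt ((0, β), rotS k s ω)) 0
    (hasDerivAt_nullPt_rot (0, β) k ω 0) (Filter.Eventually.of_forall fun s =>
      nullPt_mem_cone (z := (0, β)) hβ.le le_rfl (rotS k s ω))
  rw [rotS_zero, smul_infRot_pair, map_smul, smul_eq_mul] at h1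
  have h2 : HasDerivAt (fun s => nW u ((0, β), rotS k s ω)) (nL u k ((0, β), ω)) 0 := by
    refine (h1.const_mul (β - 0)).congr_deriv ?_
    simp only [nL]
    ring
  simp_rw [nW_bottom hb hβ] at h2
  exact h2.unique (hasDerivAt_pfun_rot hq k hβ ω)

end Characteristic

section Lateral

variable {u : E3 × ℝ → ℝ} (hu : ContDiffOn ℝ 2 u cone) {ρ δ : ℝ} (hρ : 0 < ρ) (hδ : 0 < δ)
  (hv : ∀ p : E3 × ℝ, ‖p.1‖ = ρ → ρ ≤ p.2 → p.2 ≤ ρ + 2 * δ →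
    u p = 0 ∧ pdrX (fun z => ‖z.1‖ * u z) p = 0)

include hρ hv in
lemma lateral_u {α : ℝ} (hα : α ∈ Icc 0 δ) (ω : US) : u (nullPt ((α, ρ + α), ω)) = 0 := by
  refine (hv _ ?_ ?_ ?_).1
  · rw [norm_nullPt (z := (α, ρ + α)) (by simp [hρ.le])]; simp
  · simp only [nullPt]; linarith [hα.1]
  · simp only [nullPt]; linarith [hα.2]

include hu hρ hv

lemma lateral_dU_radial {α : ℝ} (hα : α ∈ Ioo 0 δ) (ω : US) :
    dU u (nullPt ((α, ρ + α), ω)) ((ω : E3), 0) = 0 := by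
  have hp : nullPt ((α, ρ + α), ω) ∈ ocone :=
    nullPt_mem_ocone (z := (α, ρ + α)) (by simp [hρ.le]) hα.1 ω
  have hu0 := lateral_u hρ hv (Ioo_subset_Icc_self hα) ω
  have hn : ‖(nullPt ((α, ρ + α), ω)).1‖ = ρ := by
    rw [norm_nullPt (z := (α, ρ + α)) (by simp [hρ.le])]; simp
  have h := (hv (nullPt ((α, ρ + α), ω)) hn (by simp only [nullPt]; linarith [hα.1])
    (by simp only [nullPt]; linarith [hα.2])).2
  have h1 : (nullPt ((α, ρ + α), ω)).1 = ρ • (ω : E3) := by simp [nullPt]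
  set p := nullPt ((α, ρ + α), ω) with hpdef
  have hx : p.1 ≠ 0 := norm_pos_iff.1 (hn ▸ hρ)
  have h2 := ((contDiffAt_norm (n := 1) ℝ hx).differentiableAt one_ne_zero).hasFDerivAt.mul
    (hasFDerivAt_fixT hu hp)
  have h3 : fixT u p.2 p.1 = 0 := hu0
  rw [h3, zero_smul, add_zero, hn] at h2
  rw [pdrX, pdr_eq, hn,
    HasFDerivAt.fderiv (f := fixT (fun z => ‖z.1‖ * u z) p.2) h2, h1] at h
  simpa [hρ.ne', smul_infRot_pair] using h

lemma lateral_dU_time {α : ℝ} (hα : α ∈ Ioo 0 δ) (ω : US) :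
    dU u (nullPt ((α, ρ + α), ω)) ((0 : E3), 1) = 0 := by
  have hp : nullPt ((α, ρ + α), ω) ∈ ocone :=
    nullPt_mem_ocone (z := (α, ρ + α)) (by simp [hρ.le]) hα.1 ω
  have h1 : HasDerivAt (fun s : ℝ => ((ρ • (ω : E3), s) : E3 × ℝ)) ((0 : E3), 1) (ρ + 2 * α) :=
    (hasDerivAt_const _ _).prodMk (hasDerivAt_id _)
  have e : nullPt ((α, ρ + α), ω) = (ρ • (ω : E3), ρ + 2 * α) := by
    simp only [nullPt, add_sub_cancel_right]
    congr 1
    ring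
  rw [e] at hp ⊢
  have h2 := (hasFDerivAt_dU hu hp).comp_hasDerivAt (f := fun s : ℝ => (ρ • (ω : E3), s)) _ h1
  refine h2.unique ((hasDerivAt_const _ (0:ℝ)).congr_of_eventuallyEq ?_)
  have hI : Ioo ρ (ρ + 2 * δ) ∈ nhds (ρ + 2 * α) :=
    isOpen_Ioo.mem_nhds ⟨by linarith [hα.1], by linarith [hα.2]⟩
  filter_upwards [hI] with s hs
  refine (hv _ ?_ hs.1.le hs.2.le).1
  rw [norm_smul, norm_eq_of_mem_sphere, mul_one, Real.norm_of_nonneg hρ.le]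

lemma lateral_dU_rot (k : Fin 3) {α : ℝ} (hα : α ∈ Ioo 0 δ) (ω : US) :
    dU u (nullPt ((α, ρ + α), ω)) (infRot k ω, 0) = 0 := by
  have h := hasDerivAt_u_rot hu (z := (α, ρ + α)) hα.1 (by simp [hρ]) k ω 0
  have h0 : (fun s => u (nullPt ((α, ρ + α), rotS k s ω))) = fun _ => 0 := by
    ext s; exact lateral_u hρ hv (Ioo_subset_Icc_self hα) _
  rw [h0] at h
  have := h.unique (hasDerivAt_const 0 (0:ℝ))
  simpa [hρ.ne'] using this

omit hu hρ hv in
include hδ in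
lemma lateral_extend {g : (ℝ × ℝ) × US → ℝ} (hg : ContinuousOn g (Tri ρ δ ×ˢ univ)) (ω : US)
    (h : ∀ α ∈ Ioo 0 δ, g ((α, ρ + α), ω) = 0) : ∀ α ∈ Icc 0 δ, g ((α, ρ + α), ω) = 0 := by
  have hc : ContinuousOn (fun α => g ((α, ρ + α), ω)) (Icc 0 δ) := by
    refine hg.comp (by fun_prop) fun α hα => ⟨⟨hα.1, le_rfl, ?_⟩, mem_univ _⟩
    simpa using hα.2
  have : EqOn (fun α => g ((α, ρ + α), ω)) (fun _ => 0) (Icc 0 δ) :=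
    EqOn.of_subset_closure (s := Ioo 0 δ) h hc continuousOn_const Ioo_subset_Icc_self
      (closure_Ioo hδ.ne).ge
  exact this

include hδ

lemma lateral_nA (ω : US) : ∀ α ∈ Icc 0 δ, nA u ((α, ρ + α), ω) = 0 := by
  refine lateral_extend hδ (contOn_nA hu hρ) ω fun α hα => ?_
  have e : (-(ω : E3), (1:ℝ)) = -((ω : E3), (0:ℝ)) + ((0 : E3), (1:ℝ)) := by simp
  simp only [nA]
  rw [lateral_u hρ hv (Ioo_subset_Icc_self hα), e, map_add, map_neg,
    lateral_dU_radial hu hρ hv hα, lateral_dU_time hu hρ hv hα]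
  simp

lemma lateral_nB (ω : US) : ∀ α ∈ Icc 0 δ, nB u ((α, ρ + α), ω) = 0 := by
  refine lateral_extend hδ (contOn_nB hu hρ) ω fun α hα => ?_
  have e : ((ω : E3), (1:ℝ)) = ((ω : E3), (0:ℝ)) + ((0 : E3), (1:ℝ)) := by simp
  simp only [nB]
  rw [lateral_u hρ hv (Ioo_subset_Icc_self hα), e, map_add,
    lateral_dU_radial hu hρ hv hα, lateral_dU_time hu hρ hv hα]
  simp

lemma lateral_nL (k : Fin 3) (ω : US) : ∀ α ∈ Icc 0 δ, nL u k ((α, ρ + α), ω) = 0 := by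
  refine lateral_extend hδ (contOn_nL hu hρ k) ω fun α hα => ?_
  simp only [nL]
  rw [lateral_dU_rot hu hρ hv k hα, mul_zero]

end Lateral

section Control

variable {q : E3 → ℝ} (hq : ContDiff ℝ 1 q) {u : E3 × ℝ → ℝ} (hu : ContDiffOn ℝ 2 u cone)
  (hb : ∀ x : E3, u (x, ‖x‖) = ∫ σ in (0:ℝ)..1, q (σ • x))

lemma sphInt_nonneg {r : ℝ} {g : E3 → ℝ} (hg : ∀ x, 0 ≤ g x) : 0 ≤ sphInt r g :=
  integral_nonneg hg

lemma angsq_nonneg (g : E3 → ℝ) (x : E3) : 0 ≤ angsq g x := by rw [angsq_eq]; positivity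

lemma H1sq_nonneg (g : E3 → ℝ) (r : ℝ) : 0 ≤ H1sq g r :=
  sphInt_nonneg fun x => by have := angsq_nonneg g x; positivity

lemma L2sq_nonneg (g : E3 → ℝ) (r : ℝ) : 0 ≤ L2sq g r := sphInt_nonneg fun x => by positivity

lemma H1sq_pdr_le {R T γ r : ℝ} (h : memQ R T γ q) (hr : r ∈ Icc R ((R + T) / 2)) :
    H1sq (pdr (pfun q)) r ≤ 2 * γ ^ 2 * (H1sq (pfun q) r + L2sq (pdr (pfun q)) r) := by
  have h1 := h r hr
  have a := Real.sq_sqrt (H1sq_nonneg (pdr (pfun q)) r)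
  have b := Real.sq_sqrt (H1sq_nonneg (pfun q) r)
  have c := Real.sq_sqrt (L2sq_nonneg (pdr (pfun q)) r)
  have h2 : √(H1sq (pdr (pfun q)) r) ≤ γ * (√(H1sq (pfun q) r) + √(L2sq (pdr (pfun q)) r)) :=
    le_trans (le_add_of_nonneg_left (Real.sqrt_nonneg _)) h1
  have h3 := pow_le_pow_left₀ (Real.sqrt_nonneg _) h2 2
  rw [a, mul_pow] at h3
  have h4 : (√(H1sq (pfun q) r) + √(L2sq (pdr (pfun q)) r)) ^ 2 ≤
      2 * (H1sq (pfun q) r + L2sq (pdr (pfun q)) r) := by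
    rw [← b, ← c]
    simp only [Real.sqrt_sq (Real.sqrt_nonneg _)]
    nlinarith [sq_nonneg (√(H1sq (pfun q) r) - √(L2sq (pdr (pfun q)) r))]
  calc _ ≤ _ := h3
    _ ≤ γ ^ 2 * (2 * (H1sq (pfun q) r + L2sq (pdr (pfun q)) r)) := by gcongr
    _ = _ := by ring

include hq hu hb in
lemma rotDeriv_control {R T γ β : ℝ} (hR : 0 < R) (h : memQ R T γ q)
    (hβ : β ∈ Icc R ((R + T) / 2)) :
    ∫ ω, ∑ k, rotDeriv q k (β, ω) ^ 2 ∂surf ≤ 2 * γ ^ 2 * (1 + ((R + T) / 2) ^ 2) *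
      ((∫ ω : US, (∫ s in (0:ℝ)..β, q (s • (ω : E3))) ^ 2 ∂surf) +
        (∫ ω, ∑ k, (∫ s in (0:ℝ)..β, rotDeriv q k (s, ω)) ^ 2 ∂surf) +
        ∫ ω : US, q (β • (ω : E3)) ^ 2 ∂surf) := by
  have hβ0 : 0 < β := hR.trans_le hβ.1
  have cq : Continuous fun ω : US => q (β • (ω : E3)) ^ 2 :=
    (hq.continuous.comp (by fun_prop)).pow 2
  have cG : Continuous fun ω : US => ∑ k, rotDeriv q k (β, ω) ^ 2 :=
    continuous_finsetSum _ fun k _ =>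
      ((continuous_rotDeriv hq k).comp (Continuous.prodMk_right β)).pow 2
  have cp : Continuous fun ω : US => (∫ s in (0:ℝ)..β, q (s • (ω : E3))) ^ 2 :=
    (intervalIntegral.continuous_parametric_intervalIntegral_of_continuous'
      (f := fun (ω : US) s => q (s • (ω : E3)))
      (hq.continuous.comp (by fun_prop)) 0 β).pow 2
  have cI : Continuous fun ω : US => ∑ k, (∫ s in (0:ℝ)..β, rotDeriv q k (s, ω)) ^ 2 :=
    continuous_finsetSum _ fun k _ =>
      (intervalIntegral.continuous_parametric_intervalIntegral_of_continuous'
        (f := fun (ω : US) s => rotDeriv q k (s, ω))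
        ((continuous_rotDeriv hq k).comp continuous_swap) 0 β).pow 2
  have iq := integrable_of_continuous_compact (μ := surf) cq
  have iG := integrable_of_continuous_compact (μ := surf) cG
  have ip := integrable_of_continuous_compact (μ := surf) cp
  have iI := integrable_of_continuous_compact (μ := surf) cI
  have hpq : ∀ ω : US, pdr (pfun q) (β • (ω : E3)) = q (β • (ω : E3)) := fun ω =>
    pdr_pfun hq hu hb (smul_ne_zero_US hβ0 ω)
  have key := H1sq_pdr_le h hβ
  have hβ2 : ∀ a b : ℝ, β ^ 2 * (a + (β ^ 2)⁻¹ * b) = β ^ 2 * a + b := fun a b => by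
    rw [mul_add, mul_inv_cancel_left₀ (pow_ne_zero 2 hβ0.ne')]
  simp only [H1sq, L2sq] at key
  rw [sphInt_eq hβ0, sphInt_eq hβ0, sphInt_eq hβ0] at key
  simp_rw [angsq_pdr_pfun hq hu hb hβ0, angsq_pfun hq hu hb hβ0, hpq, pfun_smul q hβ0] at key
  rw [integral_add iq (iG.const_mul _), integral_add ip (iI.const_mul _),
    integral_const_mul, integral_const_mul, hβ2, hβ2] at key
  have nq : 0 ≤ ∫ ω : US, q (β • (ω : E3)) ^ 2 ∂surf := integral_nonneg fun _ => by positivity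
  have np : 0 ≤ ∫ ω : US, (∫ s in (0:ℝ)..β, q (s • (ω : E3))) ^ 2 ∂surf :=
    integral_nonneg fun _ => by positivity
  have nI : 0 ≤ ∫ ω : US, ∑ k, (∫ s in (0:ℝ)..β, rotDeriv q k (s, ω)) ^ 2 ∂surf :=
    integral_nonneg fun _ => by positivity
  have hβT : β ^ 2 ≤ 1 + ((R + T) / 2) ^ 2 :=
    (pow_le_pow_left₀ hβ0.le hβ.2 2).trans (by linarith)
  have h1T : 1 ≤ 1 + ((R + T) / 2) ^ 2 := by nlinarith [sq_nonneg ((R + T) / 2)]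
  set X := ∫ ω : US, q (β • (ω : E3)) ^ 2 ∂surf
  set Y := ∫ ω : US, (∫ s in (0:ℝ)..β, q (s • (ω : E3))) ^ 2 ∂surf
  set Z := ∫ ω : US, ∑ k, (∫ s in (0:ℝ)..β, rotDeriv q k (s, ω)) ^ 2 ∂surf
  calc _ ≤ 2 * γ ^ 2 * (β ^ 2 * Y + Z + β ^ 2 * X) := by
        have : 0 ≤ β ^ 2 * X := by positivity
        linarith
    _ ≤ 2 * γ ^ 2 * ((1 + ((R + T) / 2) ^ 2) * Y + (1 + ((R + T) / 2) ^ 2) * Z +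
          (1 + ((R + T) / 2) ^ 2) * X) := by
        gcongr
        exact le_mul_of_one_le_left nI h1T
    _ = _ := by ring

end Control

lemma integral_nP_mul {u : E3 × ℝ → ℝ} (hu : ContDiffOn ℝ 2 u cone) {z : ℝ × ℝ} (hz : 0 < z.1)
    (hz' : z.1 < z.2) {f : US → ℝ} {f' : Fin 3 → US → ℝ} (hf : Continuous f)
    (hf' : ∀ k, Continuous (f' k))
    (h : ∀ k ω θ, HasDerivAt (fun t => f (rotS k t ω)) (f' k (rotS k θ ω)) θ) :
    ∫ ω, nP u (z, ω) * f ω ∂surf = -∫ ω, ∑ k, nL u k (z, ω) * f' k ω ∂surf := by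
  have hzT : z ∈ Tri (z.2 - z.1) z.1 := ⟨hz.le, by simp, by simp⟩
  have hρ : 0 < z.2 - z.1 := sub_pos.2 hz'
  have cL : ∀ k, Continuous fun ω => nL u k (z, ω) := fun k =>
    continuous_slice (contOn_nL hu hρ k) hzT
  have cP : ∀ k, Continuous fun ω => nPk u k (z, ω) := fun k =>
    continuous_slice (contOn_nPk hu hρ k) hzT
  have iP : ∀ k, Integrable (fun ω => nPk u k (z, ω) * f ω) surf := fun k =>
    integrable_of_continuous_compact ((cP k).mul hf)
  have iL : ∀ k, Integrable (fun ω => nL u k (z, ω) * f' k ω) surf := fun k =>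
    integrable_of_continuous_compact ((cL k).mul (hf' k))
  have h0 : ∀ k, ∫ ω, nPk u k (z, ω) * f ω ∂surf = -∫ ω, nL u k (z, ω) * f' k ω ∂surf := by
    intro k
    have := integral_angular_deriv_eq_zero k (g := fun ω => nL u k (z, ω) * f ω)
      (g' := fun ω => nPk u k (z, ω) * f ω + nL u k (z, ω) * f' k ω)
      ((cL k).mul hf) (((cP k).mul hf).add ((cL k).mul (hf' k)))
      fun ω θ => (hasDerivAt_nL_rot hu hz hz' k ω θ).mul (h k ω θ)
    rw [integral_add (iP k) (iL k)] at this
    linarith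
  simp only [nP, Finset.sum_mul]
  rw [integral_finsetSum _ fun k _ => iP k, integral_finsetSum _ fun k _ => iL k,
    ← Finset.sum_neg_distrib]
  exact Finset.sum_congr rfl fun k _ => h0 k

/-- Two Goursat solutions with the same lateral Cauchy data give triangle data. -/
def goursatTriangleData {R T γ M ρ δ d : ℝ} (hR : 0 < R) (hρR : R ≤ ρ) (hd : 0 < d) (hdδ : d ≤ δ)
    (hdT : ρ + d ≤ (R + T) / 2) {q1 q2 : E3 → ℝ} (hq1 : ContDiff ℝ 1 q1) (hq2 : ContDiff ℝ 1 q2)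
    (hmem : memQ R T γ (q1 - q2)) {u1 u2 : E3 × ℝ → ℝ} (h1 : GoursatSol q1 u1)
    (h2 : GoursatSol q2 u2) (hM1 : ∀ x ∈ Ann R ((R + T) / 2), |q1 x| ≤ M)
    (hM2 : ∀ p ∈ Kreg R T ((R + T) / 2), |‖p.1‖ * u2 p| ≤ M)
    (hu : ContDiffOn ℝ 2 (u1 - u2) cone)
    (hb : ∀ x : E3, (u1 - u2) (x, ‖x‖) = ∫ σ in (0:ℝ)..1, (q1 - q2) (σ • x))
    (hv : ∀ p : E3 × ℝ, ‖p.1‖ = ρ → ρ ≤ p.2 → p.2 ≤ ρ + 2 * δ →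
      (u1 - u2) p = 0 ∧ pdrX (fun z => ‖z.1‖ * (u1 - u2) z) p = 0) :
    TriangleData surf ρ d M (2 * γ ^ 2 * (1 + ((R + T) / 2) ^ 2)) := by
  have hρ : 0 < ρ := hR.trans_le hρR
  have hδ : 0 < δ := hd.trans_le hdδ
  have hq : ContDiff ℝ 1 (q1 - q2) := hq1.sub hq2
  have hsub : Icc 0 d ⊆ Icc 0 δ := Icc_subset_Icc_right hdδ
  have hp0 : ∀ ω : US, ∫ s in (0:ℝ)..ρ, (q1 - q2) (s • (ω : E3)) = 0 := fun ω => by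
    rw [← pfun_smul _ hρ, ← nW_bottom hb hρ, nW]
    have := lateral_u hρ hv (left_mem_Icc.2 hδ.le) ω
    rw [add_zero] at this
    rw [this, mul_zero]
  have hG0 : ∀ k ω, ∫ s in (0:ℝ)..ρ, rotDeriv (q1 - q2) k (s, ω) = 0 := fun k ω => by
    rw [← nL_bottom hq hu hb k hρ]
    have := lateral_nL hu hρ hδ hv k ω 0 (left_mem_Icc.2 hδ.le)
    rwa [add_zero] at this
  have cq : ∀ ω : US, Continuous fun s : ℝ => (q1 - q2) (s • (ω : E3)) := fun ω =>
    hq.continuous.comp (by fun_prop)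
  have cG : ∀ k, ∀ ω : US, Continuous fun s : ℝ => rotDeriv (q1 - q2) k (s, ω) := fun k ω =>
    (continuous_rotDeriv hq k).comp (Continuous.prodMk_left ω)
  have hpρ : ∀ β, ∀ ω : US, ∫ s in (0:ℝ)..β, (q1 - q2) (s • (ω : E3)) =
      ∫ s in ρ..β, (q1 - q2) (s • (ω : E3)) := fun β ω => by
    rw [← intervalIntegral.integral_add_adjacent_intervals ((cq ω).intervalIntegrable 0 ρ)
      ((cq ω).intervalIntegrable ρ β), hp0, zero_add]
  have hGρ : ∀ k, ∀ β, ∀ ω : US, ∫ s in (0:ℝ)..β, rotDeriv (q1 - q2) k (s, ω) =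
      ∫ s in ρ..β, rotDeriv (q1 - q2) k (s, ω) := fun k β ω => by
    rw [← intervalIntegral.integral_add_adjacent_intervals ((cG k ω).intervalIntegrable 0 ρ)
      ((cG k ω).intervalIntegrable ρ β), hG0, zero_add]
  have hlt : ∀ {z : ℝ × ℝ}, z ∈ Tri ρ d → z.1 < z.2 := fun hz => by linarith [hz.2.1]
  exact
  { W := nW (u1 - u2)
    A := nA (u1 - u2)
    B := nB (u1 - u2)
    H := nH (u1 - u2)
    P := nP (u1 - u2)
    F := fun p => (p.1.2 - p.1.1) * (q1 (nullPt p).1 * u1 (nullPt p) -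
      q2 (nullPt p).1 * u2 (nullPt p))
    L := nL (u1 - u2)
    N := nN (u1 - u2)
    q := fun p => (q1 - q2) (p.1 • (p.2 : E3))
    G := rotDeriv (q1 - q2)
    contW := contOn_nW hu hρ
    contA := contOn_nA hu hρ
    contB := contOn_nB hu hρ
    contH := contOn_nH hu hρ
    contP := contOn_nP hu hρ
    contF := by
      have c1 : Continuous fun p => q1 (nullPt p).1 :=
        hq1.continuous.comp (continuous_fst.comp continuous_nullPt)
      have c2 : Continuous fun p => q2 (nullPt p).1 :=
        hq2.continuous.comp (continuous_fst.comp continuous_nullPt)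
      exact ContinuousOn.mul (by fun_prop) ((c1.continuousOn.mul (contOn_u h1.1 hρ)).sub
        (c2.continuousOn.mul (contOn_u h2.1 hρ)))
    contL := contOn_nL hu hρ
    contN := contOn_nN hu hρ
    contq := (continuous_radial hq).continuousOn
    contG := fun k => (continuous_rotDeriv hq k).continuousOn
    derivW := fun α β ω hα hβ _ => hasDerivAt_nW hu hα (by linarith) ω
    derivB := fun α β ω hα hβ _ => hasDerivAt_nB hu hα (by linarith) ω
    derivL := fun k α β ω hα hβ _ => hasDerivAt_nL hu hα (by linarith) ω k
    derivA := fun α β ω hα hβ _ => hasDerivAt_nA hu hα (by linarith) ω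
    zeroW := fun α hα ω => by rw [nW, lateral_u hρ hv (hsub hα), mul_zero]
    zeroA := fun α hα ω => lateral_nA hu hρ hδ hv ω α (hsub hα)
    zeroB := fun α hα ω => lateral_nB hu hρ hδ hv ω α (hsub hα)
    zeroL := fun k α hα ω => lateral_nL hu hρ hδ hv k ω α (hsub hα)
    bottomB := fun β hβ ω => nB_bottom hq hu hb (hρ.trans_le hβ.1) ω
    bottomL := fun k β hβ ω => by rw [nL_bottom hq hu hb k (hρ.trans_le hβ.1), hGρ]
    pde := fun z hz hz0 ω => nH_eq h1 h2 hz0 (hlt hz) ω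
    source := fun z hz ω => by
      have hn := norm_nullPt (hlt hz).le ω
      have hz1 := hz.1
      have hz2 := hz.2.1
      have hz3 := hz.2.2
      have b1 := hM1 (nullPt (z, ω)).1 ⟨by rw [hn]; linarith, by rw [hn]; linarith⟩
      have b2 := hM2 (nullPt (z, ω)) ⟨by rw [hn]; linarith, by rw [hn]; linarith,
        by rw [hn]; simp only [nullPt]; linarith, by rw [hn]; simp only [nullPt]; linarith⟩
      rw [hn] at b2
      have b1' := sq_le_sq' (abs_le.1 b1).1 (abs_le.1 b1).2
      have b2' := sq_le_sq' (abs_le.1 b2).1 (abs_le.1 b2).2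
      have e : (z.2 - z.1) * (q1 (nullPt (z, ω)).1 * u1 (nullPt (z, ω)) -
          q2 (nullPt (z, ω)).1 * u2 (nullPt (z, ω))) =
          q1 (nullPt (z, ω)).1 * nW (u1 - u2) (z, ω) +
          (q1 - q2) (nullPt (z, ω)).1 * ((z.2 - z.1) * u2 (nullPt (z, ω))) := by
        simp only [nW, Pi.sub_apply]; ring
      change ((z.2 - z.1) * (q1 (nullPt (z, ω)).1 * u1 (nullPt (z, ω)) -
          q2 (nullPt (z, ω)).1 * u2 (nullPt (z, ω)))) ^ 2 ≤ 2 * M ^ 2 * nW (u1 - u2) (z, ω) ^ 2 +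
          2 * M ^ 2 * (q1 - q2) (nullPt (z, ω)).1 ^ 2
      rw [e]
      set a := q1 (nullPt (z, ω)).1
      set w := nW (u1 - u2) (z, ω)
      set b := (q1 - q2) (nullPt (z, ω)).1
      set c := (z.2 - z.1) * u2 (nullPt (z, ω))
      calc (a * w + b * c) ^ 2 ≤ 2 * a ^ 2 * w ^ 2 + 2 * c ^ 2 * b ^ 2 := by
            nlinarith [sq_nonneg (a * w - b * c)]
        _ ≤ _ := by gcongr
    partsA := fun z hz hz0 => integral_nP_mul hu hz0 (hlt hz)
      (continuous_slice (contOn_nA hu hρ) hz) (fun k => continuous_slice (contOn_nN hu hρ k) hz)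
      fun k ω θ => hasDerivAt_nA_rot hu hz0 (hlt hz) k ω θ
    partsq := fun z hz hz0 => integral_nP_mul hu hz0 (hlt hz)
      ((continuous_radial hq).comp (Continuous.prodMk_right z.2))
      (fun k => (continuous_rotDeriv hq k).comp (Continuous.prodMk_right z.2))
      fun k ω θ => hasDerivAt_radial_rot hq k z.2 ω θ
    control := fun β hβ => by
      have := rotDeriv_control hq hu hb hR hmem (β := β) ⟨hρR.trans hβ.1, hβ.2.trans hdT⟩
      simp_rw [hpρ, hGρ] at this
      exact this }

lemma eq_zero_of_integral_sq_eq_zero {f : US → ℝ} (hf : Continuous f)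
    (h : ∫ ω, f ω ^ 2 ∂surf = 0) (ω : US) : f ω = 0 := by
  have h1 := (integral_eq_zero_iff_of_nonneg (f := fun ω => f ω ^ 2) (fun _ => sq_nonneg _)
    (integrable_of_continuous_compact (hf.pow 2))).1 h
  have h2 := ((hf.pow 2).ae_eq_iff_eq surf continuous_const (g := fun _ => (0:ℝ))).1 h1
  exact pow_eq_zero_iff two_ne_zero |>.1 (congrFun h2 ω)

/-- **the local step in the proof of Theorem 1.2.** There is a `δ > 0`,
depending only on `γ, R, T, M`, so that if `v` and `∂_r v` vanish on the cylinder
`|x| = R*, R* ≤ t ≤ R* + 2δ` for some `R* ∈ [R, (R+T)/2]`, then `q₁ = q₂` on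
`R* ≤ |x| ≤ min(R* + δ, (R+T)/2)`. -/
theorem stmt17 (R T γ M : ℝ) (hR : 0 < R) (hRT : R < T) (hγ : 0 < γ) (hM : 0 < M) :
    ∃ δ > (0:ℝ), ∀ q1 q2 : E3 → ℝ, ContDiff ℝ 8 q1 → ContDiff ℝ 8 q2 →
      memQ R T γ (q1 - q2) →
      ∀ u1 u2 : E3 × ℝ → ℝ, GoursatSol q1 u1 → GoursatSol q2 u2 →
      ∀ v v2 : E3 × ℝ → ℝ,
        (∀ z : E3 × ℝ, v z = ‖z.1‖ * (u1 z - u2 z)) →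
        (∀ z : E3 × ℝ, v2 z = ‖z.1‖ * u2 z) →
        (∀ x ∈ Ann R ((R + T) / 2), |q1 x| ≤ M ∧ ∀ k : Fin 3, |pd k q1 x| ≤ M) →
        (∀ p ∈ Kreg R T ((R + T) / 2),
          |v2 p| ≤ M ∧ |pdt v2 p| ≤ M ∧ ∀ k : Fin 3, |pdx k v2 p| ≤ M) →
        ∀ Rs : ℝ, R ≤ Rs → Rs ≤ (R + T) / 2 →
          (∀ p : E3 × ℝ, ‖p.1‖ = Rs → Rs ≤ p.2 → p.2 ≤ Rs + 2 * δ →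
            v p = 0 ∧ pdrX v p = 0) →
          ∀ x : E3, Rs ≤ ‖x‖ → ‖x‖ ≤ min (Rs + δ) ((R + T) / 2) → q1 x = q2 x := by
  obtain ⟨δ, hδ, huniq⟩ := exists_triangle_uniqueness (S := US) (μ := surf) (R := R) (M := M)
    (C := 2 * γ ^ 2 * (1 + ((R + T) / 2) ^ 2)) hR (by positivity)
  refine ⟨δ, hδ, fun q1 q2 hq1 hq2 hmem u1 u2 h1 h2 v v2 hvdef hv2def hM1 hM2 Rs hRRs _ hcyl x
    hx hx' => ?_⟩
  have hRs : 0 < Rs := hR.trans_le hRRs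
  have hq1' : ContDiff ℝ 1 q1 := hq1.of_le (by norm_num)
  have hq2' : ContDiff ℝ 1 q2 := hq2.of_le (by norm_num)
  have hq : ContDiff ℝ 1 (q1 - q2) := hq1'.sub hq2'
  have hu : ContDiffOn ℝ 2 (u1 - u2) cone := h1.1.sub h2.1
  have hb : ∀ y : E3, (u1 - u2) (y, ‖y‖) = ∫ σ in (0:ℝ)..1, (q1 - q2) (σ • y) := by
    intro y
    simp only [Pi.sub_apply]
    have c : ∀ {f : E3 → ℝ}, ContDiff ℝ 1 f →
        IntervalIntegrable (fun σ : ℝ => f (σ • y)) volume 0 1 := fun hf =>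
      (hf.continuous.comp (by fun_prop : Continuous fun σ : ℝ => σ • y)).intervalIntegrable _ _
    rw [intervalIntegral.integral_sub (c hq1') (c hq2'), h1.2.2, h2.2.2]
  have hv : ∀ p : E3 × ℝ, ‖p.1‖ = Rs → Rs ≤ p.2 → p.2 ≤ Rs + 2 * δ →
      (u1 - u2) p = 0 ∧ pdrX (fun z => ‖z.1‖ * (u1 - u2) z) p = 0 := by
    intro p hp ha hb
    obtain ⟨e1, e2⟩ := hcyl p hp ha hb
    rw [hvdef, hp] at e1
    refine ⟨(mul_eq_zero.1 e1).resolve_left hRs.ne', ?_⟩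
    rw [← e2]
    congr 1
    ext z
    rw [hvdef, Pi.sub_apply]
  have hx0 : 0 < ‖x‖ := hRs.trans_le hx
  let ω : US := ⟨‖x‖⁻¹ • x, by
    rw [mem_sphere_zero_iff_norm, norm_smul, norm_inv, norm_norm, inv_mul_cancel₀ hx0.ne']⟩
  have hω : ‖x‖ • (ω : E3) = x := smul_inv_smul₀ hx0.ne' x
  suffices h : (q1 - q2) (‖x‖ • (ω : E3)) = 0 by
    rw [hω] at h
    exact sub_eq_zero.1 h
  rcases hx.eq_or_lt with hxe | hxl
  · rw [← hxe, ← nB_bottom hq hu hb hRs]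
    simpa using lateral_nB hu hRs hδ hv ω 0 (left_mem_Icc.2 hδ.le)
  · have hδ' := hx'.trans (min_le_left _ _)
    have hT := hx'.trans (min_le_right _ _)
    have h0 := huniq Rs (‖x‖ - Rs) hRRs (by linarith) (by linarith)
      (goursatTriangleData hR hRRs (by linarith) (by linarith) (by linarith) hq1' hq2' hmem h1 h2
        (fun y hy => (hM1 y hy).1) (fun p hp => by rw [← hv2def]; exact (hM2 p hp).1) hu hb hv)
      ‖x‖ ⟨hx, by linarith⟩
    exact eq_zero_of_integral_sq_eq_zero
      ((continuous_radial hq).comp (Continuous.prodMk_right ‖x‖)) h0 ω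
end
end

section
/- Let R > 0 and M > 0, let q be a continuous function on the ball B = {x ∈ ℝ³ : |x| ≤ R} with |q(x)| ≤ M for all x ∈ B, let D⁻ = {(x,t) ∈ ℝ³×ℝ : |x| ≤ t ≤ R}, and let u be a C² function on an open neighborhood of D⁻ and f a continuous function with ∂_t²u − Δu − q·u = f at every point of D⁻. Then there is a constant C > 0 depending only on M and R such that ∫_B ( ū(x)² + |∇ū(x)|² ) dx ≤ C ( ∫∫_{D⁻} f² dx dt + ∫_B ( u² + |∇u|² + (∂_t u)² )(x,R) dx ), where ū(x) = u(x,|x|) and ∇ denotes the spatial gradient (applied to the function ū in the first integral). -/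
noncomputable section

open Real MeasureTheory Metric Set

/-- The gradient of the norm away from the origin. -/
lemma hasFDerivAt_norm_of_ne_zero {E : Type*} [NormedAddCommGroup E] [InnerProductSpace ℝ E]
    {x : E} (hx : x ≠ 0) :
    HasFDerivAt (fun y : E => ‖y‖) (‖x‖⁻¹ • innerSL ℝ x) x := by
  have hpos : 0 < ‖x‖ := norm_pos_iff.2 hx
  have h := (hasStrictFDerivAt_norm_sq x).hasFDerivAt.sqrt (by positivity)
  simp only [Real.sqrt_sq (norm_nonneg _)] at h
  convert h using 1
  ext v
  simp
  field_simp

/-- The derivative of a primitive in time of a compactly supported `C¹` function. -/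
lemma hasFDerivAt_time_primitive {E : Type*} [NormedAddCommGroup E] [NormedSpace ℝ E]
    {V : E × ℝ → ℝ} (hV : ContDiff ℝ 1 V)
    (hc : HasCompactSupport V) (p : E × ℝ) :
    HasFDerivAt (fun p : E × ℝ => ∫ t in (0:ℝ)..p.2, V (p.1, t))
      ((∫ t in (0:ℝ)..p.2, (fderiv ℝ V (p.1, t)).comp (.inl ℝ E ℝ)).coprod
        ((1 : ℝ →L[ℝ] ℝ).smulRight (V p))) p := by
  have hcV : Continuous V := hV.continuous
  have hcV' : Continuous (fderiv ℝ V) := hV.continuous_fderiv (by norm_num)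
  obtain ⟨C, hC⟩ := (hc.fderiv ℝ).exists_bound_of_continuous hcV'
  have hcD : Continuous fun q : E × ℝ => (fderiv ℝ V q).comp (.inl ℝ E ℝ) := by fun_prop
  have hcU : Continuous fun q : E × ℝ => (1 : ℝ →L[ℝ] ℝ).smulRight (V q) := by fun_prop
  have key := hasStrictFDerivAt_uncurry_coprod (𝕜 := ℝ) (u := p)
    (f := fun (x : E) (s : ℝ) => ∫ t in (0:ℝ)..s, V (x, t))
    (f₁ := fun (x : E) (s : ℝ) => ∫ t in (0:ℝ)..s, (fderiv ℝ V (x, t)).comp (.inl ℝ E ℝ))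
    (f₂ := fun (x : E) (s : ℝ) => (1 : ℝ →L[ℝ] ℝ).smulRight (V (x, s)))
    (.of_forall fun v => ?_) (.of_forall fun v => ?_)
    (intervalIntegral.continuous_parametric_primitive_of_continuous
      (f := fun x t => (fderiv ℝ V (x, t)).comp (.inl ℝ E ℝ)) (by fun_prop)).continuousAt
    hcU.continuousAt
  · exact key.hasFDerivAt
  · refine intervalIntegral.hasFDerivAt_integral_of_dominated_of_fderiv_le
      (F := fun x t => V (x, t)) (F' := fun x t => (fderiv ℝ V (x, t)).comp (.inl ℝ E ℝ))
      (bound := fun _ => C * ‖ContinuousLinearMap.inl ℝ E ℝ‖)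
      Filter.univ_mem (.of_forall fun x => ?_) ?_ ?_ ?_ ?_ ?_
    · exact Continuous.aestronglyMeasurable (by fun_prop)
    · exact Continuous.intervalIntegrable (by fun_prop) _ _
    · exact Continuous.aestronglyMeasurable (by fun_prop)
    · exact .of_forall fun t _ x _ => (ContinuousLinearMap.opNorm_comp_le _ _).trans
        (mul_le_mul_of_nonneg_right (hC _) (norm_nonneg _))
    · exact intervalIntegrable_const
    · exact .of_forall fun t _ x _ =>
        ((hV.differentiable one_ne_zero _).hasFDerivAt).comp x (hasFDerivAt_prodMk_left x t)
  · have := intervalIntegral.integral_hasDerivAt_right (f := fun t => V (v.1, t)) (a := 0)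
      (b := v.2) (Continuous.intervalIntegrable (by fun_prop) _ _)
      (Continuous.stronglyMeasurableAtFilter (by fun_prop) _ _)
      (Continuous.continuousAt (by fun_prop))
    exact this.hasFDerivAt

/-- The integral of `V` over the vertical segment of the truncated cone `‖x‖ ≤ t ≤ R` above `x`. -/
def coneFiber {E : Type*} [NormedAddCommGroup E] (R : ℝ) (V : E × ℝ → ℝ) (x : E) : ℝ :=
  ∫ t in (min ‖x‖ R)..R, V (x, t)

lemma coneFiber_eq_zero {E : Type*} [NormedAddCommGroup E] {R : ℝ} {V : E × ℝ → ℝ} {x : E}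
    (hx : R ≤ ‖x‖) :
    coneFiber R V x = 0 := by simp [coneFiber, hx]

lemma hasCompactSupport_coneFiber {E : Type*} [NormedAddCommGroup E] [ProperSpace E] (R : ℝ)
    (V : E × ℝ → ℝ) :
    HasCompactSupport (coneFiber R V) :=
  HasCompactSupport.intro (isCompact_closedBall (0 : E) R) fun x hx =>
    coneFiber_eq_zero (by simpa using (not_le.1 (by simpa using hx) : R < ‖x‖).le)

lemma exists_lipschitzWith_coneFiber {E : Type*} [NormedAddCommGroup E] [NormedSpace ℝ E] {R : ℝ}
    (hR : 0 < R) {V : E × ℝ → ℝ} (hV : ContDiff ℝ 1 V)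
    (hc : HasCompactSupport V) : ∃ C, LipschitzWith C (coneFiber R V) := by
  obtain ⟨L, hL⟩ := hV.lipschitzWith_of_hasCompactSupport hc one_ne_zero
  obtain ⟨B, hB⟩ := hc.exists_bound_of_continuous hV.continuous
  have hcV : Continuous V := hV.continuous
  refine ⟨_, LipschitzWith.of_dist_le' (K := R * L + B) fun x y => ?_⟩
  have hB0 : 0 ≤ B := (norm_nonneg _).trans (hB 0)
  have hint : ∀ (z : E) (a b : ℝ), IntervalIntegrable (fun t => V (z, t)) volume a b :=
    fun z a b => Continuous.intervalIntegrable (by fun_prop) _ _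
  have hsplit : coneFiber R V x - coneFiber R V y =
      (∫ t in (min ‖x‖ R)..R, (V (x, t) - V (y, t))) +
        ∫ t in (min ‖x‖ R)..(min ‖y‖ R), V (y, t) := by
    rw [intervalIntegral.integral_sub (hint _ _ _) (hint _ _ _),
      ← intervalIntegral.integral_add_adjacent_intervals (hint y (min ‖x‖ R) (min ‖y‖ R))
        (hint y _ R), coneFiber, coneFiber]
    ring
  have h1 : ‖∫ t in (min ‖x‖ R)..R, (V (x, t) - V (y, t))‖ ≤ (L * dist x y) * R := by
    refine (intervalIntegral.norm_integral_le_of_norm_le_const (C := L * dist x y)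
      fun t _ => ?_).trans ?_
    · have := hL.dist_le_mul (x, t) (y, t)
      simpa [Prod.dist_eq, Real.dist_eq] using this
    · refine mul_le_mul_of_nonneg_left ?_ (by positivity)
      have h0 : 0 ≤ min ‖x‖ R := le_min (norm_nonneg _) hR.le
      rw [abs_of_nonneg (by simp)]
      linarith
  have h2 : ‖∫ t in (min ‖x‖ R)..(min ‖y‖ R), V (y, t)‖ ≤ B * dist x y := by
    refine (intervalIntegral.norm_integral_le_of_norm_le_const (C := B) fun t _ => hB _).trans
      (mul_le_mul_of_nonneg_left ?_ hB0)
    have := abs_min_sub_min_le_max ‖y‖ R ‖x‖ R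
    simp only [sub_self, abs_zero] at this
    rw [dist_comm, dist_eq_norm]
    exact this.trans (max_le (abs_norm_sub_norm_le _ _) (norm_nonneg _))
  rw [Real.dist_eq, hsplit]
  calc _ ≤ _ := abs_add_le _ _
    _ ≤ _ := add_le_add h1 h2
    _ = _ := by ring

lemma lineDeriv_coneFiber {E : Type*} [NormedAddCommGroup E] [InnerProductSpace ℝ E] {R : ℝ}
    {V : E × ℝ → ℝ} (hV : ContDiff ℝ 1 V)
    (hc : HasCompactSupport V) {x : E} (hx : x ≠ 0) (hxR : ‖x‖ < R) (v : E) :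
    lineDeriv ℝ (coneFiber R V) x v =
      (∫ t in ‖x‖..R, fderiv ℝ V (x, t) (v, 0)) - V (x, ‖x‖) * (‖x‖⁻¹ * inner ℝ x v) := by
  have hcV : Continuous V := hV.continuous
  have hcV' : Continuous (fderiv ℝ V) := hV.continuous_fderiv (by norm_num)
  have hR' := HasFDerivAt.comp (f := fun y => (y, R)) x (hasFDerivAt_time_primitive hV hc (x, R))
    (hasFDerivAt_prodMk_left x R)
  have hN := HasFDerivAt.comp (f := fun y => (y, ‖y‖)) x
    (hasFDerivAt_time_primitive hV hc (x, ‖x‖))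
    ((hasFDerivAt_id x).prodMk (hasFDerivAt_norm_of_ne_zero hx))
  have hev : coneFiber R V =ᶠ[nhds x] fun y =>
      (∫ t in (0:ℝ)..R, V (y, t)) - ∫ t in (0:ℝ)..‖y‖, V (y, t) := by
    filter_upwards [continuous_norm.continuousAt.eventually_lt_const hxR] with y hy
    have hint : ∀ (a b : ℝ), IntervalIntegrable (fun t => V (y, t)) volume a b :=
      fun a b => Continuous.intervalIntegrable (by fun_prop) _ _
    rw [intervalIntegral.integral_interval_sub_left (hint _ _) (hint _ _), coneFiber,
      min_eq_left hy.le]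
  have hD := (hR'.sub hN).congr_of_eventuallyEq hev
  rw [(hD.hasLineDerivAt v).lineDeriv]
  have hint : ∀ (a b : ℝ), IntervalIntegrable
      (fun t => (fderiv ℝ V (x, t)).comp (.inl ℝ E ℝ)) volume a b :=
    fun a b => Continuous.intervalIntegrable (by fun_prop) _ _
  have hap : ∫ t in ‖x‖..R, fderiv ℝ V (x, t) (v, 0) =
      (∫ t in ‖x‖..R, (fderiv ℝ V (x, t)).comp (.inl ℝ E ℝ)) v := by
    rw [ContinuousLinearMap.intervalIntegral_apply (hint _ _)]
    simp
  rw [hap, ← intervalIntegral.integral_interval_sub_left (hint 0 R) (hint 0 ‖x‖)]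
  simp
  ring

lemma lineDeriv_coneFiber_of_lt {E : Type*} [NormedAddCommGroup E] [NormedSpace ℝ E] {R : ℝ}
    {V : E × ℝ → ℝ} {x : E} (hx : R < ‖x‖) (v : E) :
    lineDeriv ℝ (coneFiber R V) x v = 0 := by
  have hev : coneFiber R V =ᶠ[nhds x] fun _ => 0 := by
    filter_upwards [continuous_norm.continuousAt.eventually_const_lt hx] with y hy
    exact coneFiber_eq_zero hy.le
  rw [(((hasFDerivAt_const (0 : ℝ) x).congr_of_eventuallyEq hev).hasLineDerivAt v).lineDeriv]
  simp

lemma setIntegral_lineDeriv_coneFiber {E : Type*} [NormedAddCommGroup E] [NormedSpace ℝ E]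
    [FiniteDimensional ℝ E]
    [MeasurableSpace E] [BorelSpace E] (μ : Measure E) [μ.IsAddHaarMeasure] {R : ℝ} (hR : 0 < R)
    {V : E × ℝ → ℝ}
    (hV : ContDiff ℝ 1 V) (hc : HasCompactSupport V) (v : E) :
    ∫ x in closedBall (0 : E) R, lineDeriv ℝ (coneFiber R V) x v ∂μ = 0 := by
  obtain ⟨C, hC⟩ := exists_lipschitzWith_coneFiber hR hV hc
  rw [setIntegral_eq_integral_of_forall_compl_eq_zero fun x hx =>
    lineDeriv_coneFiber_of_lt (by simpa using hx) v]
  have h := (LipschitzWith.const (1 : ℝ)).integral_lineDeriv_mul_eq (μ := μ) hC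
    (hasCompactSupport_coneFiber R V) (-v)
  have h0 : ∀ x : E, lineDeriv ℝ (fun _ : E => (1 : ℝ)) x (-v) = 0 := fun x => by simp [lineDeriv]
  simpa [h0] using h.symm

lemma integrableOn_lineDeriv_coneFiber {E : Type*} [NormedAddCommGroup E] [NormedSpace ℝ E]
    [FiniteDimensional ℝ E]
    [MeasurableSpace E] [BorelSpace E] (μ : Measure E) [μ.IsAddHaarMeasure] {R : ℝ} (hR : 0 < R)
    {V : E × ℝ → ℝ}
    (hV : ContDiff ℝ 1 V) (hc : HasCompactSupport V) (v : E) :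
    IntegrableOn (fun x => lineDeriv ℝ (coneFiber R V) x v) (closedBall (0 : E) R) μ := by
  obtain ⟨C, hC⟩ := exists_lipschitzWith_coneFiber hR hV hc
  exact (hC.locallyIntegrable_lineDeriv v).integrableOn_isCompact (isCompact_closedBall _ _)

/-- The `i`-th spatial basis direction, seen as a space-time direction. -/
def spaceDir (i : Fin 3) : E3 × ℝ := (basis3 i, 0)

/-- The truncated solid light cone `‖x‖ ≤ t ≤ R`. -/
def truncCone (R : ℝ) : Set (E3 × ℝ) := {p | ‖p.1‖ ≤ p.2 ∧ p.2 ≤ R}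

lemma isClosed_truncCone (R : ℝ) : IsClosed (truncCone R) :=
  (isClosed_le (continuous_norm.comp continuous_fst) continuous_snd).inter
    (isClosed_le continuous_snd continuous_const)

lemma isCompact_truncCone (R : ℝ) : IsCompact (truncCone R) := by
  refine ((isCompact_closedBall (0 : E3) R).prod
    (isCompact_Icc (a := (0:ℝ)) (b := R))).of_isClosed_subset
    (isClosed_truncCone R) fun p hp => ?_
  exact ⟨by simpa using hp.1.trans hp.2, (norm_nonneg _).trans hp.1, hp.2⟩

lemma inner_basis3 (x : E3) (i : Fin 3) : inner ℝ x (basis3 i) = x i := by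
  simp [basis3, EuclideanSpace.inner_single_right]

lemma pdx_eq {u : E3 × ℝ → ℝ} {p : E3 × ℝ} (hu : DifferentiableAt ℝ u p) (i : Fin 3) :
    pdx i u p = fderiv ℝ u p (spaceDir i) := by
  have h := HasFDerivAt.comp (f := fun y => (y, p.2)) p.1 hu.hasFDerivAt
    (hasFDerivAt_prodMk_left p.1 p.2)
  have h' : fderiv ℝ (fixT u p.2) p.1 = _ := h.fderiv
  simp [pdx, pd, h', spaceDir]

lemma contDiff_fderiv_apply {u : E3 × ℝ → ℝ} (hu : ContDiff ℝ 2 u) (v : E3 × ℝ) :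
    ContDiff ℝ 1 fun p => fderiv ℝ u p v :=
  (hu.fderiv_right (m := 1) (by norm_num)).clm_apply contDiff_const

lemma lapX_eq_s19 {u : E3 × ℝ → ℝ} (hu : ContDiff ℝ 2 u) (p : E3 × ℝ) :
    lapX u p = ∑ i, fderiv ℝ (fun q => fderiv ℝ u q (spaceDir i)) p (spaceDir i) := by
  rw [lapX, lap]
  refine Finset.sum_congr rfl fun i _ => ?_
  rw [← pdx_eq ((contDiff_fderiv_apply hu _).differentiable one_ne_zero p)]
  have : pd i (fixT u p.2) = fixT (fun q => fderiv ℝ u q (spaceDir i)) p.2 :=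
    funext fun y => pdx_eq (hu.differentiable two_ne_zero (y, p.2)) i
  rw [this]
  rfl

lemma fderiv_fderiv_comm {u : E3 × ℝ → ℝ} (hu : ContDiff ℝ 2 u) (p v w : E3 × ℝ) :
    fderiv ℝ (fun q => fderiv ℝ u q v) p w = fderiv ℝ (fun q => fderiv ℝ u q w) p v := by
  have hd : DifferentiableAt ℝ (fderiv ℝ u) p :=
    (hu.fderiv_right (m := 1) (by norm_num)).differentiable one_ne_zero p
  have h : ∀ a b, fderiv ℝ (fun q => fderiv ℝ u q a) p b = fderiv ℝ (fderiv ℝ u) p b a := by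
    intro a b
    rw [fderiv_clm_apply hd (differentiableAt_const a)]
    simp
  rw [h, h]
  exact hu.contDiffAt.isSymmSndFDerivAt (by simp) w v

/-- The exponentially weighted energy density. -/
def energyDensity (k : ℝ) (u : E3 × ℝ → ℝ) (p : E3 × ℝ) : ℝ :=
  exp (k * p.2) * ((u p) ^ 2 + (pdt u p) ^ 2 + ∑ i, (fderiv ℝ u p (spaceDir i)) ^ 2) / 2

/-- The components of the exponentially weighted energy flux. -/
def energyFlux (k : ℝ) (u : E3 × ℝ → ℝ) (i : Fin 3) (p : E3 × ℝ) : ℝ :=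
  exp (k * p.2) * (pdt u p * fderiv ℝ u p (spaceDir i))

lemma contDiff_pdt {u : E3 × ℝ → ℝ} (hu : ContDiff ℝ 2 u) : ContDiff ℝ 1 (pdt u) :=
  contDiff_fderiv_apply hu (0, 1)

lemma contDiff_energyDensity (k : ℝ) {u : E3 × ℝ → ℝ} (hu : ContDiff ℝ 2 u) :
    ContDiff ℝ 1 (energyDensity k u) := by
  have h0 : ContDiff ℝ 1 u := hu.of_le (by norm_num)
  have h1 := contDiff_pdt hu
  have h2 := fun i => contDiff_fderiv_apply hu (spaceDir i)
  unfold energyDensity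
  fun_prop

lemma contDiff_energyFlux (k : ℝ) {u : E3 × ℝ → ℝ} (hu : ContDiff ℝ 2 u) (i : Fin 3) :
    ContDiff ℝ 1 (energyFlux k u i) := by
  have h1 := contDiff_pdt hu
  have h2 := contDiff_fderiv_apply hu (spaceDir i)
  unfold energyFlux
  fun_prop

lemma hasCompactSupport_energyFlux (k : ℝ) {u : E3 × ℝ → ℝ} (hc : HasCompactSupport u)
    (i : Fin 3) : HasCompactSupport (energyFlux k u i) :=
  ((hc.fderiv_apply ℝ (spaceDir i)).mul_left).mul_left

lemma hasFDerivAt_exp_time (k : ℝ) (p : E3 × ℝ) :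
    HasFDerivAt (fun p : E3 × ℝ => exp (k * p.2))
      (exp (k * p.2) • k • ContinuousLinearMap.snd ℝ E3 ℝ) p :=
  ((hasFDerivAt_snd (p := p)).const_mul k).exp

lemma energy_divergence (k : ℝ) {u : E3 × ℝ → ℝ} (hu : ContDiff ℝ 2 u) (p : E3 × ℝ) :
    fderiv ℝ (energyDensity k u) p (0, 1) - ∑ i, fderiv ℝ (energyFlux k u i) p (spaceDir i) =
      exp (k * p.2) * (k * ((u p) ^ 2 + (pdt u p) ^ 2 +
        ∑ i, (fderiv ℝ u p (spaceDir i)) ^ 2) / 2 + u p * pdt u p +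
        pdt u p * (pdt (pdt u) p - lapX u p)) := by
  have hE := hasFDerivAt_exp_time k p
  have h0 : HasFDerivAt u (fderiv ℝ u p) p := (hu.differentiable two_ne_zero p).hasFDerivAt
  have h1 := ((contDiff_pdt hu).differentiable one_ne_zero p).hasFDerivAt
  have h2 := fun i =>
    ((contDiff_fderiv_apply hu (spaceDir i)).differentiable one_ne_zero p).hasFDerivAt
  have hA : HasFDerivAt (energyDensity k u) _ p :=
    (hE.mul (((h0.pow 2).add (h1.pow 2)).add
      (HasFDerivAt.fun_sum fun i (_ : i ∈ Finset.univ) => (h2 i).pow 2))).mul_const (2:ℝ)⁻¹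
  have hV : ∀ i, HasFDerivAt (energyFlux k u i) _ p := fun i => hE.mul (h1.mul (h2 i))
  have hsymm : ∀ i, fderiv ℝ (fun q => fderiv ℝ u q (spaceDir i)) p (0, 1) =
      fderiv ℝ (pdt u) p (spaceDir i) := fun i => fderiv_fderiv_comm hu p _ _
  have ht : fderiv ℝ u p (0, 1) = pdt u p := rfl
  have htt : fderiv ℝ (pdt u) p (0, 1) = pdt (pdt u) p := rfl
  rw [hA.fderiv, lapX_eq_s19 hu]
  simp only [(hV _).fderiv]
  simp [Fin.sum_univ_three, hsymm, ht, htt]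
  simp [spaceDir]
  ring

lemma energy_divergence_ge {M : ℝ} {u : E3 × ℝ → ℝ} (hu : ContDiff ℝ 2 u) {p : E3 × ℝ}
    {q f : ℝ} (hq : |q| ≤ M) (hpde : pdt (pdt u) p - lapX u p - q * u p = f) :
    -(exp ((M + 2) * p.2) * f ^ 2 / 2) ≤ fderiv ℝ (energyDensity (M + 2) u) p (0, 1) -
      ∑ i, fderiv ℝ (energyFlux (M + 2) u i) p (spaceDir i) := by
  rw [energy_divergence _ hu, show pdt (pdt u) p - lapX u p = f + q * u p by linarith]
  have hS : 0 ≤ ∑ i, (fderiv ℝ u p (spaceDir i)) ^ 2 := Finset.sum_nonneg fun i _ => sq_nonneg _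
  have hM : 0 ≤ M := (abs_nonneg q).trans hq
  obtain ⟨hq1, hq2⟩ := abs_le.1 hq
  generalize ∑ i, (fderiv ℝ u p (spaceDir i)) ^ 2 = S at *
  generalize u p = a
  generalize pdt u p = b
  have key : -(f ^ 2 / 2) ≤ (M + 2) * (a ^ 2 + b ^ 2 + S) / 2 + a * b + b * (f + q * a) := by
    have h1 : 0 ≤ (M + q) * (a + b) ^ 2 := mul_nonneg (by linarith) (sq_nonneg _)
    have h2 : 0 ≤ (M - q) * (a - b) ^ 2 := mul_nonneg (by linarith) (sq_nonneg _)
    have h3 : 0 ≤ M * S := mul_nonneg hM hS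
    nlinarith [sq_nonneg (a + b), sq_nonneg (b + f), sq_nonneg a]
  calc _ = exp ((M + 2) * p.2) * -(f ^ 2 / 2) := by ring
    _ ≤ _ := mul_le_mul_of_nonneg_left key (exp_pos _).le

lemma trace_energy_eq {k : ℝ} {u : E3 × ℝ → ℝ} (hu : ContDiff ℝ 2 u) {x : E3} (hx : x ≠ 0) :
    energyDensity k u (x, ‖x‖) +
        ∑ i, energyFlux k u i (x, ‖x‖) * (‖x‖⁻¹ * inner ℝ x (basis3 i)) =
      exp (k * ‖x‖) * ((u (x, ‖x‖)) ^ 2 + gradsq (fun y => u (y, ‖y‖)) x) / 2 := by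
  have hd : HasFDerivAt (fun y : E3 => u (y, ‖y‖)) _ x :=
    HasFDerivAt.comp (f := fun y : E3 => (y, ‖y‖)) x
      (hu.differentiable two_ne_zero (x, ‖x‖)).hasFDerivAt
      ((hasFDerivAt_id x).prodMk (hasFDerivAt_norm_of_ne_zero hx))
  have hpd : ∀ i, pd i (fun y : E3 => u (y, ‖y‖)) x =
      fderiv ℝ u (x, ‖x‖) (spaceDir i) + ‖x‖⁻¹ * x i * pdt u (x, ‖x‖) := by
    intro i
    have hsplit : ((basis3 i, ‖x‖⁻¹ * x i) : E3 × ℝ) =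
        spaceDir i + (‖x‖⁻¹ * x i) • ((0, 1) : E3 × ℝ) := by simp [spaceDir]
    rw [pd, hd.fderiv]
    simp only [ContinuousLinearMap.comp_apply, ContinuousLinearMap.prod_apply,
      smul_apply, ContinuousLinearMap.id_apply, innerSL_apply_apply,
      inner_basis3, smul_eq_mul]
    rw [hsplit, map_add, map_smul]
    rfl
  have hn : (‖x‖⁻¹ * x 0) ^ 2 + (‖x‖⁻¹ * x 1) ^ 2 + (‖x‖⁻¹ * x 2) ^ 2 = 1 := by
    have h := EuclideanSpace.real_norm_sq_eq x
    rw [Fin.sum_univ_three] at h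
    have hpos : 0 < ‖x‖ := norm_pos_iff.2 hx
    field_simp
    linarith
  simp only [gradsq, energyDensity, energyFlux, hpd, inner_basis3, Fin.sum_univ_three]
  linear_combination (-(exp (k * ‖x‖) * pdt u (x, ‖x‖) ^ 2 / 2)) * hn

lemma trace_energy_le {R M : ℝ} (hM : 0 < M) {q : E3 → ℝ}
    (hq : ∀ x ∈ closedBall (0:E3) R, |q x| ≤ M) {u : E3 × ℝ → ℝ} (hu : ContDiff ℝ 2 u)
    (hc : HasCompactSupport u) {f : E3 × ℝ → ℝ} (hf : ContinuousOn f (truncCone R))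
    (hpde : ∀ p ∈ truncCone R, pdt (pdt u) p - lapX u p - q p.1 * u p = f p)
    {x : E3} (hx : x ≠ 0) (hxR : ‖x‖ < R) :
    ((u (x, ‖x‖)) ^ 2 + gradsq (fun y => u (y, ‖y‖)) x) / 2 ≤
      energyDensity (M + 2) u (x, R) +
        exp ((M + 2) * R) / 2 * (∫ t in Icc ‖x‖ R, (f (x, t)) ^ 2) -
        ∑ i, lineDeriv ℝ (coneFiber R (energyFlux (M + 2) u i)) x (basis3 i) := by
  set A := energyDensity (M + 2) u with hA
  set V := energyFlux (M + 2) u with hV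
  have hA1 : ContDiff ℝ 1 A := contDiff_energyDensity _ hu
  have hV1 : ∀ i, ContDiff ℝ 1 (V i) := contDiff_energyFlux _ hu
  have hcA : Continuous fun t => fderiv ℝ A (x, t) (0, 1) := by
    have := hA1.continuous_fderiv one_ne_zero
    fun_prop
  have hcV : ∀ i, Continuous fun t => fderiv ℝ (V i) (x, t) (spaceDir i) := fun i => by
    have := (hV1 i).continuous_fderiv one_ne_zero
    fun_prop
  have hftc : ∫ t in ‖x‖..R, fderiv ℝ A (x, t) (0, 1) = A (x, R) - A (x, ‖x‖) := by
    refine intervalIntegral.integral_eq_sub_of_hasDerivAt (f := fun t => A (x, t)) (fun t _ => ?_)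
      (hcA.intervalIntegrable _ _)
    exact (hA1.differentiable one_ne_zero (x, t)).hasFDerivAt.comp_hasDerivAt t
      ((hasDerivAt_const t x).prodMk (hasDerivAt_id t))
  have hfc : ContinuousOn (fun t => f (x, t)) (Icc ‖x‖ R) :=
    hf.comp (by fun_prop) fun t ht => ht
  have hfi : IntervalIntegrable (fun t => -(exp ((M + 2) * R) / 2 * (f (x, t)) ^ 2))
      volume ‖x‖ R := by
    refine ContinuousOn.intervalIntegrable ?_
    rw [uIcc_of_le hxR.le]
    exact ((hfc.pow 2).const_mul _).neg
  have hmono : ∫ t in ‖x‖..R, -(exp ((M + 2) * R) / 2 * (f (x, t)) ^ 2) ≤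
      ∫ t in ‖x‖..R, (fderiv ℝ A (x, t) (0, 1) - ∑ i, fderiv ℝ (V i) (x, t) (spaceDir i)) := by
    refine intervalIntegral.integral_mono_on hxR.le hfi
      (Continuous.intervalIntegrable (by fun_prop) _ _) fun t ht => ?_
    refine le_trans ?_ (energy_divergence_ge hu (hq x (by simpa using hxR.le)) (hpde (x, t) ht))
    have : exp ((M + 2) * t) ≤ exp ((M + 2) * R) :=
      exp_le_exp.2 (mul_le_mul_of_nonneg_left ht.2 (by linarith))
    nlinarith [mul_le_mul_of_nonneg_right this (sq_nonneg (f (x, t)))]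
  rw [intervalIntegral.integral_sub (hcA.intervalIntegrable _ _)
    (Continuous.intervalIntegrable (by fun_prop) _ _), hftc,
    intervalIntegral.integral_finsetSum fun i _ => (hcV i).intervalIntegrable _ _,
    intervalIntegral.integral_neg, intervalIntegral.integral_const_mul,
    intervalIntegral.integral_of_le hxR.le, ← integral_Icc_eq_integral_Ioc] at hmono
  have hline : ∑ i, lineDeriv ℝ (coneFiber R (V i)) x (basis3 i) =
      (∑ i, ∫ t in ‖x‖..R, fderiv ℝ (V i) (x, t) (spaceDir i)) -
        ∑ i, V i (x, ‖x‖) * (‖x‖⁻¹ * inner ℝ x (basis3 i)) := by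
    rw [← Finset.sum_sub_distrib]
    exact Finset.sum_congr rfl fun i _ => lineDeriv_coneFiber (hV1 i)
      (hasCompactSupport_energyFlux _ hc i) hx hxR _
  have htr := trace_energy_eq (k := M + 2) hu hx
  have hnn : 0 ≤ (u (x, ‖x‖)) ^ 2 + gradsq (fun y => u (y, ‖y‖)) x :=
    add_nonneg (sq_nonneg _) (Finset.sum_nonneg fun i _ => sq_nonneg _)
  have hexp : 1 ≤ exp ((M + 2) * ‖x‖) := one_le_exp (by positivity)
  have := mul_le_mul_of_nonneg_right hexp hnn
  rw [hline]
  linarith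

lemma integrable_fiber_integral {R : ℝ} {g : E3 × ℝ → ℝ} (hg : ContinuousOn g (truncCone R)) :
    Integrable (fun x : E3 => ∫ t in Icc ‖x‖ R, g (x, t)) ∧
      ∫ x : E3, (∫ t in Icc ‖x‖ R, g (x, t)) = ∫ p in truncCone R, g p := by
  have hm : MeasurableSet (truncCone R) := (isClosed_truncCone R).measurableSet
  have hi : Integrable ((truncCone R).indicator g) ((volume : Measure E3).prod volume) :=
    (integrable_indicator_iff hm).2 (hg.integrableOn_compact (isCompact_truncCone R))
  have heq : ∀ x : E3, ∫ t in Icc ‖x‖ R, g (x, t) = ∫ t, (truncCone R).indicator g (x, t) := by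
    intro x
    rw [← integral_indicator measurableSet_Icc]
    rfl
  simp only [heq]
  refine ⟨hi.integral_prod_left, ?_⟩
  rw [← integral_prod _ hi, ← integral_indicator hm]
  rfl

lemma energy_estimate_of_hasCompactSupport {R M : ℝ} (hR : 0 < R) (hM : 0 < M) {q : E3 → ℝ}
    (hq : ∀ x ∈ closedBall (0:E3) R, |q x| ≤ M) {u : E3 × ℝ → ℝ} (hu : ContDiff ℝ 2 u)
    (hc : HasCompactSupport u) {f : E3 × ℝ → ℝ} (hf : ContinuousOn f (truncCone R))
    (hpde : ∀ p ∈ truncCone R, pdt (pdt u) p - lapX u p - q p.1 * u p = f p) :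
    (∫ x in closedBall (0:E3) R, ((u (x, ‖x‖)) ^ 2 + gradsq (fun y => u (y, ‖y‖)) x)) ≤
      exp ((M + 2) * R) * ((∫ p in truncCone R, (f p) ^ 2) +
        ∫ x in closedBall (0:E3) R,
          ((u (x, R)) ^ 2 + gradsqX u (x, R) + (pdt u (x, R)) ^ 2)) := by
  set B := closedBall (0:E3) R
  obtain ⟨hFi, hF⟩ := integrable_fiber_integral (g := fun p => (f p) ^ 2) (hf.pow 2)
  have hFB : ∫ x in B, (∫ t in Icc ‖x‖ R, (f (x, t)) ^ 2) = ∫ p in truncCone R, (f p) ^ 2 := by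
    rw [← hF]
    refine setIntegral_eq_integral_of_forall_compl_eq_zero fun x hx => ?_
    rw [Icc_eq_empty (by simpa [B] using hx)]
    simp
  have hAi : IntegrableOn (fun x => energyDensity (M + 2) u (x, R)) B := by
    have := (contDiff_energyDensity (M + 2) hu).continuous
    exact (Continuous.continuousOn (by fun_prop)).integrableOn_compact (isCompact_closedBall _ _)
  have hA : ∫ x in B, energyDensity (M + 2) u (x, R) = exp ((M + 2) * R) / 2 *
      ∫ x in B, ((u (x, R)) ^ 2 + gradsqX u (x, R) + (pdt u (x, R)) ^ 2) := by
    rw [← integral_const_mul]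
    congr 1 with x
    have : gradsqX u (x, R) = ∑ i, (fderiv ℝ u (x, R) (spaceDir i)) ^ 2 := by
      simp only [← pdx_eq (hu.differentiable two_ne_zero (x, R))]
      rfl
    rw [this, energyDensity]
    ring
  have hLi : ∀ i ∈ Finset.univ, IntegrableOn (fun x =>
      lineDeriv ℝ (coneFiber R (energyFlux (M + 2) u i)) x (basis3 i)) B := fun i _ =>
    integrableOn_lineDeriv_coneFiber volume hR (contDiff_energyFlux _ hu i)
      (hasCompactSupport_energyFlux _ hc i) _
  have hL : ∫ x in B, ∑ i, lineDeriv ℝ (coneFiber R (energyFlux (M + 2) u i)) x (basis3 i) = 0 := by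
    rw [integral_finsetSum _ hLi]
    exact Finset.sum_eq_zero fun i _ => setIntegral_lineDeriv_coneFiber volume hR
      (contDiff_energyFlux _ hu i) (hasCompactSupport_energyFlux _ hc i) _
  have hgood : ∀ᵐ x ∂(volume.restrict B), x ≠ 0 ∧ ‖x‖ < R := by
    have h0 : ∀ᵐ x ∂(volume : Measure E3), x ∉ ({0} : Set E3) :=
      measure_eq_zero_iff_ae_notMem.1 (measure_singleton _)
    have hS : ∀ᵐ x ∂(volume : Measure E3), x ∉ sphere (0:E3) R :=
      measure_eq_zero_iff_ae_notMem.1 (Measure.addHaar_sphere _ _ _)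
    filter_upwards [ae_restrict_of_ae h0, ae_restrict_of_ae hS,
      ae_restrict_mem isClosed_closedBall.measurableSet] with x hx0 hxS hxB
    exact ⟨hx0, lt_of_le_of_ne (mem_closedBall_zero_iff.1 hxB) (by simpa using hxS)⟩
  have hmono := integral_mono_of_nonneg (μ := volume.restrict B)
    (f := fun x => ((u (x, ‖x‖)) ^ 2 + gradsq (fun y => u (y, ‖y‖)) x) / 2)
    (.of_forall fun x => div_nonneg (add_nonneg (sq_nonneg _)
      (Finset.sum_nonneg fun i _ => sq_nonneg _)) two_pos.le)
    ((hAi.add (hFi.integrableOn.const_mul (exp ((M + 2) * R) / 2))).sub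
      (integrable_finsetSum _ hLi))
    (hgood.mono fun x hx => by
      simpa using trace_energy_le hM hq hu hc hf hpde hx.1 hx.2)
  rw [integral_div, integral_sub' (hAi.add (hFi.integrableOn.const_mul _))
    (integrable_finsetSum _ hLi), integral_add' hAi (hFi.integrableOn.const_mul _), hL, hA,
    integral_const_mul, hFB] at hmono
  linarith

lemma exists_contDiff_hasCompactSupport_eventuallyEq {F : Type*} [NormedAddCommGroup F]
    [NormedSpace ℝ F] [FiniteDimensional ℝ F] {K S : Set F} (hK : IsCompact K) (hS : IsOpen S)
    (hKS : K ⊆ S) {u : F → ℝ} (hu : ContDiffOn ℝ 2 u S) :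
    ∃ v : F → ℝ, ContDiff ℝ 2 v ∧ HasCompactSupport v ∧ ∀ p ∈ K, v =ᶠ[nhds p] u := by
  obtain ⟨T, hT, hKT, hTS⟩ := exists_compact_between hK hS hKS
  obtain ⟨χ, h1, h0, -⟩ := exists_contMDiffMap_one_nhds_of_subset_interior (n := 2)
    (modelWithCornersSelf ℝ F) hK.isClosed hKT
  have hχ : ContDiff ℝ 2 χ := χ.contMDiff.contDiff
  refine ⟨fun p => χ p * u p, contDiff_iff_contDiffAt.2 fun p => ?_,
    HasCompactSupport.intro hT fun p hp => by simp [h0 p hp], fun p hp => ?_⟩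
  · by_cases hp : p ∈ S
    · exact hχ.contDiffAt.mul (hu.contDiffAt (hS.mem_nhds hp))
    · refine (contDiffAt_const (c := (0:ℝ))).congr_of_eventuallyEq ?_
      filter_upwards [hT.isClosed.isOpen_compl.mem_nhds fun h => hp (hTS h)] with y hy
      simp [h0 y hy]
  · filter_upwards [h1.filter_mono (nhds_le_nhdsSet hp)] with y hy
    simp [hy]

lemma pd_eventuallyEq {g h : E3 → ℝ} {x : E3} (hgh : g =ᶠ[nhds x] h) (i : Fin 3) :
    pd i g =ᶠ[nhds x] pd i h :=
  (hgh.fderiv (𝕜 := ℝ)).mono fun y hy => by simp [pd, hy]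

lemma gradsq_congr {g h : E3 → ℝ} {x : E3} (hgh : g =ᶠ[nhds x] h) : gradsq g x = gradsq h x :=
  Finset.sum_congr rfl fun i _ => by rw [(pd_eventuallyEq hgh i).eq_of_nhds]

lemma lap_congr {g h : E3 → ℝ} {x : E3} (hgh : g =ᶠ[nhds x] h) : lap g x = lap h x :=
  Finset.sum_congr rfl fun i _ => (pd_eventuallyEq (pd_eventuallyEq hgh i) i).eq_of_nhds

lemma fixT_eventuallyEq {u v : E3 × ℝ → ℝ} {p : E3 × ℝ} (h : v =ᶠ[nhds p] u) :
    fixT v p.2 =ᶠ[nhds p.1] fixT u p.2 :=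
  h.comp_tendsto (Continuous.tendsto (f := fun y : E3 => (y, p.2)) (by fun_prop) p.1)

lemma pdt_eventuallyEq {u v : E3 × ℝ → ℝ} {p : E3 × ℝ} (h : v =ᶠ[nhds p] u) :
    pdt v =ᶠ[nhds p] pdt u :=
  (h.fderiv (𝕜 := ℝ)).mono fun y hy => by simp [pdt, hy]

/-- **estimate (4.3).** Backward energy estimate on the region
`D⁻ = {|x| ≤ t ≤ R}`: the `H¹`-type norm of `ū(x) = u(x,|x|)` on the ball `|x| ≤ R` is
controlled by the source term and the energy at time `t = R`, with a constant depending
only on `M` and `R`. -/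
theorem stmt19 (R M : ℝ) (hR : 0 < R) (hM : 0 < M) :
    ∃ C > (0:ℝ), ∀ q : E3 → ℝ, ContinuousOn q (closedBall (0:E3) R) →
      (∀ x ∈ closedBall (0:E3) R, |q x| ≤ M) →
      ∀ (u : E3 × ℝ → ℝ) (S : Set (E3 × ℝ)), IsOpen S →
        {p : E3 × ℝ | ‖p.1‖ ≤ p.2 ∧ p.2 ≤ R} ⊆ S → ContDiffOn ℝ 2 u S →
      ∀ f : E3 × ℝ → ℝ, ContinuousOn f {p : E3 × ℝ | ‖p.1‖ ≤ p.2 ∧ p.2 ≤ R} →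
        (∀ p : E3 × ℝ, ‖p.1‖ ≤ p.2 → p.2 ≤ R →
          pdt (pdt u) p - lapX u p - q p.1 * u p = f p) →
        (∫ x in closedBall (0:E3) R,
            ((u (x, ‖x‖)) ^ 2 + gradsq (fun y => u (y, ‖y‖)) x))
          ≤ C * ((∫ p in {p : E3 × ℝ | ‖p.1‖ ≤ p.2 ∧ p.2 ≤ R}, (f p) ^ 2)
            + ∫ x in closedBall (0:E3) R,
                ((u (x, R)) ^ 2 + gradsqX u (x, R) + (pdt u (x, R)) ^ 2)) := by
  refine ⟨exp ((M + 2) * R), exp_pos _, fun q _ hq u S hS hDS hu f hf hpde => ?_⟩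
  obtain ⟨v, hv, hvc, hvu⟩ :=
    exists_contDiff_hasCompactSupport_eventuallyEq (isCompact_truncCone R) hS hDS hu
  have key := energy_estimate_of_hasCompactSupport hR hM hq hv hvc (f := f) hf fun p hp => by
    rw [(pdt_eventuallyEq (pdt_eventuallyEq (hvu p hp))).eq_of_nhds, (hvu p hp).eq_of_nhds,
      lapX, lap_congr (fixT_eventuallyEq (hvu p hp))]
    exact hpde p hp.1 hp.2
  have hbot : ∀ x ∈ closedBall (0:E3) R, v =ᶠ[nhds (x, ‖x‖)] u := fun x hx =>
    hvu _ ⟨le_rfl, by simpa using hx⟩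
  have htop : ∀ x ∈ closedBall (0:E3) R, v =ᶠ[nhds (x, R)] u := fun x hx =>
    hvu _ ⟨by simpa using hx, le_rfl⟩
  rw [setIntegral_congr_fun isClosed_closedBall.measurableSet fun x hx => by
      have hcomp : (fun y : E3 => v (y, ‖y‖)) =ᶠ[nhds x] fun y => u (y, ‖y‖) :=
        (hbot x hx).comp_tendsto
          (Continuous.tendsto (f := fun y : E3 => (y, ‖y‖)) (by fun_prop) x)
      show _ = (u (x, ‖x‖)) ^ 2 + gradsq (fun y => u (y, ‖y‖)) x
      simp only [(hbot x hx).eq_of_nhds, gradsq_congr hcomp],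
    setIntegral_congr_fun (f := fun x => (v (x, R)) ^ 2 + gradsqX v (x, R) + (pdt v (x, R)) ^ 2)
      isClosed_closedBall.measurableSet fun x hx => by
      show _ = (u (x, R)) ^ 2 + gradsqX u (x, R) + (pdt u (x, R)) ^ 2
      simp only [gradsqX, (htop x hx).eq_of_nhds, (pdt_eventuallyEq (htop x hx)).eq_of_nhds,
        gradsq_congr (fixT_eventuallyEq (htop x hx))]] at key
  exact key
end
end
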